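/- arXiv:math/0405196 — 4 statements merged into one kernel-verified Lean document; each statement's English description precedes it below -/
import Mathlib

section
/- Let d ≥ 2 and let x₁ < x₂ < … < x_{2d−2} be distinct real numbers, and let u_d = (1/d)·binom(2d−2, d−1) be the d-th Catalan number. Then there exist at least u_d pairwise nonequivalent rational functions of degree d with real coefficients whose set of critical points in the Riemann sphere is exactly {x₁, …, x_{2d−2}} (so all 2d−2 critical points are simple). -/
open Polynomial OnePoint

/-- The value of the rational function `f₁/f₀` at the point `∞` of the Riemann sphere. -/
noncomputable def ratAtInf (f₁ f₀ : ℂ[X]) : OnePoint ℂ :=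
  if f₀.degree < f₁.degree then ∞
  else ((f₁.coeff f₀.natDegree / f₀.leadingCoeff : ℂ) : OnePoint ℂ)

/-- The extension of the rational function `f₁/f₀` (ratio of two polynomials) to a self-map
of the Riemann sphere `ℂ̂ = ℂ ∪ {∞}`, realized as the one-point compactification of `ℂ`. -/
noncomputable def ratExt (f₁ f₀ : ℂ[X]) : OnePoint ℂ → OnePoint ℂ
  | ∞ => ratAtInf f₁ f₀
  | (z : ℂ) => if f₀.eval z = 0 then ∞ else ((f₁.eval z / f₀.eval z : ℂ) : OnePoint ℂ)

/-- A point `p` of the Riemann sphere is a critical point of `f` if `f` fails to be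
locally injective at `p`. -/
def IsCritPt (f : OnePoint ℂ → OnePoint ℂ) (p : OnePoint ℂ) : Prop :=
  ¬ ∃ U ∈ nhds p, Set.InjOn f U

/-- `(f₁, f₀)` represents a rational function of degree `d`: the two polynomials are
coprime and `max(deg f₁, deg f₀) = d`. -/
def IsRatOfDeg (d : ℕ) (f₁ f₀ : ℂ[X]) : Prop :=
  IsCoprime f₁ f₀ ∧ max f₁.degree f₀.degree = (d : ℕ)

/-- `f₁/f₀` and `g₁/g₀` are equivalent rational functions, i.e. `f₁/f₀ = ℓ∘(g₁/g₀)` for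
a fractional-linear transformation `ℓ(w) = (aw+b)/(cw+e)` with `ae − bc ≠ 0`; in terms of
the representing pairs this reads `f₁·(c g₁ + e g₀) = f₀·(a g₁ + b g₀)`. -/
def RatEquiv (f₁ f₀ g₁ g₀ : ℂ[X]) : Prop :=
  ∃ a b c e : ℂ, a * e - b * c ≠ 0 ∧ f₁ * (c • g₁ + e • g₀) = f₀ * (a • g₁ + b • g₀)

/-- `u_d = (1/d)·C(2d−2, d−1)`, the `d`-th Catalan number. -/
def ud (d : ℕ) : ℕ := (2 * d - 2).choose (d - 1) / d

namespace Gaudin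

variable {ι : Type*}

/-- The permutation action on functions of spin configurations; a configuration is the set of
flipped sites. -/
def permOp : Equiv.Perm ι →* Module.End ℝ (Finset ι → ℝ) where
  toFun σ :=
    { toFun := fun v s => v (s.map σ.symm.toEmbedding)
      map_add' := fun _ _ => rfl
      map_smul' := fun _ _ => rfl }
  map_one' := by
    ext v s
    simp only [LinearMap.coe_mk, AddHom.coe_mk]
    congr 1
    ext i
    simp [Finset.mem_map_equiv]
  map_mul' σ τ := by
    refine LinearMap.ext fun v => funext fun s => ?_
    simp only [LinearMap.coe_mk, AddHom.coe_mk, Module.End.mul_apply]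
    congr 1
    ext i
    simp [Finset.mem_map_equiv, Equiv.Perm.mul_apply]

lemma permOp_apply (σ : Equiv.Perm ι) (v : Finset ι → ℝ) (s : Finset ι) :
    permOp σ v s = v (s.map σ.symm.toEmbedding) := rfl

variable [DecidableEq ι]

lemma map_swap_eq_self {s : Finset ι} {i j : ι} (h : i ∈ s ↔ j ∈ s) :
    s.map (Equiv.swap i j).symm.toEmbedding = s := by
  ext k
  rw [Finset.mem_map_equiv]
  simp only [Equiv.symm_symm, Equiv.swap_apply_def]
  split_ifs with h1 h2
  · rw [h1, h]
  · rw [h2, h]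
  · rfl

lemma map_swap_of_mem_of_notMem {s : Finset ι} {i j : ι} (hi : i ∈ s) (hj : j ∉ s) :
    s.map (Equiv.swap i j).symm.toEmbedding = insert j (s.erase i) := by
  have hij : i ≠ j := fun h => hj (h ▸ hi)
  ext k
  rw [Finset.mem_map_equiv, Finset.mem_insert, Finset.mem_erase]
  simp only [Equiv.symm_symm, Equiv.swap_apply_def]
  split_ifs with h1 h2
  · subst h1; simp [hj, hij]
  · subst h2; simp [hi]
  · simp [h1, h2]

/-- The operator exchanging the spins at two sites, minus the identity. -/
def exch (i j : ι) : Module.End ℝ (Finset ι → ℝ) := permOp (Equiv.swap i j) - 1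

lemma exch_comm (i j : ι) : exch i j = exch j i := by
  rw [exch, exch, Equiv.swap_comm]

@[simp] lemma exch_self (i : ι) : exch i i = 0 := by
  rw [exch, Equiv.swap_self, ← Equiv.Perm.one_def, map_one, sub_self]

lemma exch_apply (i j : ι) (v : Finset ι → ℝ) (s : Finset ι) :
    exch i j v s = v (s.map (Equiv.swap i j).symm.toEmbedding) - v s := rfl

/-- The operator `v ↦ (s ↦ v (s ∪ {i}))`, vanishing at configurations containing `i`. -/
def lowering (i : ι) : Module.End ℝ (Finset ι → ℝ) where
  toFun v s := if i ∈ s then 0 else v (insert i s)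
  map_add' v w := by ext s; by_cases h : i ∈ s <;> simp [h]
  map_smul' c v := by ext s; by_cases h : i ∈ s <;> simp [h]

lemma lowering_apply (i : ι) (v : Finset ι → ℝ) (s : Finset ι) :
    lowering i v s = if i ∈ s then 0 else v (insert i s) := rfl

/-- The operator `v ↦ (s ↦ v (s \ {i}))`, vanishing at configurations not containing `i`. -/
def raising (i : ι) : Module.End ℝ (Finset ι → ℝ) where
  toFun v s := if i ∈ s then v (s.erase i) else 0
  map_add' v w := by ext s; by_cases h : i ∈ s <;> simp [h]
  map_smul' c v := by ext s; by_cases h : i ∈ s <;> simp [h]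

lemma raising_apply (i : ι) (v : Finset ι → ℝ) (s : Finset ι) :
    raising i v s = if i ∈ s then v (s.erase i) else 0 := rfl

lemma permOp_mul_lowering (σ : Equiv.Perm ι) (i : ι) :
    permOp σ * lowering i = lowering (σ i) * permOp σ := by
  refine LinearMap.ext fun v => funext fun s => ?_
  simp only [Module.End.mul_apply, permOp_apply, lowering_apply, Finset.mem_map_equiv,
    Equiv.symm_symm, Finset.map_insert, Equiv.coe_toEmbedding, Equiv.symm_apply_apply]

lemma lowering_mul_comm (i j : ι) : lowering i * lowering j = lowering j * lowering i := by
  refine LinearMap.ext fun v => funext fun s => ?_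
  simp only [Module.End.mul_apply, lowering_apply, Finset.mem_insert]
  by_cases hij : i = j
  · subst hij; rfl
  · by_cases hi : i ∈ s <;> by_cases hj : j ∈ s <;>
      simp [hi, hj, hij, Ne.symm hij, Finset.insert_comm]

lemma exch_mul_exch_of_disjoint {i j k l : ι} (h1 : i ≠ k) (h2 : i ≠ l) (h3 : j ≠ k)
    (h4 : j ≠ l) : exch i j * exch k l = exch k l * exch i j := by
  have h : permOp (Equiv.swap i j) * permOp (Equiv.swap k l)
      = permOp (Equiv.swap k l) * permOp (Equiv.swap i j) := by
    rw [← map_mul, ← map_mul, Equiv.mul_swap_eq_swap_mul,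
      Equiv.swap_apply_of_ne_of_ne h1.symm h3.symm, Equiv.swap_apply_of_ne_of_ne h2.symm h4.symm]
  rw [exch, exch, sub_mul, mul_sub, mul_sub, sub_mul, mul_sub, mul_sub, h]
  simp only [mul_one, one_mul]
  abel

/-- Products of two transpositions of three sites are the two cyclic permutations. -/
lemma permOp_swap_mul_rotate {i j k : ι} (hij : i ≠ j) (hik : i ≠ k) :
    permOp (Equiv.swap i j) * permOp (Equiv.swap j k)
      = permOp (Equiv.swap j k) * permOp (Equiv.swap k i) := by
  rw [← map_mul, ← map_mul, Equiv.swap_mul_eq_mul_swap, Equiv.swap_inv, Equiv.swap_apply_left,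
    Equiv.swap_apply_of_ne_of_ne hij hik, Equiv.swap_comm j k, Equiv.swap_comm i k]

/-- The three ways of writing a cyclic permutation of three sites. -/
lemma permOp_swap_mul_cycle {i j k : ι} (hij : i ≠ j) (hik : i ≠ k) (hjk : j ≠ k) :
    permOp (Equiv.swap i j) * permOp (Equiv.swap j k)
        = permOp (Equiv.swap j k) * permOp (Equiv.swap i k) ∧
      permOp (Equiv.swap i j) * permOp (Equiv.swap j k)
        = permOp (Equiv.swap i k) * permOp (Equiv.swap i j) := by
  have h1 := permOp_swap_mul_rotate hij hik
  have h2 := permOp_swap_mul_rotate hjk hij.symm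
  rw [Equiv.swap_comm k i] at h1 h2
  exact ⟨h1, h1.trans h2⟩

lemma exch_bracket_sum {x : ι → ℝ} (hx : Function.Injective x) {i k t : ι} (hik : i ≠ k)
    (hit : i ≠ t) (hkt : k ≠ t) :
    ((x i - x t)⁻¹ * (x k - x t)⁻¹) • (exch i t * exch k t - exch k t * exch i t)
      + ((x i - x k)⁻¹ * (x k - x t)⁻¹) • (exch i k * exch k t - exch k t * exch i k)
      + ((x i - x t)⁻¹ * (x k - x i)⁻¹) • (exch i t * exch k i - exch k i * exch i t) = 0 := by
  obtain ⟨h1, h2⟩ := permOp_swap_mul_cycle hik hit hkt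
  obtain ⟨g1, g2⟩ := permOp_swap_mul_cycle hik.symm hkt hit
  rw [Equiv.swap_comm k i] at g1 g2
  have a1 : x i - x k ≠ 0 := sub_ne_zero.2 (hx.ne hik)
  have a2 : x i - x t ≠ 0 := sub_ne_zero.2 (hx.ne hit)
  have a3 : x k - x t ≠ 0 := sub_ne_zero.2 (hx.ne hkt)
  have a4 : x k - x i ≠ 0 := sub_ne_zero.2 (hx.ne hik.symm)
  have hc : (x i - x k)⁻¹ * (x k - x t)⁻¹ - (x i - x t)⁻¹ * (x k - x t)⁻¹
      + (x i - x t)⁻¹ * (x k - x i)⁻¹ = 0 := by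
    rw [← neg_sub (x i) (x k), inv_neg]
    field_simp
    ring
  rw [exch_comm k i]
  simp only [exch]
  set a := permOp (Equiv.swap i k)
  set b := permOp (Equiv.swap k t)
  set d := permOp (Equiv.swap i t)
  have e (p q : Module.End ℝ (Finset ι → ℝ)) :
      (p - 1) * (q - 1) - (q - 1) * (p - 1) = p * q - q * p := by
    simp only [sub_mul, mul_sub, mul_one, one_mul]
    abel
  have e1 : (d - 1) * (b - 1) - (b - 1) * (d - 1) = -(a * b - b * a) := by
    rw [e, ← h1, ← g1, g2, neg_sub]
  have e2 : (a - 1) * (b - 1) - (b - 1) * (a - 1) = a * b - b * a := e a b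
  have e3 : (d - 1) * (a - 1) - (a - 1) * (d - 1) = a * b - b * a := by
    rw [e, ← h2, g2]
  rw [e1, e2, e3, smul_neg, ← neg_smul, ← add_smul, ← add_smul]
  rw [show -((x i - x t)⁻¹ * (x k - x t)⁻¹) + (x i - x k)⁻¹ * (x k - x t)⁻¹
      + (x i - x t)⁻¹ * (x k - x i)⁻¹ = 0 by linarith, zero_smul]

/-- Two transpositions with a common site satisfy the spin `1/2` relation. -/
lemma permOp_swap_anticommutator {i j k : ι} (hij : i ≠ j) (hik : i ≠ k) (hjk : j ≠ k) :
    permOp (Equiv.swap i j) * permOp (Equiv.swap i k)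
      + permOp (Equiv.swap i k) * permOp (Equiv.swap i j)
      = permOp (Equiv.swap i j) + permOp (Equiv.swap i k) + permOp (Equiv.swap j k) - 1 := by
  obtain ⟨h1, h2⟩ := permOp_swap_mul_cycle hij hik hjk
  obtain ⟨g1, g2⟩ := permOp_swap_mul_cycle hij.symm hjk hik
  rw [Equiv.swap_comm j i] at g1 g2
  refine LinearMap.ext fun v => funext fun s => ?_
  have key : ∀ (p q : ι) (w : Finset ι → ℝ), (p ∈ s ↔ q ∈ s) →
      permOp (Equiv.swap p q) w s = w s := by
    intro p q w h
    rw [permOp_apply, map_swap_eq_self h]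
  have hcases : (i ∈ s ↔ j ∈ s) ∨ (i ∈ s ↔ k ∈ s) ∨ (j ∈ s ↔ k ∈ s) := by tauto
  rcases hcases with h | h | h
  · rw [← h2]
    simp only [LinearMap.add_apply, LinearMap.sub_apply, Pi.add_apply, Pi.sub_apply,
      Module.End.mul_apply, Module.End.one_apply, key i j _ h]
    ring
  · rw [g1]
    simp only [LinearMap.add_apply, LinearMap.sub_apply, Pi.add_apply, Pi.sub_apply,
      Module.End.mul_apply, Module.End.one_apply, key i k _ h]
    ring
  · rw [g2, ← h2, h1]
    simp only [LinearMap.add_apply, LinearMap.sub_apply, Pi.add_apply, Pi.sub_apply,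
      Module.End.mul_apply, Module.End.one_apply, key j k _ h]
    ring

variable [Fintype ι]

/-- The Gaudin Hamiltonians. -/
noncomputable def hamiltonian (x : ι → ℝ) (i : ι) : Module.End ℝ (Finset ι → ℝ) :=
  ∑ j, (x i - x j)⁻¹ • exch i j

lemma hamiltonian_commute {x : ι → ℝ} (hx : Function.Injective x) (i k : ι) :
    hamiltonian x i * hamiltonian x k = hamiltonian x k * hamiltonian x i := by
  by_cases hik : i = k
  · rw [hik]
  rw [← sub_eq_zero]
  let B : ι → ι → Module.End ℝ (Finset ι → ℝ) := fun j l =>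
    ((x i - x j)⁻¹ * (x k - x l)⁻¹) • (exch i j * exch k l - exch k l * exch i j)
  have hB : hamiltonian x i * hamiltonian x k - hamiltonian x k * hamiltonian x i
      = ∑ j, ∑ l, B j l := by
    simp only [hamiltonian, Finset.sum_mul_sum, B]
    rw [Finset.sum_comm (f := fun a b => (x k - x a)⁻¹ • exch k a * (x i - x b)⁻¹ • exch i b),
      ← Finset.sum_sub_distrib]
    refine Finset.sum_congr rfl fun j _ => ?_
    rw [← Finset.sum_sub_distrib]
    refine Finset.sum_congr rfl fun l _ => ?_
    rw [smul_mul_smul_comm, smul_mul_smul_comm, smul_sub, mul_comm (x k - x l)⁻¹]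
  have hsupp : ∀ j l, B j l = (if l = j then B j l else 0) + (if j = k then B j l else 0)
      + (if l = i then B j l else 0) := by
    intro j l
    by_cases h1 : l = j
    · subst h1
      by_cases h2 : l = k
      · subst h2; simp [B]
      · by_cases h3 : l = i
        · subst h3; simp [B]
        · simp [h2, h3]
    · by_cases h2 : j = k
      · subst h2
        by_cases h3 : l = i
        · subst h3; simp [B, exch_comm j l]
        · simp [h1, h3]
      · by_cases h3 : l = i
        · simp [h2, h3, show i ≠ j from h3 ▸ h1]
        · rw [if_neg h1, if_neg h2, if_neg h3, add_zero, add_zero]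
          simp only [B]
          rw [exch_mul_exch_of_disjoint hik (Ne.symm h3) h2 (Ne.symm h1), sub_self, smul_zero]
  have hsum : ∑ j, ∑ l, B j l = ∑ t, (B t t + B k t + B t i) := by
    rw [Finset.sum_congr rfl fun j _ => Finset.sum_congr rfl fun l _ => hsupp j l]
    simp only [Finset.sum_add_distrib]
    congr 1
    · congr 1
      · simp
      · rw [Finset.sum_comm]; simp
    · simp
  rw [hB, hsum]
  refine Finset.sum_eq_zero fun t _ => ?_
  by_cases hit : i = t
  · subst hit; simp [B, exch_comm k i]
  by_cases hkt : k = t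
  · subst hkt; simp [B, exch_comm i k]
  exact exch_bracket_sum hx hik hit hkt

omit [Fintype ι] in
lemma exch_mul_self (i j : ι) : exch i j * exch i j = (-2 : ℝ) • exch i j := by
  have h : permOp (Equiv.swap i j) * permOp (Equiv.swap i j) = 1 := by
    rw [← map_mul, Equiv.swap_mul_self, map_one]
  simp only [exch, sub_mul, mul_sub, h, mul_one, one_mul]
  module

omit [Fintype ι] in
lemma exch_anticommutator {i j k : ι} (hij : i ≠ j) (hik : i ≠ k) (hjk : j ≠ k) :
    exch i j * exch i k + exch i k * exch i j = exch j k - exch i j - exch i k := by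
  have h := permOp_swap_anticommutator hij hik hjk
  simp only [exch, sub_mul, mul_sub, mul_one, one_mul]
  rw [← sub_eq_zero] at h ⊢
  rw [← h]
  abel

/-- The quadratic relations between the Gaudin Hamiltonians. -/
lemma hamiltonian_mul_self {x : ι → ℝ} (hx : Function.Injective x) (i : ι) :
    hamiltonian x i * hamiltonian x i
      + ∑ k, (x i - x k)⁻¹ • (hamiltonian x i - hamiltonian x k) = 0 := by
  have hne {k l : ι} (h : k ≠ l) : x k - x l ≠ 0 := sub_ne_zero.2 (hx.ne h)
  set c : ι → ι → ℝ := fun k l => (x k - x l)⁻¹ with hc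
  have hcs (k : ι) : c k k = 0 := by simp [c]
  have hca (k l : ι) : c k l = - c l k := by
    simp only [c]; rw [← neg_sub (x l), inv_neg]
  have hH (k : ι) : hamiltonian x k = ∑ l, c k l • exch k l := rfl
  have h1 (j k : ι) : (c i j * c i k) • (exch i j * exch i k + exch i k * exch i j)
      = (c i j * c i k) • exch j k - c i k • (c i j • exch i j) - c i j • (c i k • exch i k)
        - (if j = k then (2 * c i j ^ 2) • exch i j else 0) := by
    by_cases hij : i = j
    · subst hij; simp [hcs]
    by_cases hik : i = k
    · subst hik; simp [hcs, Ne.symm hij]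
    by_cases hjk : j = k
    · subst hjk
      rw [exch_mul_self, if_pos rfl, exch_self]
      module
    · rw [exch_anticommutator hij hik hjk, if_neg hjk]
      module
  have h2 (k l : ι) : (c i k * c k l + c i l * c l k) • exch k l
      = (c i k * c i l) • exch k l - (if k = i then c i l ^ 2 • exch i l else 0)
        - (if l = i then c i k ^ 2 • exch i k else 0) := by
    by_cases hkl : k = l
    · subst hkl
      by_cases hki : k = i
      · subst hki; simp
      · simp [hki]
    by_cases hki : k = i
    · subst hki
      rw [if_pos rfl, if_neg (Ne.symm hkl), hcs, hca l k]
      module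
    by_cases hli : l = i
    · subst hli
      rw [if_neg hki, if_pos rfl, hcs, hca k l, exch_comm k l]
      module
    · rw [if_neg hki, if_neg hli, sub_zero, sub_zero]
      congr 1
      have := hne (Ne.symm hki)
      have := hne (Ne.symm hli)
      have := hne hkl
      rw [hca l k]
      simp only [c]
      field_simp
      ring
  have h3 : (2 : ℝ) • (hamiltonian x i * hamiltonian x i)
      = ∑ j, ∑ k, (c i j * c i k) • (exch i j * exch i k + exch i k * exch i j) := by
    simp only [smul_add, Finset.sum_add_distrib]
    rw [Finset.sum_comm (f := fun j k => (c i j * c i k) • (exch i k * exch i j)), two_smul, hH,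
      Finset.sum_mul_sum]
    congr 1
    · simp only [smul_mul_smul_comm]
    · refine Finset.sum_congr rfl fun j _ => Finset.sum_congr rfl fun k _ => ?_
      rw [smul_mul_smul_comm, mul_comm]
  have h4 : (2 : ℝ) • ∑ k, c i k • hamiltonian x k
      = ∑ k, ∑ l, (c i k * c k l + c i l * c l k) • exch k l := by
    simp only [add_smul, Finset.sum_add_distrib]
    rw [Finset.sum_comm (f := fun k l => (c i l * c l k) • exch k l), two_smul]
    simp only [hH, Finset.smul_sum, smul_smul]
    congr 1
    exact Finset.sum_congr rfl fun k _ => Finset.sum_congr rfl fun l _ => by rw [exch_comm]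
  have h5 : ∑ j, ∑ k, c i j • (c i k • exch i k) = (∑ j, c i j) • hamiltonian x i := by
    simp only [← Finset.smul_sum, ← hH, Finset.sum_smul]
  have h6 : ∑ j, ∑ k, c i k • (c i j • exch i j) = (∑ j, c i j) • hamiltonian x i := by
    rw [Finset.sum_comm, h5]
  simp only [h1, Finset.sum_sub_distrib, h5, h6, Finset.sum_ite_eq, Finset.mem_univ, if_true]
    at h3
  have h7 : ∑ k, ∑ l, (if k = i then c i l ^ 2 • exch i l else 0)
      = ∑ l, c i l ^ 2 • exch i l := by
    rw [Finset.sum_comm]; simp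
  simp only [h2, Finset.sum_sub_distrib, h7, Finset.sum_ite_eq', Finset.mem_univ, if_true] at h4
  have h8 : ∑ k, (2 * c i k ^ 2) • exch i k = (2 : ℝ) • ∑ k, c i k ^ 2 • exch i k := by
    simp only [Finset.smul_sum, smul_smul]
  rw [h8] at h3
  refine (smul_eq_zero_iff_right (two_ne_zero (α := ℝ))).1 ?_
  rw [smul_add, h3]
  simp only [smul_sub, Finset.sum_sub_distrib, ← Finset.sum_smul]
  rw [h4]
  module

lemma sum_hamiltonian (x : ι → ℝ) : ∑ i, hamiltonian x i = 0 := by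
  have h : ∑ i, hamiltonian x i = - ∑ i, hamiltonian x i := by
    conv_lhs => simp only [hamiltonian]
    rw [Finset.sum_comm]
    simp only [hamiltonian, ← Finset.sum_neg_distrib]
    refine Finset.sum_congr rfl fun i _ => Finset.sum_congr rfl fun j _ => ?_
    rw [exch_comm, ← neg_sub (x i), inv_neg]
    module
  rw [eq_neg_iff_add_eq_zero, ← two_smul ℝ] at h
  exact (smul_eq_zero_iff_right two_ne_zero).1 h

lemma two_smul_sum_smul_hamiltonian {x : ι → ℝ} (hx : Function.Injective x) :
    (2 : ℝ) • ∑ i, x i • hamiltonian x i = ∑ i, ∑ j, exch i j := by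
  have h : (2 : ℝ) • ∑ i, x i • hamiltonian x i
      = ∑ i, ∑ j, (x i * (x i - x j)⁻¹ + x j * (x j - x i)⁻¹) • exch i j := by
    simp only [add_smul, Finset.sum_add_distrib]
    rw [Finset.sum_comm (f := fun i j => (x j * (x j - x i)⁻¹) • exch i j), two_smul]
    simp only [hamiltonian, Finset.smul_sum, smul_smul]
    congr 1
    exact Finset.sum_congr rfl fun i _ => Finset.sum_congr rfl fun j _ => by rw [exch_comm]
  rw [h]
  refine Finset.sum_congr rfl fun i _ => Finset.sum_congr rfl fun j _ => ?_
  by_cases hij : i = j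
  · subst hij; simp
  · have h1 : x i - x j ≠ 0 := sub_ne_zero.2 (hx.ne hij)
    have h2 : x j - x i ≠ 0 := sub_ne_zero.2 (hx.ne (Ne.symm hij))
    rw [show x i * (x i - x j)⁻¹ + x j * (x j - x i)⁻¹ = 1 by
      rw [← neg_sub (x i) (x j), inv_neg]; field_simp; ring, one_smul]

/-- On configurations of a given size, the product of the total raising and lowering operators
is the Casimir operator up to a scalar. -/
lemma sum_raising_mul_sum_lowering_apply (v : Finset ι → ℝ) (s : Finset ι) :
    2 * (∑ i, raising i) ((∑ i, lowering i) v) s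
      = (∑ i, ∑ j, exch i j) v s
        + 2 * (s.card * (Fintype.card ι - s.card + 1)) * v s := by
  let T : ι → ι → ℝ := fun i j => v (insert j (s.erase i)) - v s
  let A : ι → ι → ℝ := fun i j => if i ∈ s then (if j ∈ s then 0 else T i j) else 0
  have h1 (i j : ι) : exch i j v s = A i j + A j i := by
    by_cases hi : i ∈ s <;> by_cases hj : j ∈ s
    · rw [exch_apply, map_swap_eq_self (by tauto)]; simp [A, hi, hj]
    · rw [exch_apply, map_swap_of_mem_of_notMem hi hj]; simp [A, hi, hj, T]
    · rw [exch_comm, exch_apply, map_swap_of_mem_of_notMem hj hi]; simp [A, hi, hj, T]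
    · rw [exch_apply, map_swap_eq_self (by tauto)]; simp [A, hi, hj]
  have h2 : (∑ i, ∑ j, exch i j) v s = 2 * ∑ i, ∑ j, A i j := by
    simp only [LinearMap.sum_apply, Finset.sum_apply, h1, Finset.sum_add_distrib]
    rw [Finset.sum_comm (f := fun i j => A j i), two_mul]
  have h3 (i : ι) (hi : i ∈ s) : ∑ j, lowering j v (s.erase i)
      = ∑ j, A i j + (Fintype.card ι - s.card + 1) * v s := by
    have h4 (j : ι) : lowering j v (s.erase i)
        = A i j + ((if j ∈ s then 0 else v s) + if j = i then v s else 0) := by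
      rw [lowering_apply]
      by_cases hji : j = i
      · subst hji; simp [A, hi]
      · by_cases hj : j ∈ s
        · simp [A, hi, hji, hj]
        · simp [A, hi, hji, hj, T]
    simp only [h4, Finset.sum_add_distrib]
    have h5 : ∑ j, (if j ∈ s then 0 else v s) = (Fintype.card ι - s.card) * v s := by
      rw [Finset.sum_ite, Finset.sum_const_zero, zero_add, Finset.sum_const, nsmul_eq_mul]
      congr 1
      rw [eq_sub_iff_add_eq, ← Nat.cast_add, Finset.filter_not, Finset.filter_mem_eq_inter,
        Finset.univ_inter, ← Finset.compl_eq_univ_sdiff, Finset.card_compl_add_card]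
    rw [h5]
    simp
    ring
  have h6 : (∑ i, raising i) ((∑ i, lowering i) v) s
      = ∑ i, (∑ j, A i j + if i ∈ s then (Fintype.card ι - s.card + 1) * v s else 0) := by
    rw [LinearMap.sum_apply, Finset.sum_apply]
    refine Finset.sum_congr rfl fun i _ => ?_
    rw [raising_apply, LinearMap.sum_apply, Finset.sum_apply]
    by_cases hi : i ∈ s
    · rw [if_pos hi, if_pos hi, h3 i hi]
    · simp [hi, A]
  rw [h6, h2, Finset.sum_add_distrib, Finset.sum_ite_mem, Finset.univ_inter, Finset.sum_const,
    nsmul_eq_mul]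
  ring

lemma hamiltonian_mul_lowering (x : ι → ℝ) {i k : ι} (hik : i ≠ k) :
    hamiltonian x i * lowering k = lowering k * hamiltonian x i
      + (x i - x k)⁻¹ • ((lowering i - lowering k) * permOp (Equiv.swap i k)) := by
  have h (j : ι) : (x i - x j)⁻¹ • exch i j * lowering k
      = lowering k * ((x i - x j)⁻¹ • exch i j)
        + if j = k then (x i - x j)⁻¹ • ((lowering i - lowering k) * permOp (Equiv.swap i k))
          else 0 := by
    rw [smul_mul_assoc, mul_smul_comm]
    by_cases hjk : j = k
    · subst hjk
      rw [if_pos rfl, exch, sub_mul, permOp_mul_lowering, Equiv.swap_apply_right, mul_sub,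
        sub_mul, one_mul, mul_one]
      module
    · rw [if_neg hjk, exch, sub_mul, permOp_mul_lowering,
        Equiv.swap_apply_of_ne_of_ne (Ne.symm hik) (Ne.symm hjk), mul_sub, one_mul, mul_one,
        add_zero]
  simp only [hamiltonian, Finset.sum_mul, h, Finset.sum_add_distrib, Finset.mul_sum,
    Finset.sum_ite_eq', Finset.mem_univ, if_true]

/-- The operators whose common kernel lifts joint eigenvectors of the Hamiltonians. -/
noncomputable def twisted (x h : ι → ℝ) (i : ι) : Module.End ℝ (Finset ι → ℝ) :=
  hamiltonian x i + lowering i - h i • 1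

lemma twisted_commute {x : ι → ℝ} (hx : Function.Injective x) (h : ι → ℝ) (i k : ι) :
    twisted x h i * twisted x h k = twisted x h k * twisted x h i := by
  by_cases hik : i = k
  · rw [hik]
  have h1 := hamiltonian_mul_lowering x hik
  have h2 := hamiltonian_mul_lowering x (Ne.symm hik)
  have h3 := hamiltonian_commute hx i k
  have h4 := lowering_mul_comm i k
  rw [Equiv.swap_comm k i, ← neg_sub (x i), inv_neg] at h2
  simp only [twisted, mul_add, add_mul, mul_sub, sub_mul, smul_mul_assoc, mul_smul_comm, one_mul,
    mul_one] at h1 h2 ⊢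
  rw [h1, h2, h3, h4]
  module

lemma permOp_mul_sum_lowering (σ : Equiv.Perm ι) :
    permOp σ * ∑ i, lowering i = (∑ i, lowering i) * permOp σ := by
  rw [Finset.mul_sum, Finset.sum_mul]
  simp only [permOp_mul_lowering]
  exact Equiv.sum_comp σ fun i => lowering i * permOp σ

lemma sum_lowering_mul_hamiltonian (x : ι → ℝ) (i : ι) :
    (∑ k, lowering k) * hamiltonian x i = hamiltonian x i * ∑ k, lowering k := by
  simp only [hamiltonian, Finset.sum_mul _ _ (∑ k, lowering k), exch, smul_mul_assoc, sub_mul,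
    permOp_mul_sum_lowering, one_mul]
  rw [Finset.mul_sum]
  simp only [mul_smul_comm, mul_sub, mul_one]

/-- The Hamiltonian at a configuration only involves configurations of the same size. -/
lemma hamiltonian_apply_congr (x : ι → ℝ) (i : ι) {v w : Finset ι → ℝ} {s : Finset ι}
    (h : ∀ t : Finset ι, t.card = s.card → v t = w t) :
    hamiltonian x i v s = hamiltonian x i w s := by
  simp only [hamiltonian, LinearMap.sum_apply, LinearMap.smul_apply, Finset.sum_apply,
    Pi.smul_apply, exch_apply]
  refine Finset.sum_congr rfl fun j _ => ?_
  rw [h _ (Finset.card_map _), h s rfl]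

lemma hamiltonian_apply_eq_zero (x : ι → ℝ) (i : ι) {v : Finset ι → ℝ} {s : Finset ι}
    (h : ∀ t : Finset ι, t.card = s.card → v t = 0) : hamiltonian x i v s = 0 := by
  rw [hamiltonian_apply_congr x i (w := 0) h, map_zero, Pi.zero_apply]

lemma sum_mul_hamiltonian (x : ι → ℝ) (i : ι) (v w : Finset ι → ℝ) :
    ∑ s, v s * hamiltonian x i w s = ∑ s, hamiltonian x i v s * w s := by
  have key (j : ι) : ∑ s, v s * exch i j w s = ∑ s, exch i j v s * w s := by
    simp only [exch_apply, mul_sub, sub_mul, Finset.sum_sub_distrib]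
    congr 1
    refine Finset.sum_equiv (Equiv.finsetCongr (Equiv.swap i j)) (by simp) fun s _ => ?_
    have : (s.map (Equiv.swap i j).toEmbedding).map (Equiv.swap i j).toEmbedding = s := by
      ext k; simp [Finset.mem_map_equiv]
    simp [this]
  simp only [hamiltonian, LinearMap.sum_apply, LinearMap.smul_apply, Finset.sum_apply,
    Pi.smul_apply, smul_eq_mul, Finset.mul_sum, Finset.sum_mul]
  rw [Finset.sum_comm, Finset.sum_comm (s := Finset.univ (α := Finset ι))]
  refine Finset.sum_congr rfl fun j _ => ?_
  have := congrArg ((x i - x j)⁻¹ * ·) (key j)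
  simp only [Finset.mul_sum] at this
  convert this using 2 <;> ring

lemma sum_mul_sum_raising (v w : Finset ι → ℝ) :
    ∑ s, v s * (∑ i, raising i) w s = ∑ s, (∑ i, lowering i) v s * w s := by
  have key (i : ι) : ∑ s, v s * raising i w s = ∑ s, lowering i v s * w s := by
    simp only [raising_apply, lowering_apply, mul_ite, mul_zero, ite_mul, zero_mul]
    rw [← Finset.sum_filter, Finset.sum_ite, Finset.sum_const_zero, zero_add]
    refine Finset.sum_bij' (fun s _ => s.erase i) (fun s _ => insert i s) ?_ ?_ ?_ ?_ ?_ <;>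
      simp +contextual [Finset.insert_erase]
  simp only [LinearMap.sum_apply, Finset.sum_apply, Finset.mul_sum, Finset.sum_mul]
  rw [Finset.sum_comm, Finset.sum_comm (s := Finset.univ (α := Finset ι))]
  exact Finset.sum_congr rfl fun i _ => key i

/-- The Casimir operator, in terms of the Hamiltonians. -/
lemma sum_raising_sum_lowering {x : ι → ℝ} (hx : Function.Injective x) (v : Finset ι → ℝ)
    (s : Finset ι) :
    (∑ i, raising i) ((∑ i, lowering i) v) s = (∑ i, x i • hamiltonian x i) v s
      + s.card * (Fintype.card ι - s.card + 1) * v s := by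
  have h := sum_raising_mul_sum_lowering_apply v s
  rw [← two_smul_sum_smul_hamiltonian hx, LinearMap.smul_apply, Pi.smul_apply, smul_eq_mul] at h
  linarith

lemma eq_zero_of_casimir_of_card_lt {x : ι → ℝ} (hx : Function.Injective x) {m k : ℕ}
    (hm : Fintype.card ι = 2 * m) (hk : k < m) {v : Finset ι → ℝ}
    (hv : ∀ s : Finset ι, s.card ≠ k → v s = 0)
    (hC : (∑ i, x i • hamiltonian x i) v = -((m : ℝ) * (m + 1)) • v) : v = 0 := by
  have h1 (s : Finset ι) : (∑ i, raising i) ((∑ i, lowering i) v) s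
      = -(((m : ℝ) - k) * (m - k + 1)) * v s := by
    rw [sum_raising_sum_lowering hx, hC, hm, Pi.smul_apply, smul_eq_mul]
    by_cases hs : s.card = k
    · rw [hs]; push_cast; ring
    · rw [hv s hs]; ring
  have h2 := sum_mul_sum_raising v ((∑ i, lowering i) v)
  simp only [h1] at h2
  have h3 : 0 ≤ ∑ s, (∑ i, lowering i) v s * (∑ i, lowering i) v s :=
    Finset.sum_nonneg fun s _ => mul_self_nonneg _
  have h4 : ∑ s, v s * (-(((m : ℝ) - k) * (m - k + 1)) * v s)
      = -(((m : ℝ) - k) * (m - k + 1)) * ∑ s, v s * v s := by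
    rw [Finset.mul_sum]
    exact Finset.sum_congr rfl fun s _ => by ring
  have h5 : 0 < ((m : ℝ) - k) * (m - k + 1) := by
    have : (k : ℝ) < m := by exact_mod_cast hk
    nlinarith
  have h6 : 0 ≤ ∑ s, v s * v s := Finset.sum_nonneg fun s _ => mul_self_nonneg _
  have h7 : ∑ s, v s * v s = 0 := by nlinarith
  funext s
  simpa using (Finset.sum_eq_zero_iff_of_nonneg fun s _ => mul_self_nonneg _).1 h7 s
    (Finset.mem_univ s)

/-- Solutions of the twisted system are determined by the value at the empty configuration. -/
lemma eq_zero_of_twisted_eq_zero {x h : ι → ℝ} {u : Finset ι → ℝ}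
    (hu : ∀ i, twisted x h i u = 0) (h0 : u ∅ = 0) : u = 0 := by
  have key : ∀ k : ℕ, ∀ s : Finset ι, s.card = k → u s = 0 := by
    intro k
    induction k with
    | zero => intro s hs; rw [Finset.card_eq_zero.1 hs, h0]
    | succ k ih =>
      intro s hs
      obtain ⟨i, t, hit, rfl, ht⟩ := Finset.card_eq_succ.1 hs
      have h1 := congrFun (hu i) t
      simp only [twisted, LinearMap.sub_apply, LinearMap.add_apply, Pi.sub_apply, Pi.add_apply,
        LinearMap.smul_apply, Module.End.one_apply, Pi.smul_apply, lowering_apply, if_neg hit,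
        ih t ht, Pi.zero_apply, smul_zero, sub_zero] at h1
      rwa [hamiltonian_apply_eq_zero x i fun r hr => ih r (hr.trans ht), zero_add] at h1
  exact funext fun s => key _ s rfl

/-- The functions supported on configurations of size less than `m`. -/
def lowerLevels (ι : Type*) (m : ℕ) : Submodule ℝ (Finset ι → ℝ) where
  carrier := {v | ∀ s : Finset ι, m ≤ s.card → v s = 0}
  zero_mem' := fun _ _ => rfl
  add_mem' := fun hv hw s hs => by simp [hv s hs, hw s hs]
  smul_mem' := fun c v hv s hs => by simp [hv s hs]

lemma twisted_mem_lowerLevels (x h : ι → ℝ) (i : ι) {m : ℕ} {v : Finset ι → ℝ}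
    (hv : v ∈ lowerLevels ι m) : twisted x h i v ∈ lowerLevels ι m := by
  intro s hs
  have h1 : hamiltonian x i v s = 0 :=
    hamiltonian_apply_eq_zero x i fun t ht => hv t (ht ▸ hs)
  have h2 : v (insert i s) = 0 := hv _ (hs.trans (Finset.card_le_card (Finset.subset_insert i s)))
  simp [twisted, lowering_apply, h1, h2, hv s hs]

lemma sum_smul_twisted_apply (x h : ι → ℝ) (v : Finset ι → ℝ) (s : Finset ι) :
    (∑ i, x i • twisted x h i) v s = (∑ i, x i • hamiltonian x i) v s
      + ∑ i, x i * lowering i v s - (∑ i, x i * h i) * v s := by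
  simp only [twisted, LinearMap.sum_apply, Finset.sum_apply, LinearMap.smul_apply, Pi.smul_apply,
    LinearMap.sub_apply, LinearMap.add_apply, Pi.sub_apply, Pi.add_apply, smul_eq_mul,
    Module.End.one_apply, Finset.sum_mul, ← Finset.sum_add_distrib, ← Finset.sum_sub_distrib]
  exact Finset.sum_congr rfl fun i _ => by ring

lemma eq_zero_of_sum_smul_twisted_eq_zero {x h : ι → ℝ} (hx : Function.Injective x) {m : ℕ}
    (hm : Fintype.card ι = 2 * m) (hh : ∑ i, x i * h i = -((m : ℝ) * (m + 1)))
    {v : Finset ι → ℝ} (hv : v ∈ lowerLevels ι m) (hY : (∑ i, x i • twisted x h i) v = 0) :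
    v = 0 := by
  have key : ∀ t : ℕ, ∀ s : Finset ι, m ≤ s.card + t → v s = 0 := by
    intro t
    induction t with
    | zero => exact hv
    | succ t ih =>
      intro s hs
      by_cases hst : m ≤ s.card + t
      · exact ih s hst
      let w : Finset ι → ℝ := fun r => if r.card = s.card then v r else 0
      have hw : w = 0 := by
        refine eq_zero_of_casimir_of_card_lt hx hm (k := s.card) (by omega)
          (fun r hr => if_neg hr) (funext fun r => ?_)
        simp only [LinearMap.sum_apply, Finset.sum_apply, LinearMap.smul_apply, Pi.smul_apply]
        by_cases hr : r.card = s.card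
        · have h1 := congrFun hY r
          have h2 (i : ι) : lowering i v r = 0 := by
            rw [lowering_apply]
            split_ifs with hi
            · rfl
            · exact ih _ (by rw [Finset.card_insert_of_notMem hi]; omega)
          rw [sum_smul_twisted_apply, hh] at h1
          simp only [h2, mul_zero, Finset.sum_const_zero, LinearMap.sum_apply, Finset.sum_apply,
            LinearMap.smul_apply, Pi.smul_apply, Pi.zero_apply] at h1
          have h3 (i : ι) : hamiltonian x i w r = hamiltonian x i v r :=
            hamiltonian_apply_congr x i fun q hq => if_pos (hq.trans hr)
          simp only [h3, smul_eq_mul, show w r = v r from if_pos hr] at h1 ⊢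
          linarith
        · rw [show w r = 0 from if_neg hr]
          simp only [smul_zero]
          refine Finset.sum_eq_zero fun i _ => ?_
          rw [hamiltonian_apply_eq_zero x i fun q hq => if_neg (hq ▸ hr), smul_zero]
      simpa [w] using congrFun hw s
  exact funext fun s => key m s (by omega)

/-- The singlet vectors of `2 m` sites. -/
def singlets (ι : Type*) [DecidableEq ι] [Fintype ι] (m : ℕ) : Submodule ℝ (Finset ι → ℝ) where
  carrier := {v | (∀ s : Finset ι, s.card ≠ m → v s = 0) ∧ (∑ i, lowering i) v = 0}
  zero_mem' := ⟨fun _ _ => rfl, map_zero _⟩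
  add_mem' := fun hv hw =>
    ⟨fun s hs => by simp [hv.1 s hs, hw.1 s hs], by rw [map_add, hv.2, hw.2, add_zero]⟩
  smul_mem' := fun c v hv =>
    ⟨fun s hs => by simp [hv.1 s hs], by rw [LinearMap.map_smul, hv.2, smul_zero]⟩

lemma hamiltonian_mem_singlets (x : ι → ℝ) (i : ι) {m : ℕ} {v : Finset ι → ℝ}
    (hv : v ∈ singlets ι m) : hamiltonian x i v ∈ singlets ι m := by
  refine ⟨fun s hs => hamiltonian_apply_eq_zero x i fun t ht => hv.1 t (ht ▸ hs), ?_⟩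
  rw [← Module.End.mul_apply, sum_lowering_mul_hamiltonian, Module.End.mul_apply, hv.2, map_zero]

lemma casimir_singlets {x : ι → ℝ} (hx : Function.Injective x) {m : ℕ}
    (hm : Fintype.card ι = 2 * m) {v : Finset ι → ℝ} (hv : v ∈ singlets ι m) :
    (∑ i, x i • hamiltonian x i) v = -((m : ℝ) * (m + 1)) • v := by
  funext s
  have h := sum_raising_sum_lowering hx v s
  rw [hv.2, map_zero, Pi.zero_apply] at h
  by_cases hs : s.card = m
  · rw [hs, hm] at h
    rw [Nat.cast_mul, Nat.cast_ofNat] at h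
    rw [Pi.smul_apply, smul_eq_mul]
    linarith
  · rw [hv.1 s hs, mul_zero, add_zero] at h
    rw [← h, Pi.smul_apply, hv.1 s hs, smul_zero]

/-- A joint eigenvalue tuple of a nonzero singlet vector satisfies the linear and quadratic
relations of the Hamiltonians. -/
lemma joint_eigenvalue_relations {x h : ι → ℝ} (hx : Function.Injective x) {m : ℕ}
    (hm : Fintype.card ι = 2 * m) {w : Finset ι → ℝ} (hw : w ∈ singlets ι m) (hw0 : w ≠ 0)
    (hh : ∀ i, hamiltonian x i w = h i • w) :
    ∑ i, h i = 0 ∧ ∑ i, x i * h i = -((m : ℝ) * (m + 1)) ∧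
      ∀ i, h i ^ 2 + ∑ k, (x i - x k)⁻¹ * (h i - h k) = 0 := by
  have key {a b : ℝ} (hab : a • w = b • w) : a = b := smul_left_injective ℝ hw0 hab
  refine ⟨key ?_, key ?_, fun i => key ?_⟩
  · rw [Finset.sum_smul, zero_smul, ← LinearMap.zero_apply (σ₁₂ := RingHom.id ℝ) w,
      ← sum_hamiltonian x, LinearMap.sum_apply]
    simp only [hh]
  · rw [← casimir_singlets hx hm hw, LinearMap.sum_apply, Finset.sum_smul]
    simp only [LinearMap.smul_apply, hh, smul_smul]
  · have := congrArg (fun T : Module.End ℝ (Finset ι → ℝ) => T w) (hamiltonian_mul_self hx i)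
    simp only [LinearMap.add_apply, Module.End.mul_apply, hh, LinearMap.map_smul,
      LinearMap.sum_apply,
      LinearMap.smul_apply, LinearMap.sub_apply, LinearMap.zero_apply, smul_smul, ← sub_smul,
      ← Finset.sum_smul, ← add_smul] at this
    rw [zero_smul, ← this, sq]

/-- A joint eigenvector in the singlets lifts to a solution of the twisted system. -/
lemma exists_twisted_lift {x h : ι → ℝ} (hx : Function.Injective x) {m : ℕ}
    (hm : Fintype.card ι = 2 * m) (hh : ∑ i, x i * h i = -((m : ℝ) * (m + 1)))
    {w : Finset ι → ℝ} (hw : w ∈ singlets ι m) (hwh : ∀ i, hamiltonian x i w = h i • w) :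
    ∃ u : Finset ι → ℝ, (∀ i, twisted x h i u = 0) ∧ ∀ s : Finset ι, s.card = m → u s = w s := by
  set Y : Module.End ℝ (Finset ι → ℝ) := ∑ i, x i • twisted x h i with hY
  have hmaps : ∀ v ∈ lowerLevels ι m, Y v ∈ lowerLevels ι m := by
    intro v hv
    rw [hY, LinearMap.sum_apply]
    exact Submodule.sum_mem _ fun i _ =>
      Submodule.smul_mem _ _ (twisted_mem_lowerLevels x h i hv)
  have hinj : Function.Injective (Y.restrict hmaps) := by
    rw [injective_iff_map_eq_zero]
    intro v hv
    exact Subtype.ext (eq_zero_of_sum_smul_twisted_eq_zero hx hm hh v.2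
      (congrArg Subtype.val hv))
  have hsurj := LinearMap.injective_iff_surjective.1 hinj
  have hDw (i : ι) : twisted x h i w ∈ lowerLevels ι m := by
    intro s hs
    simp only [twisted, LinearMap.sub_apply, LinearMap.add_apply, hwh, LinearMap.smul_apply,
      Module.End.one_apply, add_sub_cancel_left, lowering_apply]
    split_ifs with hi
    · rfl
    · exact hw.1 _ (by rw [Finset.card_insert_of_notMem hi]; omega)
  have hYw : Y w ∈ lowerLevels ι m := by
    rw [hY, LinearMap.sum_apply]
    exact Submodule.sum_mem _ fun i _ => Submodule.smul_mem _ _ (hDw i)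
  obtain ⟨r, hr⟩ := hsurj ⟨-Y w, Submodule.neg_mem _ hYw⟩
  have hr' : Y r.1 = - Y w := congrArg Subtype.val hr
  have hcomm (i : ι) : Y * twisted x h i = twisted x h i * Y := by
    rw [hY, Finset.sum_mul, Finset.mul_sum]
    refine Finset.sum_congr rfl fun k _ => ?_
    rw [smul_mul_assoc, mul_smul_comm, twisted_commute hx]
  refine ⟨w + r.1, fun i => ?_, fun s hs => ?_⟩
  · refine eq_zero_of_sum_smul_twisted_eq_zero hx hm hh ?_ ?_
    · rw [map_add]
      exact Submodule.add_mem _ (hDw i) (twisted_mem_lowerLevels x h i r.2)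
    · rw [← hY, ← Module.End.mul_apply, hcomm, Module.End.mul_apply, map_add, hr',
        add_neg_cancel, map_zero]
  · rw [Pi.add_apply, r.2 s hs.ge, add_zero]

/-- The joint spectrum of the Hamiltonians on the singlets is simple. -/
lemma exists_eq_smul_of_joint_eigenvector {x h : ι → ℝ} (hx : Function.Injective x) {m : ℕ}
    (hm : Fintype.card ι = 2 * m) {w w' : Finset ι → ℝ} (hw : w ∈ singlets ι m) (hw0 : w ≠ 0)
    (hwh : ∀ i, hamiltonian x i w = h i • w) (hw' : w' ∈ singlets ι m)
    (hwh' : ∀ i, hamiltonian x i w' = h i • w') : ∃ c : ℝ, w' = c • w := by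
  have hh := (joint_eigenvalue_relations hx hm hw hw0 hwh).2.1
  obtain ⟨u, hu, huw⟩ := exists_twisted_lift hx hm hh hw hwh
  obtain ⟨u', hu', huw'⟩ := exists_twisted_lift hx hm hh hw' hwh'
  have hu0 : u ∅ ≠ 0 := by
    intro h0
    refine hw0 (funext fun s => ?_)
    by_cases hs : s.card = m
    · rw [← huw s hs, eq_zero_of_twisted_eq_zero hu h0]
    · exact hw.1 s hs
  have key : u' - (u' ∅ / u ∅) • u = 0 := by
    refine eq_zero_of_twisted_eq_zero (x := x) (h := h) (fun i => ?_) ?_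
    · rw [map_sub, LinearMap.map_smul, hu, hu', smul_zero, sub_zero]
    · simp [hu0]
  refine ⟨u' ∅ / u ∅, funext fun s => ?_⟩
  by_cases hs : s.card = m
  · rw [Pi.smul_apply, ← huw s hs, ← huw' s hs]
    exact congrFun (sub_eq_zero.1 key) s
  · rw [Pi.smul_apply, hw.1 s hs, hw'.1 s hs, smul_zero]

/-- A commuting family of symmetric operators with simple joint spectrum has as many joint
eigenvalue tuples as the dimension of the space. -/
lemma exists_injective_joint_eigenvalues {κ V : Type*} [NormedAddCommGroup V]
    [InnerProductSpace ℝ V] [FiniteDimensional ℝ V] {T : κ → Module.End ℝ V}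
    (hT : ∀ i, (T i).IsSymmetric) (hcomm : ∀ i j, Commute (T i) (T j))
    (hsimple : ∀ (χ : κ → ℝ) (w w' : V), w ≠ 0 → (∀ i, T i w = χ i • w) →
      (∀ i, T i w' = χ i • w') → ∃ c : ℝ, w' = c • w) :
    ∃ h : Fin (Module.finrank ℝ V) → κ → ℝ, Function.Injective h ∧
      ∀ a, ∃ w : V, w ≠ 0 ∧ ∀ i, T i w = h a i • w := by
  have htop := LinearMap.IsSymmetric.iSup_iInf_eq_top_of_commute hT fun i j _ => hcomm i j
  let s : Set V := {w | ∃ χ : κ → ℝ, ∀ i, T i w = χ i • w}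
  have hs : Submodule.span ℝ s = ⊤ := by
    rw [eq_top_iff, ← htop, iSup_le_iff]
    intro χ w hw
    simp only [Submodule.mem_iInf, Module.End.mem_eigenspace_iff] at hw
    exact Submodule.subset_span ⟨χ, hw⟩
  obtain ⟨t, hts, htc, -, hti⟩ := Submodule.exists_finset_span_eq_linearIndepOn ℝ s
  rw [hs, finrank_top] at htc
  choose χ hχ using fun w : t => hts w.2
  have hne (w : t) : w.1 ≠ 0 := hti.ne_zero w.2
  have hinj : Function.Injective χ := by
    intro w w' hww
    by_contra hne'
    obtain ⟨c, hc⟩ := hsimple (χ w) w.1 w'.1 (hne w) (hχ w) (hww ▸ hχ w')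
    have hpair : LinearIndependent ℝ ![w.1, w'.1] := by
      have h2 := hti.comp ![w, w'] (by
        intro a b hab
        fin_cases a <;> fin_cases b <;> simp_all)
      rwa [show (fun v : (t : Set V) => id v.1) ∘ ![w, w'] = ![w.1, w'.1] from
        funext fun a => by fin_cases a <;> rfl] at h2
    have := (LinearIndependent.pair_iff.1 hpair c (-1) (by rw [hc]; module)).2
    norm_num at this
  let e : Fin (Module.finrank ℝ V) ≃ t := (finCongr htc.symm).trans t.equivFin.symm
  exact ⟨fun a => χ (e a), hinj.comp e.injective, fun a => ⟨e a, hne _, hχ _⟩⟩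

lemma exists_injective_singlet_eigenvalues {x : ι → ℝ} (hx : Function.Injective x) {m : ℕ}
    (hm : Fintype.card ι = 2 * m) :
    ∃ h : Fin (Module.finrank ℝ (singlets ι m)) → ι → ℝ, Function.Injective h ∧
      ∀ a, ∃ w ∈ singlets ι m, w ≠ 0 ∧ ∀ i, hamiltonian x i w = h a i • w := by
  let φ : EuclideanSpace ℝ (Finset ι) ≃ₗ[ℝ] (Finset ι → ℝ) := WithLp.linearEquiv 2 ℝ _
  let V : Submodule ℝ (EuclideanSpace ℝ (Finset ι)) := (singlets ι m).comap φ.toLinearMap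
  let H (i : ι) : Module.End ℝ (EuclideanSpace ℝ (Finset ι)) := φ.symm.conj (hamiltonian x i)
  have hH (i : ι) (v) : φ (H i v) = hamiltonian x i (φ v) := by
    simp [H, LinearEquiv.conj_apply]
  have hHV (i : ι) : ∀ v ∈ V, H i v ∈ V := fun v hv => by
    rw [Submodule.mem_comap, LinearEquiv.coe_coe, hH]
    exact hamiltonian_mem_singlets x i hv
  have hsymm (i : ι) : ((H i).restrict (hHV i)).IsSymmetric := by
    intro v w
    have := sum_mul_hamiltonian x i (φ w.1) (φ v.1)
    rw [← hH, ← hH] at this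
    simpa [PiLp.inner_apply, φ, mul_comm] using this
  have hcomm (i j : ι) : Commute ((H i).restrict (hHV i)) ((H j).restrict (hHV j)) := by
    refine LinearMap.ext fun v => Subtype.ext (φ.injective ?_)
    change φ (H i (H j v)) = φ (H j (H i v))
    rw [hH, hH, hH, hH, ← Module.End.mul_apply, hamiltonian_commute hx, Module.End.mul_apply]
  have heig {i : ι} {v : V} {c : ℝ} (h : (H i).restrict (hHV i) v = c • v) :
      hamiltonian x i (φ v) = c • φ v := by
    rw [← hH, ← LinearEquiv.map_smul]
    exact congrArg φ (congrArg Subtype.val h)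
  obtain ⟨h, hinj, hh⟩ := exists_injective_joint_eigenvalues hsymm hcomm (by
    intro χ w w' hw0 hw hw'
    obtain ⟨c, hc⟩ := exists_eq_smul_of_joint_eigenvector hx hm (w := φ w) (w' := φ w') w.2
      (fun h0 => hw0 (Subtype.ext (φ.map_eq_zero_iff.1 h0))) (fun i => heig (hw i)) w'.2
      (fun i => heig (hw' i))
    exact ⟨c, Subtype.ext (φ.injective (by simpa using hc))⟩)
  have hdim : Module.finrank ℝ V = Module.finrank ℝ (singlets ι m) :=
    (φ.ofSubmodule' (singlets ι m)).finrank_eq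
  rw [← hdim]
  refine ⟨h, hinj, fun a => ?_⟩
  obtain ⟨w, hw0, hw⟩ := hh a
  exact ⟨φ w, w.2, fun h0 => hw0 (Subtype.ext (φ.map_eq_zero_iff.1 h0)), fun i => heig (hw i)⟩

lemma catalan_le_finrank_singlets {m : ℕ} (hm : Fintype.card ι = 2 * m) (hm0 : 0 < m) :
    (2 * m).choose m / (m + 1) ≤ Module.finrank ℝ (singlets ι m) := by
  let A := {s : Finset ι // s.card = m}
  let B := {s : Finset ι // s.card = m - 1}
  let ext : (A → ℝ) →ₗ[ℝ] (Finset ι → ℝ) := Function.ExtendByZero.linearMap ℝ Subtype.val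
  let T : (A → ℝ) →ₗ[ℝ] (B → ℝ) :=
    LinearMap.funLeft ℝ ℝ Subtype.val ∘ₗ (∑ i, lowering i) ∘ₗ ext
  have hA : Module.finrank ℝ (A → ℝ) = (2 * m).choose m := by
    rw [Module.finrank_fintype_fun_eq_card, Fintype.card_finset_len, hm]
  have hB : Module.finrank ℝ (B → ℝ) = (2 * m).choose (m - 1) := by
    rw [Module.finrank_fintype_fun_eq_card, Fintype.card_finset_len, hm]
  have hext (f : A → ℝ) (s : Finset ι) (hs : s.card ≠ m) : ext f s = 0 := by
    refine Function.extend_apply' _ _ _ ?_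
    rintro ⟨a, rfl⟩
    exact hs a.2
  have hmem (f : LinearMap.ker T) : ext f ∈ singlets ι m := by
    refine ⟨hext f, funext fun s => ?_⟩
    by_cases hs : s.card = m - 1
    · exact congrFun f.2 ⟨s, hs⟩
    · rw [LinearMap.sum_apply, Finset.sum_apply]
      refine Finset.sum_eq_zero fun i _ => ?_
      rw [lowering_apply]
      split_ifs with hi
      · rfl
      · exact hext _ _ (by rw [Finset.card_insert_of_notMem hi]; omega)
  have hinj : Function.Injective ext := by
    intro f g hfg
    funext a
    have := congrFun hfg a.1
    simpa [ext, Subtype.val_injective.extend_apply] using this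
  have hle : Module.finrank ℝ (LinearMap.ker T) ≤ Module.finrank ℝ (singlets ι m) :=
    LinearMap.finrank_le_finrank_of_injective
      (f := (ext ∘ₗ (LinearMap.ker T).subtype).codRestrict _ hmem) fun f g hfg =>
        Subtype.ext (hinj (congrArg Subtype.val hfg))
  have hrank := LinearMap.finrank_range_add_finrank_ker T
  have hrange := Submodule.finrank_le (LinearMap.range T)
  have hcat : (2 * m).choose m / (m + 1) + (2 * m).choose (m - 1) = (2 * m).choose m := by
    have h1 : (2 * m).choose (m - 1) = (2 * m).choose (m + 1) := by
      rw [← Nat.choose_symm (by omega)]; congr 1; omega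
    have h2 := Nat.choose_succ_right_eq (2 * m) m
    rw [show 2 * m - m = m by omega, ← h1] at h2
    have h3 : (2 * m).choose (m - 1) ≤ (2 * m).choose m := by nlinarith
    have h4 : (2 * m).choose m = ((2 * m).choose m - (2 * m).choose (m - 1)) * (m + 1) := by
      rw [Nat.sub_mul, h2]
      have : (2 * m).choose m * (m + 1) = (2 * m).choose m * m + (2 * m).choose m := by ring
      omega
    have h5 : (2 * m).choose m / (m + 1) = (2 * m).choose m - (2 * m).choose (m - 1) :=
      Nat.div_eq_of_eq_mul_left (by omega) h4
    omega
  omega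

open Lagrange

/-- The polynomial with residues `h` at the nodes `x` relative to the nodal polynomial. -/
noncomputable def residuePoly (x h : ι → ℝ) : ℝ[X] :=
  ∑ i, C (h i) * nodal (Finset.univ.erase i) x

/-- The second order operator `y ↦ ω D²y - (Dω) (Dy) - Γ y`, where `D` is the derivative, `ω`
the nodal polynomial and `Γ` the polynomial with given residues. -/
noncomputable def fuchsOp (x h : ι → ℝ) (y : ℝ[X]) : ℝ[X] :=
  nodal Finset.univ x * derivative (derivative y)
    - derivative (nodal Finset.univ x) * derivative y - residuePoly x h * y

lemma eval_nodal_erase_of_ne (x : ι → ℝ) {i j : ι} (hij : i ≠ j) :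
    (nodal (Finset.univ.erase j) x).eval (x i) = 0 :=
  eval_nodal_at_node (Finset.mem_erase.2 ⟨hij, Finset.mem_univ i⟩)

lemma eval_derivative_nodal_erase {x : ι → ℝ} (hx : Function.Injective x) (i j : ι) :
    (derivative (nodal (Finset.univ.erase j) x)).eval (x i)
      = (x i - x j)⁻¹ * (nodal (Finset.univ.erase i) x).eval (x i)
        + if j = i then (∑ k, (x i - x k)⁻¹) * (nodal (Finset.univ.erase i) x).eval (x i)
          else 0 := by
  have key {k : ι} (hk : k ≠ i) : (nodal ((Finset.univ.erase i).erase k) x).eval (x i)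
      = (x i - x k)⁻¹ * (nodal (Finset.univ.erase i) x).eval (x i) := by
    have h1 : x i - x k ≠ 0 := sub_ne_zero.2 (hx.ne (Ne.symm hk))
    rw [nodal_eq_mul_nodal_erase (Finset.mem_erase.2 ⟨hk, Finset.mem_univ k⟩), eval_mul]
    simp only [eval_sub, eval_X, eval_C]
    field_simp
  by_cases hij : j = i
  · subst hij
    rw [derivative_nodal, eval_finsetSum, if_pos rfl, sub_self, inv_zero, zero_mul, zero_add,
      Finset.sum_mul, ← Finset.add_sum_erase _ _ (Finset.mem_univ j), sub_self, inv_zero, zero_mul,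
      zero_add]
    exact Finset.sum_congr rfl fun k hk => key (Finset.ne_of_mem_erase hk)
  · rw [if_neg hij, add_zero, ← key hij, Finset.erase_right_comm,
      eval_nodal_derivative_eval_node_eq (Finset.mem_erase.2 ⟨Ne.symm hij, Finset.mem_univ i⟩)]

lemma X_sub_C_sq_dvd {R : Type*} [CommRing R] {a : R} {p : R[X]}
    (h0 : p.eval a = 0) (h1 : (derivative p).eval a = 0) :
    (X - C a) ^ 2 ∣ p := by
  obtain ⟨q, rfl⟩ := dvd_iff_isRoot.2 h0
  have hq : q.eval a = 0 := by simpa using h1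
  obtain ⟨r, rfl⟩ := dvd_iff_isRoot.2 hq
  exact ⟨r, by ring⟩

lemma X_sub_C_sq_dvd_fuchsOp {x h : ι → ℝ} (hx : Function.Injective x) {i : ι}
    (hQ : h i ^ 2 + ∑ k, (x i - x k)⁻¹ * (h i - h k) = 0) {y : ℝ[X]}
    (hy : (derivative y).eval (x i) + h i * y.eval (x i) = 0) :
    (X - C (x i)) ^ 2 ∣ fuchsOp x h y := by
  set A := (nodal (Finset.univ.erase i) x).eval (x i) with hA
  have hω0 : (nodal Finset.univ x).eval (x i) = 0 := eval_nodal_at_node (Finset.mem_univ i)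
  have hω1 : (derivative (nodal Finset.univ x)).eval (x i) = A :=
    eval_nodal_derivative_eval_node_eq (Finset.mem_univ i)
  have hω2 : (derivative (derivative (nodal Finset.univ x))).eval (x i)
      = 2 * A * ∑ k, (x i - x k)⁻¹ := by
    rw [derivative_nodal, derivative_sum, eval_finsetSum]
    simp only [eval_derivative_nodal_erase hx, Finset.sum_add_distrib, Finset.sum_ite_eq',
      Finset.mem_univ, if_true, ← hA, ← Finset.sum_mul]
    ring
  have hΓ0 : (residuePoly x h).eval (x i) = h i * A := by
    rw [residuePoly, eval_finsetSum, Finset.sum_eq_single i]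
    · rw [eval_mul, eval_C]
    · intro j _ hj
      rw [eval_mul, eval_nodal_erase_of_ne x (Ne.symm hj), mul_zero]
    · simp
  have hΓ1 : (derivative (residuePoly x h)).eval (x i)
      = A * (h i * ∑ k, (x i - x k)⁻¹ + ∑ k, (x i - x k)⁻¹ * h k) := by
    rw [residuePoly, derivative_sum, eval_finsetSum]
    simp only [derivative_C_mul, eval_C_mul, eval_derivative_nodal_erase hx, mul_add, mul_ite,
      mul_zero, Finset.sum_add_distrib, Finset.sum_ite_eq', Finset.mem_univ, if_true, ← hA]
    have hcomm : ∑ k, h k * ((x i - x k)⁻¹ * A) = A * ∑ k, (x i - x k)⁻¹ * h k := by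
      rw [Finset.mul_sum]
      exact Finset.sum_congr rfl fun k _ => by ring
    rw [hcomm]
    ring
  have hQ' : h i ^ 2 + (h i * ∑ k, (x i - x k)⁻¹ - ∑ k, (x i - x k)⁻¹ * h k) = 0 := by
    rw [← hQ, Finset.mul_sum, ← Finset.sum_sub_distrib]
    congr 1
    exact Finset.sum_congr rfl fun k _ => by ring
  refine X_sub_C_sq_dvd ?_ ?_
  · simp only [fuchsOp, eval_sub, eval_mul, hω0, hω1, hΓ0]
    linear_combination -A * hy
  · simp only [fuchsOp, derivative_sub, derivative_mul, eval_sub, eval_add, eval_mul, hω0, hω1,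
      hω2, hΓ0, hΓ1]
    linear_combination (-2 * A * (∑ k, (x i - x k)⁻¹) - h i * A) * hy
      + A * y.eval (x i) * hQ'

lemma X_mul_residuePoly {x h : ι → ℝ} (hsum : ∑ i, h i = 0) :
    X * residuePoly x h = residuePoly x fun i => x i * h i := by
  have key (i : ι) : X * (C (h i) * nodal (Finset.univ.erase i) x)
      = C (h i) * nodal Finset.univ x + C (x i * h i) * nodal (Finset.univ.erase i) x := by
    rw [nodal_eq_mul_nodal_erase (Finset.mem_univ i), C_mul]
    ring
  rw [residuePoly, Finset.mul_sum, Finset.sum_congr rfl fun i _ => key i, Finset.sum_add_distrib,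
    ← Finset.sum_mul, ← map_sum, hsum, map_zero, zero_mul, zero_add, residuePoly]

lemma natDegree_residuePoly_le (x h : ι → ℝ) :
    (residuePoly x h).natDegree ≤ Fintype.card ι - 1 := by
  refine natDegree_sum_le_of_forall_le _ _ fun i _ => (natDegree_C_mul_le _ _).trans ?_
  rw [natDegree_nodal, Finset.card_erase_of_mem (Finset.mem_univ i), Finset.card_univ]

lemma coeff_residuePoly (x h : ι → ℝ) :
    (residuePoly x h).coeff (Fintype.card ι - 1) = ∑ i, h i := by
  rw [residuePoly, finsetSum_coeff]
  refine Finset.sum_congr rfl fun i _ => ?_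
  have h1 : (nodal (Finset.univ.erase i) x).natDegree = Fintype.card ι - 1 := by
    rw [natDegree_nodal, Finset.card_erase_of_mem (Finset.mem_univ i), Finset.card_univ]
  rw [coeff_C_mul, ← h1, Monic.coeff_natDegree nodal_monic, mul_one]

/-- A polynomial of small degree satisfying the first order conditions at the nodes solves the
second order equation. -/
lemma fuchsOp_eq_zero {x h : ι → ℝ} (hx : Function.Injective x) {m : ℕ}
    (hm : Fintype.card ι = 2 * m) (hm0 : 0 < m) (hsum : ∑ i, h i = 0)
    (hQ : ∀ i, h i ^ 2 + ∑ k, (x i - x k)⁻¹ * (h i - h k) = 0) {y : ℝ[X]}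
    (hdeg : y.natDegree ≤ 2 * m + 1)
    (hy : ∀ i, (derivative y).eval (x i) + h i * y.eval (x i) = 0) : fuchsOp x h y = 0 := by
  have hω : (nodal Finset.univ x).natDegree = 2 * m := by
    rw [natDegree_nodal, Finset.card_univ, hm]
  have hdvd : nodal Finset.univ x ^ 2 ∣ fuchsOp x h y := by
    rw [nodal, ← Finset.prod_pow]
    refine Finset.prod_dvd_of_coprime (fun i _ j _ hij => ?_) fun i _ =>
      X_sub_C_sq_dvd_fuchsOp hx (hQ i) (hy i)
    exact (pairwise_coprime_X_sub_C (K := ℝ) hx hij).pow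
  have hΓ : (residuePoly x h).natDegree ≤ 2 * m - 2 := by
    by_cases h0 : residuePoly x h = 0
    · simp [h0]
    have h1 := natDegree_X_mul h0
    have h2 := natDegree_residuePoly_le x fun i => x i * h i
    rw [← X_mul_residuePoly hsum] at h2
    omega
  refine eq_zero_of_dvd_of_natDegree_lt hdvd ?_
  rw [natDegree_pow, hω]
  have hy1 := natDegree_derivative_le y
  have hy2 := natDegree_derivative_le (derivative y)
  have hω1 := natDegree_derivative_le (nodal Finset.univ x)
  refine lt_of_le_of_lt (b := 4 * m - 1) ?_ (by omega)
  rw [← max_self (4 * m - 1)]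
  refine natDegree_sub_le_of_le ?_ ?_
  · rw [← max_self (4 * m - 1)]
    refine natDegree_sub_le_of_le ?_ ?_ <;>
    · refine natDegree_mul_le.trans ?_
      omega
  · refine natDegree_mul_le.trans ?_
    omega

lemma natDegree_X_mul_derivative_le (p : ℝ[X]) : (X * derivative p).natDegree ≤ p.natDegree := by
  by_cases h0 : p.natDegree = 0
  · rw [derivative_of_natDegree_zero h0, mul_zero, natDegree_zero]; omega
  · refine natDegree_mul_le.trans ?_
    have := natDegree_derivative_le p
    rw [natDegree_X]; omega

lemma coeff_X_mul_derivative (p : ℝ[X]) (k : ℕ) :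
    (X * derivative p).coeff k = k * p.coeff k := by
  cases k with
  | zero => simp
  | succ k => rw [coeff_X_mul, coeff_derivative]; push_cast; ring

/-- Polynomials of different degrees have nonzero Wronskian. -/
lemma wronskian_ne_zero_of_natDegree_ne {p q : ℝ[X]} (hp : p ≠ 0) (hq : q ≠ 0)
    (h : p.natDegree ≠ q.natDegree) : wronskian p q ≠ 0 := by
  intro hW
  have e1 : p * (X * derivative q) - (X * derivative p) * q = 0 := by
    rw [wronskian] at hW
    linear_combination X * hW
  have e2 := congrArg (fun r => coeff r (p.natDegree + q.natDegree)) e1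
  simp only [coeff_sub, coeff_zero] at e2
  rw [coeff_mul_add_eq_of_natDegree_le le_rfl (natDegree_X_mul_derivative_le q),
    coeff_mul_add_eq_of_natDegree_le (natDegree_X_mul_derivative_le p) le_rfl,
    coeff_X_mul_derivative, coeff_X_mul_derivative] at e2
  have e3 : ((q.natDegree : ℝ) - p.natDegree) * (p.leadingCoeff * q.leadingCoeff) = 0 := by
    simp only [leadingCoeff]
    linear_combination e2
  rcases mul_eq_zero.1 e3 with h1 | h1
  · exact h (by exact_mod_cast (sub_eq_zero.1 h1).symm)
  · exact mul_ne_zero (leadingCoeff_ne_zero.2 hp) (leadingCoeff_ne_zero.2 hq) h1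

/-- The possible degrees of a polynomial solution are the exponents at infinity. -/
lemma natDegree_of_fuchsOp_eq_zero {x h : ι → ℝ} {m : ℕ} (hm : Fintype.card ι = 2 * m)
    (hm0 : 0 < m) (hsum : ∑ i, h i = 0) (hxsum : ∑ i, x i * h i = -((m : ℝ) * (m + 1)))
    {y : ℝ[X]} (hy0 : y ≠ 0) (hy : fuchsOp x h y = 0) :
    y.natDegree = m ∨ y.natDegree = m + 1 := by
  set N := y.natDegree with hN
  set ω := nodal Finset.univ x with hω
  have hωd : ω.natDegree = 2 * m := by rw [natDegree_nodal, Finset.card_univ, hm]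
  have hωc : ω.coeff (2 * m) = 1 := by rw [← hωd]; exact nodal_monic.coeff_natDegree
  have e1 : ω * (X * derivative (X * derivative y)) - ω * (X * derivative y)
      - (X * derivative ω) * (X * derivative y) - X * residuePoly x (fun i => x i * h i) * y
      = 0 := by
    have : X ^ 2 * fuchsOp x h y = 0 := by rw [hy, mul_zero]
    rw [← this, fuchsOp, ← X_mul_residuePoly hsum, derivative_mul, derivative_X]
    ring
  have hR : (X * residuePoly x fun i => x i * h i).natDegree ≤ 2 * m := by
    refine natDegree_mul_le.trans ?_
    have := natDegree_residuePoly_le x fun i => x i * h i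
    rw [natDegree_X]; omega
  have hRc : (X * residuePoly x fun i => x i * h i).coeff (2 * m) = -((m : ℝ) * (m + 1)) := by
    rw [show 2 * m = (Fintype.card ι - 1) + 1 by omega, coeff_X_mul, coeff_residuePoly, hxsum]
  have e2 := congrArg (fun p => coeff p (2 * m + N)) e1
  simp only [coeff_sub, coeff_zero] at e2
  rw [coeff_mul_add_eq_of_natDegree_le hωd.le
      ((natDegree_X_mul_derivative_le _).trans (natDegree_X_mul_derivative_le y)),
    coeff_mul_add_eq_of_natDegree_le hωd.le (natDegree_X_mul_derivative_le y),
    coeff_mul_add_eq_of_natDegree_le ((natDegree_X_mul_derivative_le ω).trans hωd.le)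
      (natDegree_X_mul_derivative_le y),
    coeff_mul_add_eq_of_natDegree_le hR hN.ge, coeff_X_mul_derivative, coeff_X_mul_derivative,
    coeff_X_mul_derivative, hRc, hωc] at e2
  have hlc : y.coeff N ≠ 0 := leadingCoeff_ne_zero.2 hy0
  have e3 : (((N : ℝ) - m) * (N - (m + 1))) * y.coeff N = 0 := by
    push_cast at e2
    linear_combination e2
  rcases mul_eq_zero.1 ((mul_eq_zero.1 e3).resolve_right hlc) with h1 | h1
  · exact Or.inl (by exact_mod_cast sub_eq_zero.1 h1)
  · exact Or.inr (by exact_mod_cast sub_eq_zero.1 h1)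

omit [DecidableEq ι] in
lemma exists_ne_zero_of_conditions {m : ℕ} (hm : Fintype.card ι = 2 * m) (x h : ι → ℝ) (k : ℕ) :
    ∃ y : ℝ[X], y ≠ 0 ∧ y.natDegree ≤ 2 * m + 1 ∧ y.coeff k = 0 ∧
      ∀ i, (derivative y).eval (x i) + h i * y.eval (x i) = 0 := by
  let T : ℝ[X] →ₗ[ℝ] (ι → ℝ) × ℝ :=
    (LinearMap.pi fun i => leval (x i) ∘ₗ derivative + h i • leval (x i)).prod (lcoeff ℝ k)
  have hker : LinearMap.ker (T ∘ₗ (degreeLT ℝ (2 * m + 2)).subtype) ≠ ⊥ := by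
    refine LinearMap.ker_ne_bot_of_finrank_lt ?_
    rw [Module.finrank_prod, Module.finrank_self, Module.finrank_fintype_fun_eq_card, hm,
      (degreeLTEquiv ℝ (2 * m + 2)).finrank_eq, Module.finrank_fin_fun]
    omega
  obtain ⟨y, hy, hy0⟩ := Submodule.exists_mem_ne_zero_of_ne_bot hker
  have hT : T y.1 = 0 := hy
  have hy0' : y.1 ≠ 0 := fun h0 => hy0 (Subtype.ext h0)
  refine ⟨y, hy0', ?_, congrArg Prod.snd hT, fun i => congrFun (congrArg Prod.fst hT) i⟩
  have := (natDegree_lt_iff_degree_lt hy0').2 (mem_degreeLT.1 y.2)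
  omega

/-- A pair of polynomials of degrees `m` and `m + 1` solving the second order equation. -/
lemma exists_polynomial_pair {x h : ι → ℝ} (hx : Function.Injective x) {m : ℕ}
    (hm : Fintype.card ι = 2 * m) (hm0 : 0 < m) (hsum : ∑ i, h i = 0)
    (hxsum : ∑ i, x i * h i = -((m : ℝ) * (m + 1)))
    (hQ : ∀ i, h i ^ 2 + ∑ k, (x i - x k)⁻¹ * (h i - h k) = 0) :
    ∃ p q : ℝ[X], p ≠ 0 ∧ q ≠ 0 ∧ p.natDegree = m ∧ q.natDegree = m + 1 ∧
      (∀ i, (derivative p).eval (x i) + h i * p.eval (x i) = 0) ∧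
      (∀ i, (derivative q).eval (x i) + h i * q.eval (x i) = 0) ∧
      ∃ c : ℝ, c ≠ 0 ∧ wronskian p q = C c * nodal Finset.univ x := by
  obtain ⟨p, hp0, hpd, hpc, hp⟩ := exists_ne_zero_of_conditions hm x h (m + 1)
  obtain ⟨q, hq0, hqd, hqc, hq⟩ := exists_ne_zero_of_conditions hm x h m
  have hTp := fuchsOp_eq_zero hx hm hm0 hsum hQ hpd hp
  have hTq := fuchsOp_eq_zero hx hm hm0 hsum hQ hqd hq
  have hpm : p.natDegree = m := by
    refine (natDegree_of_fuchsOp_eq_zero hm hm0 hsum hxsum hp0 hTp).resolve_right fun h1 => ?_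
    rw [← h1] at hpc
    exact leadingCoeff_ne_zero.2 hp0 hpc
  have hqm : q.natDegree = m + 1 := by
    refine (natDegree_of_fuchsOp_eq_zero hm hm0 hsum hxsum hq0 hTq).resolve_left fun h1 => ?_
    rw [← h1] at hqc
    exact leadingCoeff_ne_zero.2 hq0 hqc
  refine ⟨p, q, hp0, hq0, hpm, hqm, hp, hq, ?_⟩
  set ω := nodal Finset.univ x with hω
  have hω0 : ω ≠ 0 := nodal_ne_zero
  have hW : ω * derivative (wronskian p q) = derivative ω * wronskian p q := by
    simp only [fuchsOp] at hTp hTq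
    simp only [wronskian, derivative_sub, derivative_mul]
    linear_combination p * hTq - q * hTp
  have hcop : IsCoprime ω (derivative ω) := separable_prod_X_sub_C_iff.2 hx
  obtain ⟨k, hk⟩ : ω ∣ wronskian p q := hcop.dvd_of_dvd_mul_left ⟨_, hW.symm⟩
  have hk0 : derivative k = 0 := by
    rw [hk, derivative_mul] at hW
    have : ω * ω * derivative k = 0 := by linear_combination hW
    exact (mul_eq_zero.1 this).resolve_left (mul_ne_zero hω0 hω0)
  rw [eq_C_of_derivative_eq_zero hk0] at hk
  refine ⟨k.coeff 0, ?_, by rw [hk, mul_comm]⟩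
  intro hc
  rw [hc, C_0, mul_zero] at hk
  exact wronskian_ne_zero_of_natDegree_ne hp0 hq0 (by omega) hk

open Filter Topology in
/-- Where the Wronskian does not vanish, the quotient of two polynomials is locally injective. -/
lemma exists_mem_nhds_of_eval_wronskian_ne_zero {a b : ℂ[X]} {z : ℂ}
    (hW : (wronskian a b).eval z ≠ 0) :
    ∃ U ∈ 𝓝 z, ∀ y ∈ U, ∀ y' ∈ U, a.eval y * b.eval y' = a.eval y' * b.eval y → y = y' := by
  wlog hb : b.eval z ≠ 0 generalizing a b
  · have ha : a.eval z ≠ 0 := by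
      intro ha
      push Not at hb
      exact hW (by simp [wronskian, ha, hb])
    obtain ⟨U, hU, h⟩ := this (a := b) (b := a)
      (by rwa [← wronskian_neg_eq, eval_neg, neg_ne_zero]) ha
    exact ⟨U, hU, fun y hy y' hy' hyy' => h y hy y' hy' (by linear_combination -hyy')⟩
  have hg : HasStrictDerivAt (fun y => a.eval y / b.eval y)
      ((a.derivative.eval z * b.eval z - a.eval z * b.derivative.eval z) / b.eval z ^ 2) z :=
    (a.hasStrictDerivAt z).div (b.hasStrictDerivAt z) hb
  have hne : (a.derivative.eval z * b.eval z - a.eval z * b.derivative.eval z) / b.eval z ^ 2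
      ≠ 0 := by
    refine div_ne_zero (fun h => hW ?_) (pow_ne_zero 2 hb)
    simp only [wronskian, eval_sub, eval_mul]
    linear_combination -h
  have hb' : ∀ᶠ y in 𝓝 z, b.eval y ≠ 0 := b.continuous.continuousAt.eventually_ne hb
  refine ⟨_, (hg.eventually_left_inverse hne).and hb', fun y hy y' hy' h => ?_⟩
  have hgy : a.eval y / b.eval y = a.eval y' / b.eval y' := (div_eq_div_iff hy.2 hy'.2).2 h
  rw [← hy.1, ← hy'.1]
  exact congrArg _ hgy

open Filter Topology in
/-- At a simple zero of the Wronskian, the quotient of two polynomials is not locally injective. -/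
lemma exists_ne_of_eval_wronskian_eq_zero {a b : ℂ[X]} {z : ℂ}
    (hab : a.eval z ≠ 0 ∨ b.eval z ≠ 0) (hW : (wronskian a b).eval z = 0)
    (hW' : (derivative (wronskian a b)).eval z ≠ 0) {U : Set ℂ} (hU : U ∈ 𝓝 z) :
    ∃ y ∈ U, ∃ y' ∈ U, y ≠ y' ∧ a.eval y * b.eval y' = a.eval y' * b.eval y := by
  wlog hb : b.eval z ≠ 0 generalizing a b
  · obtain ⟨y, hy, y', hy', hne, h⟩ := this (a := b) (b := a) hab.symm
      (by rw [← wronskian_neg_eq, eval_neg, hW, neg_zero])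
      (by rwa [← wronskian_neg_eq, derivative_neg, eval_neg, neg_ne_zero]) (hab.resolve_right hb)
    exact ⟨y, hy, y', hy', hne, by linear_combination -h⟩
  obtain ⟨M, hM⟩ : (X - C z) ^ 2 ∣ C (b.eval z) * a - C (a.eval z) * b := by
    refine X_sub_C_sq_dvd ?_ ?_
    · simp [mul_comm]
    · simp only [wronskian, eval_sub, eval_mul] at hW
      simp only [derivative_sub, derivative_C_mul, eval_sub, eval_C_mul]
      linear_combination -hW
  have hMz : M.eval z ≠ 0 := by
    intro h0
    have h2 := congrArg (fun p => (derivative (derivative p)).eval z) hM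
    simp [h0, derivative_X_sub_C_sq] at h2
    refine hW' ?_
    simp only [wronskian, derivative_sub, derivative_mul, eval_sub, eval_add, eval_mul]
    linear_combination -h2
  set r : ℂ → ℂ := fun y => M.eval y / b.eval y * (b.eval z / M.eval z) with hr
  have hrz : r z = 1 := by simp only [hr]; field_simp
  have hra : AnalyticAt ℂ r z :=
    ((AnalyticAt.aeval_polynomial analyticAt_id M).div (AnalyticAt.aeval_polynomial analyticAt_id b)
      (by simpa using hb)).mul analyticAt_const
  set ψ : ℂ → ℂ := fun y => r y ^ (((2 : ℕ) : ℂ)⁻¹) with hψ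
  have hψa : AnalyticAt ℂ ψ z := hra.cpow analyticAt_const (by simp [hrz])
  have hψ2 (y : ℂ) : ψ y ^ 2 = r y := Complex.cpow_nat_inv_pow _ two_ne_zero
  have hψz : ψ z = 1 := by simp [hψ, hrz]
  have hφ : HasStrictDerivAt (fun y => (y - z) * ψ y) 1 z := by
    have h1 : HasStrictDerivAt (fun y : ℂ => y - z) 1 z := (hasStrictDerivAt_id z).sub_const z
    have := h1.mul hψa.hasStrictDerivAt
    rw [hψz, one_mul, sub_self, zero_mul, add_zero] at this
    exact this
  have hb' : ∀ᶠ y in 𝓝 z, b.eval y ≠ 0 := b.continuous.continuousAt.eventually_ne hb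
  have hS := hφ.map_nhds_eq one_ne_zero
  simp only [sub_self, zero_mul] at hS
  have hS' : (fun y => (y - z) * ψ y) '' (U ∩ {y | b.eval y ≠ 0}) ∈ 𝓝 (0 : ℂ) := by
    rw [← hS]
    exact image_mem_map (inter_mem hU hb')
  have hneg : Tendsto (fun t : ℂ => -t) (𝓝 0) (𝓝 0) := by
    simpa using (continuous_neg (G := ℂ)).tendsto 0
  have hev : ∀ᶠ t in 𝓝[≠] (0 : ℂ), t ∈ (fun y => (y - z) * ψ y) '' (U ∩ {y | b.eval y ≠ 0}) ∧
      -t ∈ (fun y => (y - z) * ψ y) '' (U ∩ {y | b.eval y ≠ 0}) ∧ t ≠ 0 :=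
    (eventually_nhdsWithin_of_eventually_nhds hS').and
      ((eventually_nhdsWithin_of_eventually_nhds (hneg.eventually hS')).and
        eventually_mem_nhdsWithin)
  obtain ⟨t, ⟨y, ⟨hyU, hyb⟩, hyt⟩, ⟨y', ⟨hyU', hyb'⟩, hyt'⟩, ht⟩ := hev.exists
  simp only [Set.mem_ofPred_eq] at hyb hyb'
  refine ⟨y, hyU, y', hyU', fun hyy => ht ?_, ?_⟩
  · subst hyy
    have h2 : t + t = 0 := by linear_combination hyt' - hyt
    simpa using h2
  · have e1 : (y - z) ^ 2 * r y = (y' - z) ^ 2 * r y' := by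
      rw [← hψ2, ← hψ2]
      linear_combination ((y - z) * ψ y + t) * hyt - ((y' - z) * ψ y' - t) * hyt'
    have e2 : (y - z) ^ 2 * M.eval y * b.eval y' = (y' - z) ^ 2 * M.eval y' * b.eval y := by
      simp only [hr] at e1
      field_simp at e1
      linear_combination e1
    have e3 (s : ℂ) : b.eval z * a.eval s - a.eval z * b.eval s = (s - z) ^ 2 * M.eval s := by
      simpa using congrArg (eval s) hM
    refine mul_left_cancel₀ hb ?_
    linear_combination e2 + b.eval y' * e3 y - b.eval y * e3 y'

lemma ratExt_coe (f₁ f₀ : ℂ[X]) (z : ℂ) : ratExt f₁ f₀ (z : OnePoint ℂ)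
    = if f₀.eval z = 0 then ∞ else ((f₁.eval z / f₀.eval z : ℂ) : OnePoint ℂ) := rfl

lemma ratExt_infty {f₁ f₀ : ℂ[X]} (h : f₀.degree < f₁.degree) : ratExt f₁ f₀ ∞ = ∞ :=
  if_pos h

lemma eval_ne_zero_or_of_isCoprime {f₁ f₀ : ℂ[X]} (hf : IsCoprime f₁ f₀) (z : ℂ) :
    f₁.eval z ≠ 0 ∨ f₀.eval z ≠ 0 := by
  obtain ⟨u, v, huv⟩ := hf
  by_contra! h
  simpa [h.1, h.2] using congrArg (eval z) huv

lemma ratExt_coe_eq_coe_iff {f₁ f₀ : ℂ[X]} (hf : IsCoprime f₁ f₀) (y y' : ℂ) :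
    ratExt f₁ f₀ (y : OnePoint ℂ) = ratExt f₁ f₀ (y' : OnePoint ℂ)
      ↔ f₁.eval y * f₀.eval y' = f₁.eval y' * f₀.eval y := by
  have h1 := eval_ne_zero_or_of_isCoprime hf y
  have h2 := eval_ne_zero_or_of_isCoprime hf y'
  rw [ratExt_coe, ratExt_coe]
  by_cases hy : f₀.eval y = 0 <;> by_cases hy' : f₀.eval y' = 0
  · simp [hy, hy']
  · simp_all
  · simp_all
  · rw [if_neg hy, if_neg hy', OnePoint.coe_eq_coe, div_eq_div_iff hy hy']

open Topology in
lemma isCritPt_ratExt_coe_iff {f₁ f₀ : ℂ[X]} (hf : IsCoprime f₁ f₀)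
    (hW : (wronskian f₁ f₀).Separable) (z : ℂ) :
    IsCritPt (ratExt f₁ f₀) (z : OnePoint ℂ) ↔ (wronskian f₁ f₀).eval z = 0 := by
  constructor
  · intro hz
    by_contra hne
    obtain ⟨U, hU, h⟩ := exists_mem_nhds_of_eval_wronskian_ne_zero hne
    refine hz ⟨(↑) '' U, ?_, ?_⟩
    · rw [OnePoint.nhds_coe_eq]
      exact Filter.image_mem_map hU
    · rintro _ ⟨y, hy, rfl⟩ _ ⟨y', hy', rfl⟩ hyy'
      rw [h y hy y' hy' ((ratExt_coe_eq_coe_iff hf y y').1 hyy')]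
  · rintro hz ⟨U, hU, hinj⟩
    rw [OnePoint.nhds_coe_eq] at hU
    obtain ⟨y, hy, y', hy', hne, h⟩ := exists_ne_of_eval_wronskian_eq_zero
      (eval_ne_zero_or_of_isCoprime hf z) hz
      ((eval_ne_zero_or_of_isCoprime hW z).resolve_left (not_not.2 hz)) hU
    exact hne (OnePoint.coe_injective (hinj hy hy' ((ratExt_coe_eq_coe_iff hf y y').2 h)))

open Topology in
/-- A rational function with a simple pole at infinity is locally injective there. -/
lemma not_isCritPt_ratExt_infty {f₁ f₀ : ℂ[X]} (hf : IsCoprime f₁ f₀) (h0 : f₀ ≠ 0)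
    (hdeg : f₁.natDegree = f₀.natDegree + 1) : ¬ IsCritPt (ratExt f₁ f₀) ∞ := by
  have h1 : f₁ ≠ 0 := by
    rintro rfl
    simp at hdeg
  have hlt : f₀.degree < f₁.degree := by
    rw [degree_eq_natDegree h0, degree_eq_natDegree h1, hdeg]
    exact_mod_cast Nat.lt_succ_self _
  have hr0 : f₀.reverse.eval 0 ≠ 0 := by
    rw [← coeff_zero_eq_eval_zero, coeff_zero_reverse]
    exact leadingCoeff_ne_zero.2 h0
  have hr1 : f₁.reverse.eval 0 ≠ 0 := by
    rw [← coeff_zero_eq_eval_zero, coeff_zero_reverse]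
    exact leadingCoeff_ne_zero.2 h1
  obtain ⟨U, hU, h⟩ := exists_mem_nhds_of_eval_wronskian_ne_zero (a := X * f₀.reverse)
    (b := f₁.reverse) (z := 0) (by simp [wronskian, hr0, hr1])
  have e1 {y : ℂ} (hy : y ≠ 0) : f₁.reverse.eval y⁻¹ * y ^ (f₀.natDegree + 1) = f₁.eval y := by
    let _ := invertibleOfNonzero hy
    have := eval₂_reverse_mul_pow (RingHom.id ℂ) y f₁
    rwa [invOf_eq_inv, eval₂_id, eval₂_id, hdeg] at this
  have e0 {y : ℂ} (hy : y ≠ 0) :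
      (X * f₀.reverse).eval y⁻¹ * y ^ (f₀.natDegree + 1) = f₀.eval y := by
    let _ := invertibleOfNonzero hy
    have := eval₂_reverse_mul_pow (RingHom.id ℂ) y f₀
    rw [invOf_eq_inv, eval₂_id, eval₂_id] at this
    rw [eval_mul, eval_X, ← this, pow_succ]
    linear_combination (f₀.reverse.eval y⁻¹ * y ^ f₀.natDegree) * inv_mul_cancel₀ hy
  have hne {y : ℂ} (hy : y ≠ 0) (hyU : y⁻¹ ∈ U) : ratExt f₁ f₀ (y : OnePoint ℂ) ≠ ∞ := by
    rw [ratExt_coe]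
    split_ifs with hy0
    · rw [← e0 hy] at hy0
      have h2 := h y⁻¹ hyU 0 (mem_of_mem_nhds hU)
        (by rw [(mul_eq_zero.1 hy0).resolve_right (pow_ne_zero _ hy)]; simp)
      exact absurd h2 (inv_ne_zero hy)
    · exact OnePoint.coe_ne_infty _
  refine not_not.2 ⟨insert ∞ ((↑) '' {y : ℂ | y ≠ 0 ∧ y⁻¹ ∈ U}), ?_, ?_⟩
  · rw [OnePoint.nhds_infty_eq, Filter.coclosedCompact_eq_cocompact,
      ← Metric.cobounded_eq_cocompact]
    refine Filter.mem_sup.2 ⟨?_, Filter.mem_pure.2 (Set.mem_insert _ _)⟩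
    refine Filter.mem_of_superset (Filter.image_mem_map ?_) (Set.subset_insert _ _)
    exact (Bornology.eventually_ne_cobounded 0).and
      (Filter.tendsto_inv₀_cobounded.eventually hU)
  · rintro _ (rfl | ⟨y, ⟨hy0, hy⟩, rfl⟩) _ (rfl | ⟨y', ⟨hy0', hy'⟩, rfl⟩) hyy'
    · rfl
    · exact absurd (hyy'.symm.trans (ratExt_infty hlt)) (hne hy0' hy')
    · exact absurd (hyy'.trans (ratExt_infty hlt)) (hne hy0 hy)
    · rw [ratExt_coe_eq_coe_iff hf, ← e1 hy0, ← e1 hy0', ← e0 hy0, ← e0 hy0'] at hyy'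
      have h3 := h y⁻¹ hy y'⁻¹ hy' (mul_right_cancel₀
        (mul_ne_zero (pow_ne_zero (f₀.natDegree + 1) hy0) (pow_ne_zero (f₀.natDegree + 1) hy0'))
        (by linear_combination -hyy'))
      rw [inv_injective h3]

/-- If two fractions of the same degree are equivalent, the numerator and the denominator of the
first are linear combinations of those of the second, up to a common scalar. -/
lemma exists_smul_eq_of_ratEquiv {f₁ f₀ g₁ g₀ : ℂ[X]} (hf : IsCoprime f₁ f₀) (hg0 : g₀ ≠ 0)
    (hg : g₀.degree < g₁.degree) (hfg : f₀.degree < f₁.degree) (hdeg : f₁.degree = g₁.degree)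
    (h : RatEquiv f₁ f₀ g₁ g₀) :
    ∃ k a b c e : ℂ, k ≠ 0 ∧ k • f₁ = a • g₁ + b • g₀ ∧ k • f₀ = c • g₁ + e • g₀ := by
  obtain ⟨a, b, c, e, hdet, h⟩ := h
  have hf1 : f₁ ≠ 0 := ne_zero_of_degree_gt hfg
  obtain ⟨r, hr⟩ : f₁ ∣ a • g₁ + b • g₀ := hf.dvd_of_dvd_mul_left ⟨_, h.symm⟩
  have hG0 : c • g₁ + e • g₀ = f₀ * r := by
    refine mul_left_cancel₀ hf1 ?_
    rw [h, hr]
    ring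
  have hne : a • g₁ + b • g₀ ≠ 0 := by
    intro h0
    have ha : a = 0 := by
      by_contra ha
      have : (a • g₁ + b • g₀).degree = g₁.degree := by
        rw [degree_add_eq_left_of_degree_lt,
          degree_smul_of_smul_regular _ (IsSMulRegular.of_ne_zero ha)]
        rw [degree_smul_of_smul_regular _ (IsSMulRegular.of_ne_zero ha)]
        exact (degree_smul_le _ _).trans_lt hg
      rw [h0, degree_zero] at this
      exact not_lt_bot (this ▸ hg)
    subst ha
    rw [zero_smul, zero_add, smul_eq_zero] at h0
    exact hdet (by rw [h0.resolve_right hg0]; ring)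
  have hr0 : r ≠ 0 := by
    rintro rfl
    exact hne (by rw [hr, mul_zero])
  have hrdeg : r.natDegree = 0 := by
    have h1 : (f₁ * r).natDegree ≤ f₁.natDegree := by
      rw [← hr, natDegree_eq_of_degree_eq hdeg]
      refine natDegree_add_le_of_degree_le (natDegree_smul_le _ _) ?_
      exact (natDegree_smul_le _ _).trans (natDegree_le_natDegree hg.le)
    rw [natDegree_mul hf1 hr0] at h1
    omega
  rw [natDegree_eq_zero] at hrdeg
  obtain ⟨k, rfl⟩ := hrdeg
  refine ⟨k, a, b, c, e, fun hk => hr0 (by rw [hk, C_0]), ?_, ?_⟩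
  · rw [hr, smul_eq_C_mul, mul_comm]
  · rw [hG0, smul_eq_C_mul, mul_comm]

lemma eval_map_ofReal (p : ℝ[X]) (t : ℝ) :
    (p.map (algebraMap ℝ ℂ)).eval (t : ℂ) = ((p.eval t : ℝ) : ℂ) := by
  rw [eval_map_algebraMap]
  exact aeval_algebraMap_apply_eq_algebraMap_eval t p

lemma first_order_condition_map {p : ℝ[X]} {t s : ℝ}
    (h : (derivative p).eval t + s * p.eval t = 0) :
    (derivative (p.map (algebraMap ℝ ℂ))).eval (t : ℂ)
      + s * (p.map (algebraMap ℝ ℂ)).eval (t : ℂ) = 0 := by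
  rw [derivative_map, eval_map_ofReal, eval_map_ofReal]
  exact_mod_cast h

/-- Coprimality follows from squarefreeness of the Wronskian. -/
lemma isCoprime_of_squarefree_wronskian {p q : ℝ[X]} (hp : p ≠ 0)
    (h : Squarefree (wronskian p q)) : IsCoprime p q := by
  refine isCoprime_of_irreducible_dvd (fun h0 => hp h0.1) fun z hz hzp hzq => ?_
  obtain ⟨a, rfl⟩ := hzp
  obtain ⟨b, rfl⟩ := hzq
  refine hz.not_isUnit (h z ⟨wronskian a b, ?_⟩)
  simp only [wronskian, derivative_mul]
  ring

/-- Common eigenvalues of the Hamiltonians give a rational function with prescribed critical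
points, whose entries satisfy first order conditions there. -/
lemma exists_rational_function {x h : ι → ℝ} (hx : Function.Injective x) {m : ℕ}
    (hm : Fintype.card ι = 2 * m) (hm0 : 0 < m) (hsum : ∑ i, h i = 0)
    (hxsum : ∑ i, x i * h i = -((m : ℝ) * (m + 1)))
    (hQ : ∀ i, h i ^ 2 + ∑ k, (x i - x k)⁻¹ * (h i - h k) = 0) :
    ∃ g₁ g₀ : ℝ[X], g₁.natDegree = m + 1 ∧ g₀ ≠ 0 ∧ g₀.natDegree = m ∧ IsCoprime g₁ g₀ ∧
      (∀ i, (derivative g₁).eval (x i) + h i * g₁.eval (x i) = 0) ∧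
      (∀ i, (derivative g₀).eval (x i) + h i * g₀.eval (x i) = 0) ∧
      {p : OnePoint ℂ | IsCritPt
          (ratExt (g₁.map (algebraMap ℝ ℂ)) (g₀.map (algebraMap ℝ ℂ))) p} =
        Set.range fun j => ((x j : ℂ) : OnePoint ℂ) := by
  obtain ⟨p, q, hp0, hq0, hpd, hqd, hp, hq, c, hc, hW⟩ :=
    exists_polynomial_pair hx hm hm0 hsum hxsum hQ
  have hsep : (wronskian q p).Separable := by
    rw [← wronskian_neg_eq, hW, ← neg_mul, ← C_neg]
    exact (separable_prod_X_sub_C_iff.2 hx).unit_mul (isUnit_C.2 (neg_ne_zero.2 hc).isUnit)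
  have hcop : IsCoprime q p := isCoprime_of_squarefree_wronskian hq0 hsep.squarefree
  refine ⟨q, p, hqd, hp0, hpd, hcop, hq, hp, ?_⟩
  have hcop' : IsCoprime (q.map (algebraMap ℝ ℂ)) (p.map (algebraMap ℝ ℂ)) :=
    hcop.map (mapRingHom (algebraMap ℝ ℂ))
  have hWmap : wronskian (q.map (algebraMap ℝ ℂ)) (p.map (algebraMap ℝ ℂ))
      = (wronskian q p).map (algebraMap ℝ ℂ) := by
    simp [wronskian, derivative_map]
  have hWeval (z : ℂ) : (wronskian (q.map (algebraMap ℝ ℂ)) (p.map (algebraMap ℝ ℂ))).eval z = 0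
      ↔ ∃ j, (x j : ℂ) = z := by
    rw [hWmap, ← wronskian_neg_eq, hW, nodal, ← neg_mul, ← C_neg, Polynomial.map_mul, map_C,
      Polynomial.map_prod, eval_mul, eval_C, eval_prod, mul_eq_zero, Finset.prod_eq_zero_iff,
      or_iff_right (by simpa using hc)]
    simp [sub_eq_zero, eq_comm]
  have hsep' : (wronskian (q.map (algebraMap ℝ ℂ)) (p.map (algebraMap ℝ ℂ))).Separable := by
    rw [hWmap]
    exact hsep.map
  ext P
  induction P using OnePoint.rec with
  | infty =>
    refine iff_of_false (not_isCritPt_ratExt_infty hcop' ?_ ?_) ?_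
    · exact (Polynomial.map_ne_zero_iff (algebraMap ℝ ℂ).injective).2 hp0
    · rw [natDegree_map, natDegree_map, hqd, hpd]
    · rintro ⟨j, hj⟩
      exact OnePoint.coe_ne_infty _ hj
  | coe z =>
    rw [Set.mem_ofPred_eq, isCritPt_ratExt_coe_iff hcop' hsep', hWeval]
    simp [Set.mem_range]

omit [DecidableEq ι] [Fintype ι] in
/-- Equivalent pairs satisfy the same first order conditions. -/
lemma eq_of_ratEquiv {x h h' : ι → ℝ} {m : ℕ} {f₁ f₀ g₁ g₀ : ℝ[X]}
    (hf1 : f₁.natDegree = m + 1) (hf00 : f₀ ≠ 0) (hf0 : f₀.natDegree = m)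
    (hf : IsCoprime f₁ f₀)
    (hf1x : ∀ i, (derivative f₁).eval (x i) + h i * f₁.eval (x i) = 0)
    (hf0x : ∀ i, (derivative f₀).eval (x i) + h i * f₀.eval (x i) = 0)
    (hg1 : g₁.natDegree = m + 1) (hg00 : g₀ ≠ 0) (hg0 : g₀.natDegree = m)
    (hg1x : ∀ i, (derivative g₁).eval (x i) + h' i * g₁.eval (x i) = 0)
    (hg0x : ∀ i, (derivative g₀).eval (x i) + h' i * g₀.eval (x i) = 0)
    (he : RatEquiv (f₁.map (algebraMap ℝ ℂ)) (f₀.map (algebraMap ℝ ℂ))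
      (g₁.map (algebraMap ℝ ℂ)) (g₀.map (algebraMap ℝ ℂ))) : h = h' := by
  have hf10 : f₁ ≠ 0 := by rintro rfl; simp at hf1
  have hg10 : g₁ ≠ 0 := by rintro rfl; simp at hg1
  have hf' : IsCoprime (f₁.map (algebraMap ℝ ℂ)) (f₀.map (algebraMap ℝ ℂ)) :=
    hf.map (mapRingHom (algebraMap ℝ ℂ))
  obtain ⟨k, a, b, c, e, hk, e1, e0⟩ := exists_smul_eq_of_ratEquiv hf'
    ((Polynomial.map_ne_zero_iff (algebraMap ℝ ℂ).injective).2 hg00)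
    (by rw [degree_map, degree_map, degree_eq_natDegree hg00, degree_eq_natDegree hg10, hg0, hg1]
        exact_mod_cast Nat.lt_succ_self _)
    (by rw [degree_map, degree_map, degree_eq_natDegree hf00, degree_eq_natDegree hf10, hf0, hf1]
        exact_mod_cast Nat.lt_succ_self _)
    (by rw [degree_map, degree_map, degree_eq_natDegree hf10, degree_eq_natDegree hg10, hf1, hg1])
    he
  funext i
  have key {u : ℝ[X]} {s t : ℂ} (hu : (derivative u).eval (x i) + h i * u.eval (x i) = 0)
      (hst : k • u.map (algebraMap ℝ ℂ)
        = s • g₁.map (algebraMap ℝ ℂ) + t • g₀.map (algebraMap ℝ ℂ)) :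
      (h i - h' i : ℂ) * (u.map (algebraMap ℝ ℂ)).eval (x i : ℂ) = 0 := by
    have h0 := first_order_condition_map hu
    have h1 := first_order_condition_map (hg1x i)
    have h2 := first_order_condition_map (hg0x i)
    have h3 := congrArg (eval (x i : ℂ)) hst
    have h4 := congrArg (fun r => eval (x i : ℂ) (derivative r)) hst
    simp only [derivative_add, derivative_smul, eval_add, eval_smul, smul_eq_mul] at h3 h4
    refine (mul_eq_zero.1 ?_).resolve_left hk
    linear_combination k * h0 - s * h1 - t * h2 - h4 - h' i * h3
  have hsub : (h i - h' i : ℂ) = 0 := by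
    rcases eval_ne_zero_or_of_isCoprime hf' (x i) with hne | hne
    · exact (mul_eq_zero.1 (key (hf1x i) e1)).resolve_right hne
    · exact (mul_eq_zero.1 (key (hf0x i) e0)).resolve_right hne
  exact_mod_cast sub_eq_zero.1 hsub

end Gaudin

/-- **Theorem 2.** For given distinct real numbers `x₁ < … < x_{2d−2}` there exist at least
`u_d` pairwise nonequivalent rational functions of degree `d` with real coefficients whose
set of critical points on the Riemann sphere is exactly `{x₁, …, x_{2d−2}}`. -/
theorem at_least_catalan_real_rational_functions
    (d : ℕ) (hd : 2 ≤ d) (x : Fin (2 * d - 2) → ℝ) (hx : StrictMono x) :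
    ∃ F : Fin (ud d) → ℂ[X] × ℂ[X],
      (∀ i, IsRatOfDeg d (F i).1 (F i).2 ∧
        (∃ g₁ g₀ : ℝ[X], (F i).1 = g₁.map (algebraMap ℝ ℂ) ∧
          (F i).2 = g₀.map (algebraMap ℝ ℂ)) ∧
        {p : OnePoint ℂ | IsCritPt (ratExt (F i).1 (F i).2) p} =
          Set.range fun j => (((x j : ℂ)) : OnePoint ℂ)) ∧
      (∀ i j, i ≠ j → ¬ RatEquiv (F i).1 (F i).2 (F j).1 (F j).2) := by
  obtain ⟨m, rfl⟩ : ∃ m, d = m + 1 := ⟨d - 1, by omega⟩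
  have hm : Fintype.card (Fin (2 * (m + 1) - 2)) = 2 * m := by
    rw [Fintype.card_fin]; omega
  have hm0 : 0 < m := by omega
  obtain ⟨h, hinj, hh⟩ := Gaudin.exists_injective_singlet_eigenvalues hx.injective hm
  have hu : ud (m + 1) ≤ Module.finrank ℝ (Gaudin.singlets (Fin (2 * (m + 1) - 2)) m) := by
    have := Gaudin.catalan_le_finrank_singlets hm hm0
    rwa [← show 2 * (m + 1) - 2 = 2 * m by omega] at this
  choose w hw hw0 hwh using hh
  have hrel (i : Fin (ud (m + 1))) := Gaudin.joint_eigenvalue_relations hx.injective hm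
    (hw (Fin.castLE hu i)) (hw0 _) (hwh _)
  have hrat (i : Fin (ud (m + 1))) := Gaudin.exists_rational_function hx.injective hm hm0
    (hrel i).1 (hrel i).2.1 (hrel i).2.2
  choose g₁ g₀ hg1 hg00 hg0 hg hg1x hg0x hcrit using hrat
  refine ⟨fun i => ((g₁ i).map (algebraMap ℝ ℂ), (g₀ i).map (algebraMap ℝ ℂ)),
    fun i => ⟨⟨(hg i).map (mapRingHom (algebraMap ℝ ℂ)), ?_⟩, ⟨g₁ i, g₀ i, rfl, rfl⟩, hcrit i⟩,
    fun i j hij he => hij (Fin.castLE_injective hu (hinj ?_))⟩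
  · have hne : g₁ i ≠ 0 := by
      intro h0
      have := hg1 i
      simp [h0] at this
    rw [degree_map, degree_map, degree_eq_natDegree hne, degree_eq_natDegree (hg00 i), hg1, hg0]
    exact max_eq_left (by exact_mod_cast Nat.le_succ m)
  · exact Gaudin.eq_of_ratEquiv (hg1 i) (hg00 i) (hg0 i) (hg i) (hg1x i) (hg0x i)
      (hg1 j) (hg00 j) (hg0 j) (hg1x j) (hg0x j) he
end

section
/- (B. and M. Shapiro conjecture for codimension-2 Schubert conditions) Let d ≥ 2 and let z₁, …, z_{2d−2} be distinct real numbers. For z ∈ ℂ let E(z) = (1, z, z², …, z^d) ∈ ℂ^{d+1} and E′(z) = (0, 1, 2z, …, d·z^{d−1}). If H ⊆ ℂ^{d+1} is a complex linear subspace of dimension d−1 such that H ∩ span_ℂ{E(zᵢ), E′(zᵢ)} ≠ {0} for every i = 1, …, 2d−2, then H is real: H is invariant under coordinatewise complex conjugation (equivalently, H is spanned by vectors with real coordinates). -/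
/-- The rational normal curve `E(z) = (1, z, z², …, z^d)` in `ℂ^{d+1}`. -/
noncomputable def rncE (d : ℕ) (t : ℂ) : Fin (d + 1) → ℂ := fun j => t ^ (j : ℕ)

/-- Its derivative `E′(z) = (0, 1, 2z, …, d·z^{d−1})`. -/
noncomputable def rncE' (d : ℕ) (t : ℂ) : Fin (d + 1) → ℂ :=
  fun j => ((j : ℕ) : ℂ) * t ^ ((j : ℕ) - 1)

section GaudinAlgebra

variable {ι R A : Type*} [Fintype ι] [DecidableEq ι] [CommRing R] [Ring A] [Algebra R A]
  {e : ι → A} {t : ι → ι → A}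

theorem commute_gaudin (ht : ∀ i, t i i = 0) (hs : ∀ i j, t j i = -t i j)
    (hcomm : ∀ i j k l, i ≠ k → i ≠ l → j ≠ k → j ≠ l → Commute (t i j) (t k l))
    (hYB : ∀ i j k, i ≠ j → i ≠ k → j ≠ k → ⁅t i j, t j k⁆ + ⁅t i k, t j i⁆ + ⁅t i k, t j k⁆ = 0)
    (hee : ∀ i j, Commute (e i) (e j))
    (hte : ∀ i j k, k ≠ i → k ≠ j → Commute (t i j) (e k))
    (hte' : ∀ i j, Commute (t i j) (e i + e j)) (p q : R) (i j : ι) :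
    Commute (q • e i + p • ∑ k, t i k) (q • e j + p • ∑ k, t j k) := by
  let _ : LieRing A := LieRing.ofAssociativeRing
  rcases eq_or_ne i j with rfl | hij
  · exact Commute.refl _
  have hself : ∀ a b, ⁅t a b, t b a⁆ = 0 := by
    intro a b
    rw [hs a b, lie_neg, lie_self, neg_zero]
  have hterm : ∀ k l, ⁅t i k, t j l⁆ =
      (if l = i then ⁅t i k, t j i⁆ else 0) +
      (if k = j then ⁅t i j, t j l⁆ else 0) +
      (if l = k then ⁅t i k, t j k⁆ else 0) := by
    intro k l
    rcases eq_or_ne k i with rfl | hki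
    · simp [ht, hij]
    rcases eq_or_ne l j with rfl | hlj
    · rcases eq_or_ne k l with rfl | hkl
      · simp [ht, hself]
      · rcases eq_or_ne l i with rfl | hli
        · exact absurd rfl hij
        · simp [ht, hkl, hkl.symm, hli]
    rcases eq_or_ne l i with rfl | hli
    · rcases eq_or_ne k j with rfl | hkj
      · simp [hself, hki.symm]
      · simp [hkj, hki.symm]
    rcases eq_or_ne k j with rfl | hkj
    · simp [hli, hlj]
    rcases eq_or_ne l k with rfl | hlk
    · simp [hli, hkj]
    · simp [hli, hlk, hkj, (hcomm i k j l hij hli.symm hkj hlk.symm).lie_eq]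
  have hterms : ⁅∑ k, t i k, ∑ l, t j l⁆ = 0 := by
    have hsum : ∀ k, ⁅t i k, t j i⁆ + ⁅t i j, t j k⁆ + ⁅t i k, t j k⁆ = 0 := by
      intro k
      rcases eq_or_ne k i with rfl | hki
      · simp [ht, hself]
      rcases eq_or_ne k j with rfl | hkj
      · simp [ht, hself]
      rw [← hYB i j k hij hki.symm hkj.symm]
      abel
    have hexp : ⁅∑ k, t i k, ∑ l, t j l⁆ = ∑ k, ∑ l, ⁅t i k, t j l⁆ := by
      simp only [sum_lie, lie_sum]
      exact Finset.sum_comm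
    rw [hexp, Finset.sum_congr rfl fun k _ => Finset.sum_congr rfl fun l _ => hterm k l]
    refine Eq.trans ?_ (Finset.sum_eq_zero (s := Finset.univ) fun k _ => hsum k)
    simp only [Finset.sum_add_distrib]
    congr 1
    · congr 1
      · simp
      · rw [Finset.sum_comm]
        simp
    · simp
  have hup : ⁅e i, ∑ l, t j l⁆ + ⁅∑ k, t i k, e j⁆ = 0 := by
    simp only [sum_lie, lie_sum]
    rw [Fintype.sum_eq_single i, Fintype.sum_eq_single j]
    · have := (hte' i j).lie_eq
      rw [lie_add] at this
      rw [hs i j, lie_neg, ← lie_skew, neg_neg, this]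
    · intro k hk
      exact (hte _ _ _ hij.symm hk.symm).lie_eq
    · intro k hk
      exact (hte _ _ _ hij hk.symm).symm.lie_eq
  rw [Ring.lie_def] at hterms hup
  rw [Ring.lie_def] at hup
  rw [Commute, SemiconjBy]
  simp only [add_mul, mul_add, smul_mul_smul_comm, (hee i j).eq]
  linear_combination (norm := module) (p * q) • hup + (p * p) • hterms

theorem gaudin_mul_self [IsAddTorsionFree A] {c : ι → ι → R}
    (ht : ∀ i, t i i = 0) (hs : ∀ i j, t j i = -t i j)
    (htt : ∀ i j, t i j * t i j = (2 * c i j) • t i j)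
    (httt : ∀ i j k, i ≠ j → i ≠ k → j ≠ k → t i j * t i k + t i k * t i j =
      c i j • (t i k - t j k) + c i k • (t i j - t k j))
    (hee : ∀ i, e i * e i = e i)
    (het : ∀ i j, e i * t i j + t i j * e i = t i j + c i j • (e i - e j)) (p q : R) (i : ι) :
    (q • e i + p • ∑ k, t i k) * (q • e i + p • ∑ k, t i k) =
      q • (q • e i + p • ∑ k, t i k) +
        p • ∑ j, c i j • ((q • e i + p • ∑ k, t i k) - (q • e j + p • ∑ k, t j k)) := by
  let g : ι → ι → A := fun j k => t i j * t i k - c i j • t i k + c i j • t j k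
    - (if k = j then c i j • t i j else 0) + (if k = i then c i j • t i j else 0)
  have hg : ∀ j k, g j k = -g k j := by
    intro j k
    rw [← add_eq_zero_iff_eq_neg]
    simp only [g]
    rcases eq_or_ne j i with rfl | hji
    · rcases eq_or_ne k j with rfl | hkj
      · simp [ht]
      · simp [ht, hkj, hkj.symm, hs j k]
    rcases eq_or_ne k i with rfl | hki
    · simp [ht, hji, hji.symm, hs k j]
    rcases eq_or_ne k j with rfl | hkj
    · simp only [htt, ht, hki, if_true, if_false]
      module
    · simp only [hkj, hkj.symm, hki, hji, if_false]
      rw [← sub_eq_zero.2 (httt i j k hji.symm hki.symm hkj.symm)]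
      module
  have hg0 : ∑ j, ∑ k, g j k = 0 := by
    have : ∑ j, ∑ k, g j k = -∑ j, ∑ k, g j k := by
      conv_lhs => rw [Finset.sum_comm]
      simp only [← Finset.sum_neg_distrib]
      exact Finset.sum_congr rfl fun k _ => Finset.sum_congr rfl fun j _ => hg j k
    rwa [self_eq_neg] at this
  simp only [g, Finset.sum_add_distrib, Finset.sum_sub_distrib] at hg0
  simp only [Finset.sum_ite_eq', Finset.mem_univ, if_true, ← Finset.smul_sum, ← Finset.sum_mul_sum]
    at hg0
  have het' : e i * (∑ k, t i k) + (∑ k, t i k) * e i =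
      ∑ k, t i k + ∑ k, c i k • (e i - e k) := by
    simp only [Finset.mul_sum, Finset.sum_mul, ← Finset.sum_add_distrib, het]
  have hexp : ∀ T : ι → A, ∑ j, c i j • ((q • e i + p • T i) - (q • e j + p • T j)) =
      q • ∑ k, c i k • (e i - e k) + p • (∑ j, c i j • T i - ∑ j, c i j • T j) := by
    intro T
    rw [Finset.smul_sum, ← Finset.sum_sub_distrib, Finset.smul_sum, ← Finset.sum_add_distrib]
    exact Finset.sum_congr rfl fun k _ => by module
  rw [hexp fun j => ∑ k, t j k]
  simp only [add_mul, mul_add, smul_mul_smul_comm, hee]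
  linear_combination (norm := module) (p * q) • het' + (p * p) • hg0

end GaudinAlgebra

section Gaudin

variable {ι R : Type*} [CommRing R]

/-- The operator on functions of spin configurations exchanging the spins at sites `i` and `j`. -/
def spinSwap [DecidableEq ι] (i j : ι) : Module.End R ((ι → Bool) → R) :=
  LinearMap.funLeft R R fun s => s ∘ Equiv.swap i j

/-- The projection onto configurations whose spin at site `i` is up. -/
def spinUp (i : ι) : Module.End R ((ι → Bool) → R) where
  toFun f s := if s i then f s else 0
  map_add' f g := by ext s; by_cases h : s i <;> simp [h]
  map_smul' a f := by ext s; by_cases h : s i <;> simp [h]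

/-- The two-site term of the Gaudin Hamiltonian with coupling constants `c`. -/
def gaudinTerm [DecidableEq ι] (c : ι → ι → R) (i j : ι) : Module.End R ((ι → Bool) → R) :=
  c i j • (1 - spinSwap i j)

/-- The Gaudin Hamiltonian at site `i`, with interaction strength `p` and field strength `q`. -/
def gaudinHamiltonian [DecidableEq ι] [Fintype ι] (c : ι → ι → R) (p q : R) (i : ι) :
    Module.End R ((ι → Bool) → R) :=
  q • spinUp i + p • ∑ j, gaudinTerm c i j

variable {c : ι → ι → R}

@[simp]
theorem spinUp_apply (i : ι) (f : (ι → Bool) → R) (s : ι → Bool) :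
    spinUp i f s = if s i then f s else 0 := rfl

theorem spinUp_mul_self (i : ι) :
    (spinUp i * spinUp i : Module.End R ((ι → Bool) → R)) = spinUp i := by
  refine LinearMap.ext fun f => funext fun s => ?_
  by_cases h : s i <;> simp [h]

theorem spinUp_commute (i j : ι) :
    Commute (spinUp i : Module.End R ((ι → Bool) → R)) (spinUp j) := by
  refine LinearMap.ext fun f => funext fun s => ?_
  by_cases h : s i <;> by_cases h' : s j <;> simp [h, h']

variable [DecidableEq ι]

@[simp]
theorem spinSwap_apply (i j : ι) (f : (ι → Bool) → R) (s : ι → Bool) :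
    spinSwap i j f s = f (s ∘ Equiv.swap i j) := rfl

theorem spinSwap_comm (i j : ι) : (spinSwap i j : Module.End R _) = spinSwap j i := by
  ext; simp [Equiv.swap_comm]

theorem spinSwap_self (i : ι) : (spinSwap i i : Module.End R ((ι → Bool) → R)) = 1 := by
  refine LinearMap.ext fun f => funext fun s => ?_
  simp

theorem spinSwap_mul_self (i j : ι) :
    (spinSwap i j * spinSwap i j : Module.End R ((ι → Bool) → R)) = 1 := by
  refine LinearMap.ext fun f => funext fun s => ?_
  simp [Function.comp_assoc, ← Equiv.coe_trans]

theorem spinSwap_mul_spinSwap {i j k : ι} (hij : i ≠ j) (hik : i ≠ k) (hjk : j ≠ k) :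
    (spinSwap i j * spinSwap j k : Module.End R ((ι → Bool) → R)) =
      spinSwap i k * spinSwap i j := by
  refine LinearMap.ext fun f => funext fun s => ?_
  simp only [Module.End.mul_apply, spinSwap_apply]
  congr 1
  ext x
  simp only [Function.comp_apply]
  congr 1
  simp only [Equiv.swap_apply_def]
  grind

theorem spinSwap_commute {i j k l : ι} (hik : i ≠ k) (hil : i ≠ l) (hjk : j ≠ k) (hjl : j ≠ l) :
    Commute (spinSwap i j : Module.End R ((ι → Bool) → R)) (spinSwap k l) := by
  refine LinearMap.ext fun f => funext fun s => ?_
  simp only [Module.End.mul_apply, spinSwap_apply]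
  congr 1
  ext x
  simp only [Function.comp_apply]
  congr 1
  simp only [Equiv.swap_apply_def]
  grind

theorem comp_swap_eq_self {i j : ι} {s : ι → Bool} (h : s i = s j) : s ∘ Equiv.swap i j = s := by
  ext x
  simp only [Function.comp_apply, Equiv.swap_apply_def]
  grind

/-- There are only two spin states, so antisymmetrising over three sites gives zero. -/
theorem spinSwap_antisymmetrizer (i j k : ι) (hij : i ≠ j) (hik : i ≠ k) (hjk : j ≠ k) :
    (1 - spinSwap i j - spinSwap i k - spinSwap j k + spinSwap i j * spinSwap i k
      + spinSwap i k * spinSwap i j : Module.End R ((ι → Bool) → R)) = 0 := by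
  refine LinearMap.ext fun f => funext fun s => ?_
  simp only [LinearMap.add_apply, LinearMap.sub_apply, Module.End.mul_apply, spinSwap_apply,
    Module.End.one_apply, Pi.add_apply, Pi.sub_apply, LinearMap.zero_apply, Pi.zero_apply]
  have h3 : s i = s j ∨ s i = s k ∨ s j = s k := by
    cases s i <;> cases s j <;> cases s k <;> simp
  rcases h3 with h | h | h
  · have e : (s ∘ Equiv.swap i k) ∘ Equiv.swap i j = s ∘ Equiv.swap j k := by
      ext x
      simp only [Function.comp_apply, Equiv.swap_apply_def]
      grind
    rw [e, comp_swap_eq_self h]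
    ring
  · have e : (s ∘ Equiv.swap i j) ∘ Equiv.swap i k = s ∘ Equiv.swap j k := by
      ext x
      simp only [Function.comp_apply, Equiv.swap_apply_def]
      grind
    rw [e, comp_swap_eq_self h]
    ring
  · have e : (s ∘ Equiv.swap i j) ∘ Equiv.swap i k = s ∘ Equiv.swap i j := by
      ext x
      simp only [Function.comp_apply, Equiv.swap_apply_def]
      grind
    have e' : (s ∘ Equiv.swap i k) ∘ Equiv.swap i j = s ∘ Equiv.swap i k := by
      ext x
      simp only [Function.comp_apply, Equiv.swap_apply_def]
      grind
    rw [e, e', comp_swap_eq_self h]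
    ring

theorem spinSwap_mul_spinUp (i j : ι) :
    (spinSwap i j * spinUp i : Module.End R ((ι → Bool) → R)) = spinUp j * spinSwap i j := by
  refine LinearMap.ext fun f => funext fun s => ?_
  simp

theorem spinSwap_commute_spinUp {i j k : ι} (hki : k ≠ i) (hkj : k ≠ j) :
    Commute (spinSwap i j : Module.End R ((ι → Bool) → R)) (spinUp k) := by
  refine LinearMap.ext fun f => funext fun s => ?_
  simp [Equiv.swap_apply_of_ne_of_ne hki hkj]

theorem spinUp_add_sub_one_mul (i j : ι) :
    ((spinUp i + spinUp j - 1) * (1 - spinSwap i j) : Module.End R ((ι → Bool) → R)) = 0 := by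
  refine LinearMap.ext fun f => funext fun s => ?_
  by_cases h : s i = s j
  · simp [comp_swap_eq_self h]
  · cases hi : s i <;> cases hj : s j <;> simp_all

theorem gaudinTerm_self (c : ι → ι → R) (i : ι) : gaudinTerm c i i = 0 := by
  simp [gaudinTerm, spinSwap_self]

theorem gaudinTerm_symm (hc : ∀ i j, c j i = -c i j) (i j : ι) :
    gaudinTerm c j i = -gaudinTerm c i j := by
  rw [gaudinTerm, gaudinTerm, spinSwap_comm j i, hc i j]
  module

theorem gaudinTerm_commute {i j k l : ι} (hik : i ≠ k) (hil : i ≠ l) (hjk : j ≠ k) (hjl : j ≠ l) :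
    Commute (gaudinTerm c i j) (gaudinTerm c k l) :=
  ((((Commute.one_left _).sub_left ((Commute.one_right _).sub_right
    (spinSwap_commute hik hil hjk hjl)))).smul_left _).smul_right _

/-- The infinitesimal braid relation, in the form of the classical Yang-Baxter equation. -/
theorem gaudinTerm_yangBaxter (hc : ∀ i j, c j i = -c i j)
    (hA : ∀ i j k, i ≠ j → i ≠ k → j ≠ k → c i j * c j k + c j k * c k i + c k i * c i j = 0)
    {i j k : ι} (hij : i ≠ j) (hik : i ≠ k) (hjk : j ≠ k) :
    ⁅gaudinTerm c i j, gaudinTerm c j k⁆ + ⁅gaudinTerm c i k, gaudinTerm c j i⁆ +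
      ⁅gaudinTerm c i k, gaudinTerm c j k⁆ = 0 := by
  have h1 := spinSwap_mul_spinSwap (R := R) hij hik hjk
  have h2 := spinSwap_mul_spinSwap (R := R) hjk hij.symm hik.symm
  have h3 := spinSwap_mul_spinSwap (R := R) hjk.symm hik.symm hij.symm
  have h4 := spinSwap_mul_spinSwap (R := R) hij.symm hjk hik
  rw [spinSwap_comm k i, spinSwap_comm j i] at h2
  rw [spinSwap_comm k j, spinSwap_comm j i, spinSwap_comm k i] at h3
  rw [spinSwap_comm j i] at h4
  have hb : ∀ (a b : R) (X Y : Module.End R ((ι → Bool) → R)),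
      ⁅a • (1 - X), b • (1 - Y)⁆ = (a * b) • (X * Y - Y * X) := by
    intro a b X Y
    rw [Ring.lie_def, smul_mul_smul_comm, smul_mul_smul_comm, mul_comm b a]
    simp only [mul_sub, sub_mul, mul_one, one_mul]
    module
  have hs : c i j * c j k + c i k * c j i = c i k * c j k := by
    have := hA i j k hij hik hjk
    rw [hc i k] at this
    rw [hc i j]
    linear_combination this
  simp only [gaudinTerm, hb]
  rw [spinSwap_comm j i, ← hs, ← h1, h4, h2, ← h3]
  module

theorem gaudinTerm_mul_add_mul (hc : ∀ i j, c j i = -c i j)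
    (hA : ∀ i j k, i ≠ j → i ≠ k → j ≠ k → c i j * c j k + c j k * c k i + c k i * c i j = 0)
    {i j k : ι} (hij : i ≠ j) (hik : i ≠ k) (hjk : j ≠ k) :
    gaudinTerm c i j * gaudinTerm c i k + gaudinTerm c i k * gaudinTerm c i j =
      c i j • (gaudinTerm c i k - gaudinTerm c j k) +
        c i k • (gaudinTerm c i j - gaudinTerm c k j) := by
  have hs : c j k * (c i j - c i k) = c i j * c i k := by
    have := hA i j k hij hik hjk
    rw [hc i k] at this
    linear_combination this
  have h := congrArg ((c i j * c i k) • ·) (spinSwap_antisymmetrizer (R := R) i j k hij hik hjk)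
  simp only [smul_zero] at h
  rw [gaudinTerm_symm hc j k]
  simp only [gaudinTerm]
  rw [smul_mul_smul_comm, smul_mul_smul_comm, mul_comm (c i k) (c i j), ← sub_eq_zero, ← h]
  have hs' : ∀ X : Module.End R ((ι → Bool) → R), c i j • c j k • X - c i k • c j k • X =
      (c i j * c i k) • X := by
    intro X
    rw [← hs]
    module
  have := hs' (1 - spinSwap j k)
  rw [← sub_eq_zero] at this ⊢
  rw [← this]
  simp only [mul_sub, sub_mul, mul_one, one_mul]
  module

theorem gaudinTerm_mul_self (i j : ι) :
    gaudinTerm c i j * gaudinTerm c i j = (2 * c i j) • gaudinTerm c i j := by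
  simp only [gaudinTerm]
  rw [smul_mul_smul_comm, mul_sub, sub_mul, sub_mul, spinSwap_mul_self]
  simp only [mul_one, one_mul]
  module

theorem spinUp_mul_gaudinTerm_add (i j : ι) :
    spinUp i * gaudinTerm c i j + gaudinTerm c i j * spinUp i =
      gaudinTerm c i j + c i j • (spinUp i - spinUp j) := by
  have h := spinUp_add_sub_one_mul (R := R) i j
  have h' := spinSwap_mul_spinUp (R := R) i j
  simp only [gaudinTerm]
  rw [mul_smul_comm, smul_mul_assoc, ← smul_add, ← smul_add]
  congr 1
  rw [← sub_eq_zero, ← h, sub_mul 1, h']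
  simp only [mul_sub, sub_mul, add_mul, mul_one, one_mul]
  abel

theorem gaudinTerm_commute_spinUp {i j k : ι} (hki : k ≠ i) (hkj : k ≠ j) :
    Commute (gaudinTerm c i j) (spinUp k) :=
  ((Commute.one_left _).sub_left (spinSwap_commute_spinUp hki hkj)).smul_left _

theorem gaudinTerm_commute_spinUp_add (i j : ι) :
    Commute (gaudinTerm c i j) (spinUp i + spinUp j) := by
  refine ((Commute.one_left _).sub_left ?_).smul_left _
  have h := spinSwap_mul_spinUp (R := R) i j
  have h' := spinSwap_mul_spinUp (R := R) j i
  rw [spinSwap_comm j i] at h'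
  rw [Commute, SemiconjBy, mul_add, add_mul, h, h', add_comm]

variable [Fintype ι]

theorem gaudinHamiltonian_commute (hc : ∀ i j, c j i = -c i j)
    (hA : ∀ i j k, i ≠ j → i ≠ k → j ≠ k → c i j * c j k + c j k * c k i + c k i * c i j = 0)
    (p q : R) (i j : ι) : Commute (gaudinHamiltonian c p q i) (gaudinHamiltonian c p q j) :=
  commute_gaudin (gaudinTerm_self c) (gaudinTerm_symm hc)
    (fun _ _ _ _ => gaudinTerm_commute) (fun _ _ _ => gaudinTerm_yangBaxter hc hA) spinUp_commute
    (fun _ _ _ => gaudinTerm_commute_spinUp) gaudinTerm_commute_spinUp_add p q i j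

theorem gaudinHamiltonian_mul_self [IsAddTorsionFree R] (hc : ∀ i j, c j i = -c i j)
    (hA : ∀ i j k, i ≠ j → i ≠ k → j ≠ k → c i j * c j k + c j k * c k i + c k i * c i j = 0)
    (p q : R) (i : ι) : gaudinHamiltonian c p q i * gaudinHamiltonian c p q i =
      q • gaudinHamiltonian c p q i +
        p • ∑ j, c i j • (gaudinHamiltonian c p q i - gaudinHamiltonian c p q j) := by
  have : IsAddTorsionFree (Module.End R ((ι → Bool) → R)) := by
    refine ⟨fun n hn f g h => LinearMap.ext fun u => funext fun s => ?_⟩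
    have := congrFun (LinearMap.congr_fun h u) s
    exact nsmul_right_injective hn this
  exact gaudin_mul_self (gaudinTerm_self c) (gaudinTerm_symm hc) gaudinTerm_mul_self
    (fun _ _ _ => gaudinTerm_mul_add_mul hc hA) spinUp_mul_self spinUp_mul_gaudinTerm_add p q i

end Gaudin

open Polynomial in
theorem aeval_mem_span_prod {ι R A : Type*} [Fintype ι] [DecidableEq ι] [CommRing R] [CommRing A]
    [Algebra R A] {x : ι → A} {a : R} {b : ι → ι → R}
    (hx : ∀ i, x i * x i = a • x i + ∑ j, b i j • (x i - x j)) (i : ι) (f : R[X]) :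
    aeval (x i) f ∈ Submodule.span R (Set.range fun S : Finset ι => ∏ k ∈ S, x k) := by
  set T := Submodule.span R (Set.range fun S : Finset ι => ∏ k ∈ S, x k)
  have hmem : ∀ S : Finset ι, ∏ k ∈ S, x k ∈ T := fun S => Submodule.subset_span ⟨S, rfl⟩
  have hmul : ∀ n, ∀ S : Finset ι, S.card = n → ∀ i, x i * ∏ k ∈ S, x k ∈ T := by
    intro n
    induction n with
    | zero =>
      intro S hS i
      rw [Finset.card_eq_zero.1 hS]
      simpa using hmem {i}
    | succ n ih =>
      intro S hS i
      by_cases hi : i ∈ S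
      · have hn : (S.erase i).card = n := by rw [Finset.card_erase_of_mem hi, hS]; rfl
        rw [← Finset.mul_prod_erase S x hi, ← mul_assoc, hx, add_mul, smul_mul_assoc,
          Finset.sum_mul]
        refine add_mem (T.smul_mem _ (ih _ hn i)) (sum_mem fun j _ => ?_)
        rw [smul_mul_assoc, sub_mul]
        exact T.smul_mem _ (sub_mem (ih _ hn i) (ih _ hn j))
      · rw [← Finset.prod_insert hi]
        exact hmem _
  have hmulT : ∀ y ∈ T, x i * y ∈ T := by
    intro y hy
    have : T ≤ T.comap (LinearMap.mulLeft R (x i)) := by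
      rw [Submodule.span_le]
      rintro _ ⟨S, rfl⟩
      exact hmul _ S rfl i
    exact this hy
  have hpow : ∀ n : ℕ, x i ^ n ∈ T := by
    intro n
    induction n with
    | zero => simpa using hmem ∅
    | succ n ih => rw [pow_succ']; exact hmulT _ ih
  rw [aeval_eq_sum_range]
  exact sum_mem fun n _ => T.smul_mem _ (hpow n)

open Polynomial in
/-- If squarefree monomials in `x` are linearly independent, then any other solution `y` of the
same quadratic system is a specialisation of `x`. -/
theorem aeval_eq_zero_of_linearIndependent_prod {ι R B K : Type*} [Fintype ι] [DecidableEq ι]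
    [CommRing R] [CommRing B] [Algebra R B] [CommRing K] [Algebra R K] {x : ι → B} {y : ι → K}
    {a : R} {b : ι → ι → R}
    (hx : ∀ i, x i * x i = a • x i + ∑ j, b i j • (x i - x j))
    (hy : ∀ i, y i * y i = a • y i + ∑ j, b i j • (y i - y j))
    (hind : LinearIndependent R fun S : Finset ι => ∏ k ∈ S, x k) (i : ι) {f : R[X]}
    (hf : aeval (x i) f = 0) : aeval (y i) f = 0 := by
  have hxy : ∀ i, ((x i, y i) : B × K) * (x i, y i) =
      a • (x i, y i) + ∑ j, b i j • ((x i, y i) - (x j, y j)) := by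
    intro i
    ext
    · simpa [Prod.fst_sum] using hx i
    · simpa [Prod.snd_sum] using hy i
  have hmem := aeval_mem_span_prod hxy i f
  rw [Submodule.mem_span_range_iff_exists_fun] at hmem
  obtain ⟨d, hd⟩ := hmem
  have h1 := congrArg (AlgHom.fst R B K) hd
  have h2 := congrArg (AlgHom.snd R B K) hd
  rw [← aeval_algHom_apply] at h1 h2
  simp only [map_sum, map_smul, map_prod, AlgHom.fst_apply, AlgHom.snd_apply] at h1 h2
  rw [hf] at h1
  have hd0 := Fintype.linearIndependent_iff.1 hind d h1
  simpa [hd0] using h2.symm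

section

variable {ι : Type*} [Fintype ι] [DecidableEq ι]

theorem det_subset_ne_zero {K : Type*} [Field K] :
    (Matrix.of fun S T : Finset ι => if S ⊆ T then (1 : K) else 0).det ≠ 0 := by
  rw [Ne, ← Matrix.exists_vecMul_eq_zero_iff]
  rintro ⟨a, ha, h⟩
  refine ha (funext fun T => ?_)
  induction T using Finset.strongInduction with
  | H T ih =>
    have hT := congrFun h T
    simp only [Matrix.vecMul, dotProduct, Matrix.of_apply, mul_ite, mul_one, mul_zero,
      Pi.zero_apply] at hT
    rw [Fintype.sum_eq_single T] at hT
    · simpa using hT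
    · intro S hS
      split_ifs with hST
      · exact ih S (Finset.ssubset_iff_subset_ne.2 ⟨hST, hS⟩)
      · rfl

variable {R : Type*} [CommRing R] {c : ι → ι → R}

theorem map_gaudinHamiltonian_apply {K : Type*} [CommRing K] (φ : R →+* K) {p q : R}
    (hp : φ p = 0) (hq : φ q = 1) (i : ι) (f : (ι → Bool) → R) (s : ι → Bool) :
    φ (gaudinHamiltonian c p q i f s) = if s i then φ (f s) else 0 := by
  simp [gaudinHamiltonian, hp, hq, apply_ite φ]

theorem linearIndependent_prod_gaudinHamiltonian [IsDomain R] {K : Type*} [Field K] (φ : R →+* K)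
    {p q : R} (hp : φ p = 0) (hq : φ q = 1) {B : Type*} [CommRing B] [Algebra R B]
    (ψ : B →ₐ[R] Module.End R ((ι → Bool) → R)) {x : ι → B}
    (hx : ∀ i, ψ (x i) = gaudinHamiltonian c p q i) :
    LinearIndependent R fun S : Finset ι => ∏ k ∈ S, x k := by
  let w : Finset ι → (ι → Bool) → R := fun S => ψ (∏ k ∈ S, x k) 1
  have hw : ∀ (S : Finset ι) (s : ι → Bool), φ (w S s) = if ∀ k ∈ S, s k then 1 else 0 := by
    intro S s
    induction S using Finset.induction_on with
    | empty => simp [w]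
    | insert i S hi ih =>
      simp only [w] at ih ⊢
      rw [Finset.prod_insert hi, map_mul, hx, Module.End.mul_apply,
        map_gaudinHamiltonian_apply φ hp hq, ih]
      simp [ite_and]
  let M : Matrix (Finset ι) (Finset ι) R := Matrix.of fun S T => w S fun k => decide (k ∈ T)
  have hM : M.det ≠ 0 := by
    intro h
    refine det_subset_ne_zero (ι := ι) (K := K) ?_
    have hφ := congrArg φ h
    rw [RingHom.map_det, map_zero] at hφ
    refine Eq.trans ?_ hφ
    congr 1
    ext S T
    simp [M, hw, Finset.subset_iff]
  rw [Fintype.linearIndependent_iff]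
  intro d hd
  refine congrFun (Matrix.eq_zero_of_vecMul_eq_zero hM (funext fun T => ?_))
  have h := congrFun (LinearMap.congr_fun (congrArg ψ hd) 1) fun k => decide (k ∈ T)
  simpa [Matrix.vecMul, dotProduct, M, w] using h

open Polynomial in
/-- The Gaudin Hamiltonians are real symmetric, so solutions of their quadratic relations are
real. -/
theorem conj_eq_of_gaudin_system {z : ι → ℝ} (hz : Function.Injective z) {y : ι → ℂ}
    (hy : ∀ i, y i * y i = ∑ j, ((z i - z j : ℝ) : ℂ)⁻¹ * (y i - y j)) (i : ι) :
    (starRingEnd ℂ) (y i) = y i := by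
  let c : ι → ι → ℂ[X] := fun i j => C (((z i - z j : ℝ) : ℂ)⁻¹)
  have hc : ∀ i j, c j i = -c i j := by
    intro i j
    simp only [c, ← C_neg, ← inv_neg, ← Complex.ofReal_neg, neg_sub]
  have hA : ∀ i j k, i ≠ j → i ≠ k → j ≠ k →
      c i j * c j k + c j k * c k i + c k i * c i j = 0 := by
    intro i j k hij hik hjk
    have h1 : ((z i - z j : ℝ) : ℂ) ≠ 0 := by exact_mod_cast sub_ne_zero.2 (hz.ne hij)
    have h2 : ((z j - z k : ℝ) : ℂ) ≠ 0 := by exact_mod_cast sub_ne_zero.2 (hz.ne hjk)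
    have h3 : ((z k - z i : ℝ) : ℂ) ≠ 0 := by exact_mod_cast sub_ne_zero.2 (hz.ne hik.symm)
    simp only [c, ← C_mul, ← C_add, C_eq_zero]
    field_simp
    push_cast
    ring
  let p : ℂ[X] := X
  let q : ℂ[X] := 1 - X
  let h := gaudinHamiltonian c p q
  let _ : Algebra ℂ[X] ℂ := (evalRingHom (1 : ℂ)).toAlgebra
  have hsmul : ∀ (r : ℂ[X]) (w : ℂ), r • w = r.eval 1 * w := fun r w => rfl
  let B := Algebra.adjoin ℂ[X] (Set.range h)
  have : IsMulCommutative B := Algebra.isMulCommutative_adjoin _ (by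
    rintro _ ⟨i, rfl⟩ _ ⟨j, rfl⟩
    exact gaudinHamiltonian_commute hc hA p q i j)
  open scoped IsMulCommutative in
  let _ : CommRing B := inferInstance
  let x : ι → B := fun i => ⟨h i, Algebra.subset_adjoin ⟨i, rfl⟩⟩
  have hind : LinearIndependent ℂ[X] fun S : Finset ι => ∏ k ∈ S, x k :=
    linearIndependent_prod_gaudinHamiltonian (evalRingHom (0 : ℂ)) (p := p) (q := q) (c := c)
      (by simp [p]) (by simp [q]) B.val fun i => rfl
  have hx : ∀ i, x i * x i = q • x i + ∑ j, (p * c i j) • (x i - x j) := by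
    intro i
    apply Subtype.ext
    have := gaudinHamiltonian_mul_self hc hA p q i
    rw [Finset.smul_sum] at this
    simp only [smul_smul] at this
    simpa [x] using this
  have hy' : ∀ i, y i * y i = q • y i + ∑ j, (p * c i j) • (y i - y j) := by
    intro i
    rw [hy]
    simp [hsmul, p, q, c]
  have hf : aeval (x i) (h i).charpoly = 0 := by
    apply Subtype.ext
    have := (h i).aeval_self_charpoly
    rw [show h i = B.val (x i) from rfl, aeval_algHom_apply] at this
    exact this
  have hroot := aeval_eq_zero_of_linearIndependent_prod hx hy' hind i hf
  let N : Matrix (ι → Bool) (ι → Bool) ℂ := (LinearMap.toMatrix' (h i)).map (evalRingHom 1)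
  have hNapp : ∀ s t, N s t = ∑ k, ((z i - z k : ℝ) : ℂ)⁻¹ *
      ((if s = t then 1 else 0) - if s ∘ Equiv.swap i k = t then 1 else 0) := by
    intro s t
    have : N s t = (h i (Pi.single t 1) s).eval 1 := by
      simp [N, LinearMap.toMatrix'_apply]
    rw [this]
    simp only [h, gaudinHamiltonian, gaudinTerm, LinearMap.add_apply, LinearMap.smul_apply,
      LinearMap.sum_apply, LinearMap.sub_apply, Pi.add_apply, Pi.smul_apply, Finset.sum_apply,
      Pi.sub_apply, spinSwap_apply, Module.End.one_apply, Pi.single_apply, smul_eq_mul, eval_add,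
      eval_mul, eval_finsetSum, p, q, c, eval_sub, eval_X, eval_one, eval_C, sub_self, zero_mul,
      zero_add, one_mul, apply_ite (eval (1 : ℂ)), eval_zero]
  have hN : N.IsHermitian := by
    ext s t
    have hst : ∀ k, s ∘ Equiv.swap i k = t ↔ t ∘ Equiv.swap i k = s := by
      intro k
      constructor <;> rintro rfl <;> ext <;> simp
    rw [Matrix.conjTranspose_apply, hNapp, hNapp, star_sum]
    refine Finset.sum_congr rfl fun k _ => ?_
    simp only [hst k, eq_comm (a := t) (b := s), star_mul', star_sub, RCLike.star_def, map_inv₀,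
      Complex.conj_ofReal, apply_ite (starRingEnd ℂ), map_one, map_zero]
  have hNroot : N.charpoly.eval (y i) = 0 := by
    rw [← hroot, ← LinearMap.charpoly_toMatrix (h i) (Pi.basisFun ℂ[X] (ι → Bool)),
      aeval_def, ← eval_map, LinearMap.toMatrix_eq_toMatrix', ← Matrix.charpoly_map]
    rfl
  rw [hN.charpoly_eq, eval_prod, Finset.prod_eq_zero_iff] at hNroot
  obtain ⟨s, -, hs⟩ := hNroot
  rw [eval_sub, eval_X, eval_C, sub_eq_zero] at hs
  rw [hs]
  exact Complex.conj_ofReal _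

end

section Wronskian

open Polynomial

variable {K : Type*} [Field K]

theorem exists_eq_C_mul_of_wronskian_eq_zero [CharZero K] {f g : K[X]} (hg : g ≠ 0)
    (h : wronskian g f = 0) : ∃ s : K, f = C s * g := by
  classical
  obtain ⟨g', hg'⟩ := EuclideanDomain.gcd_dvd_left g f
  obtain ⟨f', hf'⟩ := EuclideanDomain.gcd_dvd_right g f
  set r := EuclideanDomain.gcd g f
  have hr : r ≠ 0 := by
    rintro hr
    rw [hr, zero_mul] at hg'
    exact hg hg'
  have hcop : IsCoprime g' f' := by
    have h1 := EuclideanDomain.gcd_eq_gcd_ab g f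
    refine ⟨EuclideanDomain.gcdA g f, EuclideanDomain.gcdB g f, mul_left_cancel₀ hr ?_⟩
    linear_combination -h1 - EuclideanDomain.gcdA g f * hg' - EuclideanDomain.gcdB g f * hf'
  have hw : wronskian g' f' = 0 := by
    have : r ^ 2 * wronskian g' f' = 0 := by
      rw [← h, hg', hf']
      simp only [wronskian, derivative_mul]
      ring
    exact (mul_eq_zero.1 this).resolve_left (pow_ne_zero 2 hr)
  obtain ⟨h1, h2⟩ := hcop.wronskian_eq_zero_iff.1 hw
  have hgC := eq_C_of_derivative_eq_zero h1
  have hfC := eq_C_of_derivative_eq_zero h2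
  have hg0 : g'.coeff 0 ≠ 0 := by
    intro h0
    rw [hgC, h0, C_0, mul_zero] at hg'
    exact hg hg'
  refine ⟨f'.coeff 0 / g'.coeff 0, ?_⟩
  rw [hf', hg', hfC, hgC, mul_left_comm, ← C_mul, coeff_C_zero, coeff_C_zero,
    div_mul_cancel₀ _ hg0]

theorem natDegree_wronskian_le {d : ℕ} (hd : 1 ≤ d) {f g : K[X]} (hf : f.natDegree ≤ d)
    (hg : g.natDegree ≤ d) : (wronskian f g).natDegree ≤ 2 * d - 2 := by
  obtain ⟨e, rfl⟩ : ∃ e, d = e + 1 := ⟨d - 1, by omega⟩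
  have hf' : (derivative f).natDegree ≤ e := (natDegree_derivative_le f).trans (by omega)
  have hg' : (derivative g).natDegree ≤ e := (natDegree_derivative_le g).trans (by omega)
  have hle : (wronskian f g).natDegree ≤ e + 1 + e :=
    (natDegree_sub_le_of_le (natDegree_mul_le_of_le hf hg')
      (natDegree_mul_le_of_le hf' hg)).trans (by omega)
  have hcoeff : (wronskian f g).coeff (e + 1 + e) = 0 := by
    rw [wronskian, coeff_sub, coeff_mul_add_eq_of_natDegree_le hf hg', add_comm (e + 1) e,
      coeff_mul_add_eq_of_natDegree_le hf' hg, coeff_derivative, coeff_derivative]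
    ring
  have := natDegree_le_pred hle hcoeff
  omega

theorem eq_C_mul_nodal {ι : Type*} [Fintype ι] {v : ι → K} (hv : Function.Injective v) {P : K[X]}
    (hP : P.natDegree ≤ Fintype.card ι) (h0 : ∀ i, P.eval (v i) = 0) :
    P = C (P.coeff (Fintype.card ι)) * Lagrange.nodal Finset.univ v := by
  refine eq_of_degree_sub_lt_of_eval_index_eq Finset.univ (v := v) hv.injOn ?_ ?_
  · rw [Finset.card_univ, degree_lt_iff_coeff_zero]
    intro m hm
    rw [coeff_sub, coeff_C_mul]
    rcases hm.eq_or_lt with rfl | hm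
    · have := (Lagrange.nodal_monic (s := Finset.univ) (v := v)).coeff_natDegree
      rw [Lagrange.natDegree_nodal, Finset.card_univ] at this
      rw [this, mul_one, sub_self]
    · have hN : (Lagrange.nodal Finset.univ v).natDegree < m := by
        rwa [Lagrange.natDegree_nodal, Finset.card_univ]
      rw [coeff_eq_zero_of_natDegree_lt (hP.trans_lt hm), coeff_eq_zero_of_natDegree_lt hN,
        mul_zero, sub_zero]
  · intro i _
    rw [h0, eval_mul, Lagrange.eval_nodal_at_node (Finset.mem_univ i), mul_zero]

/-- The logarithmic derivatives, at the zeros of the Wronskian, of a two-dimensional space of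
polynomials satisfy the quadratic relations of the Gaudin Hamiltonians. -/
theorem gaudin_system_of_wronskian {d : ℕ} (hd : 2 ≤ d) {ι : Type*} [Fintype ι] [DecidableEq ι]
    (hι : Fintype.card ι = 2 * d - 2) {v : ι → K} (hv : Function.Injective v) {f g : K[X]}
    (hf : f.natDegree ≤ d) (hg : g.natDegree ≤ d) {c : K} (hc : c ≠ 0)
    (hW : wronskian f g = C c * Lagrange.nodal Finset.univ v) {l : ι → K}
    (hlf : ∀ i, f.derivative.eval (v i) = l i * f.eval (v i))
    (hlg : ∀ i, g.derivative.eval (v i) = l i * g.eval (v i)) (i : ι) :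
    l i * l i = ∑ j, (v i - v j)⁻¹ * (l i - l j) := by
  set N := Lagrange.nodal Finset.univ v
  let w : ι → K[X] := fun k => C c * Lagrange.nodal (Finset.univ.erase k) v
  have hNk : ∀ k, wronskian f g = (X - C (v k)) * w k := by
    intro k
    rw [hW, show N = _ from Lagrange.nodal_eq_mul_nodal_erase (Finset.mem_univ k)]
    ring
  have hNd : derivative (wronskian f g) = ∑ k, w k := by
    rw [hW, derivative_C_mul, show derivative N = _ from Lagrange.derivative_nodal,
      Finset.mul_sum]
  have hwne : ∀ j k, k ≠ j → (w k).eval (v j) = 0 := by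
    intro j k hkj
    rw [eval_mul, Lagrange.eval_nodal_at_node (by simp [hkj.symm]), mul_zero]
  have hw0 : ∀ j, (w j).eval (v j) ≠ 0 := by
    intro j
    rw [eval_mul, eval_C]
    refine mul_ne_zero hc (Lagrange.eval_nodal_not_at_node fun k hk => ?_)
    exact hv.ne (Finset.ne_of_mem_erase hk).symm
  have hwdeg : ∀ k m, Fintype.card ι ≤ m → (w k).coeff m = 0 := by
    intro k m hm
    rw [coeff_C_mul, coeff_eq_zero_of_natDegree_lt, mul_zero]
    rw [Lagrange.natDegree_nodal]
    exact (Finset.card_erase_lt_of_mem (Finset.mem_univ k)).trans_le hm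
  clear_value w
  have hwD : ∀ j, (derivative (wronskian f g)).eval (v j) = (w j).eval (v j) := by
    intro j
    rw [hNd, eval_finsetSum, Fintype.sum_eq_single j (hwne j)]
  have hD0 : ∀ j, (derivative (wronskian f g)).eval (v j) ≠ 0 := by
    intro j
    rw [hwD]
    exact hw0 j
  have hwd : ∀ j k, k ≠ j → (derivative (w k)).eval (v j) =
      (derivative (wronskian f g)).eval (v j) * (v j - v k)⁻¹ := by
    intro j k hkj
    have hne : v j - v k ≠ 0 := sub_ne_zero.2 (hv.ne hkj.symm)
    rw [eq_mul_inv_iff_mul_eq₀ hne, hNk k, derivative_mul]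
    simp only [derivative_sub, derivative_X, derivative_C, eval_add, eval_mul, eval_sub, eval_one,
      eval_zero, eval_X, eval_C, hwne j k hkj]
    ring
  set Q := wronskian (derivative f) (derivative g)
  have hev : ∀ j, ∃ u : K[X], u.eval (v j) ≠ 0 ∧
      u.derivative.eval (v j) = l j * u.eval (v j) ∧
      wronskian f g * u.derivative.derivative - derivative (wronskian f g) * u.derivative
        + Q * u = 0 := by
    intro j
    by_cases h0 : f.eval (v j) = 0
    · refine ⟨g, fun h1 => hD0 j ?_, hlg j, ?_⟩
      · simp [wronskian, h0, h1, hlf, hlg]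
      · simp only [wronskian, Q, derivative_sub, derivative_mul]
        ring
    · refine ⟨f, h0, hlf j, ?_⟩
      simp only [wronskian, Q, derivative_sub, derivative_mul]
      ring
  have hW0 : ∀ j, (wronskian f g).eval (v j) = 0 := by
    intro j
    rw [hNk j]
    simp
  have hQ : ∀ j, Q.eval (v j) = l j * (derivative (wronskian f g)).eval (v j) := by
    intro j
    obtain ⟨u, hu0, hul, hu⟩ := hev j
    have := congrArg (eval (v j)) hu
    simp only [eval_add, eval_sub, eval_mul, hW0, hul, eval_zero] at this
    exact mul_right_cancel₀ hu0 (by linear_combination this)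
  have hQ' : ∀ j, l j ^ 2 * (derivative (wronskian f g)).eval (v j) =
      l j * (derivative (derivative (wronskian f g))).eval (v j) - (derivative Q).eval (v j) := by
    intro j
    obtain ⟨u, hu0, hul, hu⟩ := hev j
    have := congrArg (fun p => eval (v j) (derivative p)) hu
    simp only [derivative_add, derivative_sub, derivative_mul, derivative_zero, eval_add, eval_sub,
      eval_mul, hW0, hul, hQ, eval_zero] at this
    exact mul_right_cancel₀ hu0 (by linear_combination this)
  have hQsum : Q = ∑ k, C (l k) * w k := by
    refine eq_of_degrees_lt_of_eval_index_eq Finset.univ (v := v) hv.injOn ?_ ?_ ?_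
    · have h1 : Q.natDegree ≤ 2 * (d - 1) - 2 := natDegree_wronskian_le (by omega)
        ((natDegree_derivative_le f).trans (by omega))
        ((natDegree_derivative_le g).trans (by omega))
      refine degree_le_natDegree.trans_lt ?_
      rw [Finset.card_univ, hι]
      exact_mod_cast (by omega : Q.natDegree < 2 * d - 2)
    · rw [degree_lt_iff_coeff_zero]
      intro m hm
      rw [finsetSum_coeff]
      refine Finset.sum_eq_zero fun k _ => ?_
      rw [coeff_C_mul, hwdeg k m hm, mul_zero]
    · intro j _
      rw [hQ, hwD, eval_finsetSum, Fintype.sum_eq_single j]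
      · rw [eval_mul, eval_C]
      · intro k hk
        rw [eval_mul, hwne j k hk, mul_zero]
  have h := hQ' i
  rw [hQsum] at h
  nth_rewrite 2 [hNd] at h
  rw [derivative_sum, derivative_sum, eval_finsetSum, eval_finsetSum, Finset.mul_sum,
    ← Finset.sum_sub_distrib] at h
  refine mul_right_cancel₀ (hD0 i) ?_
  rw [← sq, h, Finset.sum_mul]
  refine Finset.sum_congr rfl fun k _ => ?_
  rcases eq_or_ne k i with rfl | hki
  · simp
  · rw [derivative_C_mul, eval_mul, eval_C, hwd i k hki]
    ring

theorem exists_eq_add_of_wronskian [CharZero K] {d : ℕ} (hd : 1 ≤ d) {ι : Type*} [Fintype ι]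
    (hι : Fintype.card ι = 2 * d - 2) {v : ι → K} (hv : Function.Injective v) {f g u : K[X]}
    (hf : f.natDegree ≤ d) (hg : g.natDegree ≤ d) (hu : u.natDegree ≤ d) {c : K} (hc : c ≠ 0)
    (hW : wronskian f g = C c * Lagrange.nodal Finset.univ v) {l : ι → K}
    (hlf : ∀ i, f.derivative.eval (v i) = l i * f.eval (v i))
    (hlg : ∀ i, g.derivative.eval (v i) = l i * g.eval (v i))
    (hlu : ∀ i, u.derivative.eval (v i) = l i * u.eval (v i)) :
    ∃ a b : K, u = C a * f + C b * g := by
  obtain ⟨a, ha⟩ : ∃ a, wronskian u f = C a * Lagrange.nodal Finset.univ v :=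
    ⟨_, eq_C_mul_nodal hv (hι ▸ natDegree_wronskian_le hd hu hf) fun i => by
      simp [wronskian, hlu, hlf]; ring⟩
  obtain ⟨b, hb⟩ : ∃ b, wronskian u g = C b * Lagrange.nodal Finset.univ v :=
    ⟨_, eq_C_mul_nodal hv (hι ▸ natDegree_wronskian_le hd hu hg) fun i => by
      simp [wronskian, hlu, hlg]; ring⟩
  have hW0 : wronskian f g ≠ 0 := by
    rw [hW]
    exact mul_ne_zero (C_ne_zero.2 hc) Lagrange.nodal_ne_zero
  set r := C c * u - C b * f + C a * g with hr
  have h1 : wronskian r f = 0 := by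
    have : wronskian r f = C c * wronskian u f - C a * wronskian f g := by
      simp only [hr, wronskian, derivative_add, derivative_sub, derivative_C_mul]
      ring
    rw [this, ha, hW]
    ring
  have h2 : wronskian r g = 0 := by
    have : wronskian r g = C c * wronskian u g - C b * wronskian f g := by
      simp only [hr, wronskian, derivative_add, derivative_sub, derivative_C_mul]
      ring
    rw [this, hb, hW]
    ring
  have hr0 : r = 0 := by
    by_contra hne
    obtain ⟨s, hs⟩ := exists_eq_C_mul_of_wronskian_eq_zero hne h1
    obtain ⟨t, ht⟩ := exists_eq_C_mul_of_wronskian_eq_zero hne h2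
    refine hW0 ?_
    rw [hs, ht]
    simp only [wronskian, derivative_C_mul]
    ring
  refine ⟨b / c, -a / c, ?_⟩
  have hcc : C c * C c⁻¹ = (1 : K[X]) := by rw [← C_mul, mul_inv_cancel₀ hc, C_1]
  rw [div_eq_mul_inv, div_eq_mul_inv, C_mul, C_mul, C_neg]
  linear_combination C c⁻¹ * (hr.symm.trans hr0) - u * hcc

end Wronskian

section

open Polynomial

theorem exists_map_conj_eq_add {d : ℕ} (hd : 2 ≤ d) {ι : Type*} [Fintype ι]
    (hι : Fintype.card ι = 2 * d - 2) {z : ι → ℝ} (hz : Function.Injective z) {f g : ℂ[X]}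
    (hf : f.natDegree ≤ d) (hg : g.natDegree ≤ d) (hW : wronskian f g ≠ 0)
    (hmeet : ∀ i, ∃ α β : ℂ, (α ≠ 0 ∨ β ≠ 0) ∧
      α * f.eval (z i : ℂ) + β * f.derivative.eval (z i : ℂ) = 0 ∧
      α * g.eval (z i : ℂ) + β * g.derivative.eval (z i : ℂ) = 0) {u : ℂ[X]}
    (hu : u = f ∨ u = g) : ∃ a b : ℂ, u.map (starRingEnd ℂ) = C a * f + C b * g := by
  classical
  have hv : Function.Injective fun i => (z i : ℂ) := Complex.ofReal_injective.comp hz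
  have hev : ∀ i, (wronskian f g).eval (z i : ℂ) = 0 := by
    intro i
    obtain ⟨α, β, h0, h1, h2⟩ := hmeet i
    simp only [wronskian, eval_sub, eval_mul]
    rcases h0 with h0 | h0
    · refine mul_left_cancel₀ h0 ?_
      linear_combination g.derivative.eval (z i : ℂ) * h1 - f.derivative.eval (z i : ℂ) * h2
    · refine mul_left_cancel₀ h0 ?_
      linear_combination f.eval (z i : ℂ) * h2 - g.eval (z i : ℂ) * h1
  have hN := eq_C_mul_nodal hv (hι ▸ natDegree_wronskian_le (by omega) hf hg) hev
  set c := (wronskian f g).coeff (Fintype.card ι)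
  have hc : c ≠ 0 := by
    intro hc
    rw [hc, C_0, zero_mul] at hN
    exact hW hN
  have hD0 : ∀ i, (derivative (wronskian f g)).eval (z i : ℂ) ≠ 0 := by
    intro i
    rw [hN, derivative_C_mul, eval_mul, eval_C,
      Lagrange.eval_nodal_derivative_eval_node_eq (v := fun i => (z i : ℂ)) (Finset.mem_univ i)]
    refine mul_ne_zero hc (Lagrange.eval_nodal_not_at_node fun k hk => ?_)
    exact hv.ne (Finset.ne_of_mem_erase hk).symm
  have hl : ∀ i, ∃ l : ℂ, f.derivative.eval (z i : ℂ) = l * f.eval (z i : ℂ) ∧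
      g.derivative.eval (z i : ℂ) = l * g.eval (z i : ℂ) := by
    intro i
    obtain ⟨α, β, h0, h1, h2⟩ := hmeet i
    have hβ : β ≠ 0 := by
      rintro rfl
      have hα : α ≠ 0 := by simpa using h0
      refine hD0 i ?_
      have hf0 : f.eval (z i : ℂ) = 0 := by simpa [hα] using h1
      have hg0 : g.eval (z i : ℂ) = 0 := by simpa [hα] using h2
      simp only [wronskian, derivative_sub, derivative_mul, eval_sub, eval_add, eval_mul, hf0, hg0]
      ring
    refine ⟨-α / β, ?_, ?_⟩
    · field_simp
      linear_combination h1
    · field_simp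
      linear_combination h2
  choose l hlf hlg using hl
  have hreal := conj_eq_of_gaudin_system hz (y := l) fun i => by
    simpa using gaudin_system_of_wronskian hd hι hv hf hg hc hN hlf hlg i
  have hud : u.natDegree ≤ d := by rcases hu with rfl | rfl <;> assumption
  have hul : ∀ i, u.derivative.eval (z i : ℂ) = l i * u.eval (z i : ℂ) := by
    rcases hu with rfl | rfl <;> assumption
  have hconj : ∀ (p : ℂ[X]) (x : ℝ), (p.map (starRingEnd ℂ)).eval (x : ℂ) =
      starRingEnd ℂ (p.eval (x : ℂ)) := by
    intro p x
    rw [← eval₂_at_apply, Complex.conj_ofReal, eval_map]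
  refine exists_eq_add_of_wronskian (by omega) hι hv hf hg (natDegree_map_le.trans hud) hc hN
    hlf hlg fun i => ?_
  rw [derivative_map, hconj, hconj, hul, map_mul, hreal]

theorem eval_ofFn_eq_dotProduct {d : ℕ} (a : Fin (d + 1) → ℂ) (t : ℂ) :
    (ofFn (d + 1) a).eval t = a ⬝ᵥ rncE d t := by
  simp [ofFn_eq_sum_monomial, eval_finsetSum, eval_monomial, dotProduct, rncE]

theorem eval_derivative_ofFn_eq_dotProduct {d : ℕ} (a : Fin (d + 1) → ℂ) (t : ℂ) :
    (ofFn (d + 1) a).derivative.eval t = a ⬝ᵥ rncE' d t := by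
  simp [ofFn_eq_sum_monomial, eval_finsetSum, eval_monomial, dotProduct, rncE',
    derivative_monomial, mul_assoc]

theorem exists_mem_iff_dotProduct_eq_zero {K : Type*} [Field K] {n : ℕ}
    {H : Submodule K (Fin n → K)} (hH : Module.finrank K H + 2 = n) :
    ∃ a b : Fin n → K, LinearIndependent K ![a, b] ∧
      ∀ v, v ∈ H ↔ a ⬝ᵥ v = 0 ∧ b ⬝ᵥ v = 0 := by
  let e := (dotProductEquiv K (Fin n)).symm
  let A := H.dualAnnihilator.map e.toLinearMap
  have hfin : Module.finrank K A = 2 := by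
    have := Subspace.finrank_add_finrank_dualAnnihilator_eq H
    rw [Module.finrank_fin_fun] at this
    have h : Module.finrank K A = Module.finrank K H.dualAnnihilator :=
      LinearEquiv.finrank_map_eq e _
    omega
  have hmem : ∀ v, v ∈ H ↔ ∀ a ∈ A, a ⬝ᵥ v = 0 := by
    intro v
    have he : ∀ φ : Module.Dual K (Fin n → K), e φ ⬝ᵥ v = φ v := fun φ =>
      LinearMap.congr_fun ((dotProductEquiv K (Fin n)).apply_symm_apply φ) v
    constructor
    · rintro hv _ ⟨φ, hφ, rfl⟩
      exact (he φ).trans ((Submodule.mem_dualAnnihilator φ).1 hφ v hv)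
    · intro h
      rw [← Subspace.dualAnnihilator_dualCoannihilator_eq (W := H), Submodule.mem_dualCoannihilator]
      intro φ hφ
      rw [← he]
      exact h _ ⟨φ, hφ, rfl⟩
  let B := Module.finBasisOfFinrankEq K A hfin
  refine ⟨B 0, B 1, ?_, fun v => ?_⟩
  · have h1 := B.linearIndependent.map' A.subtype A.ker_subtype
    convert! h1 using 1
    ext i
    fin_cases i <;> rfl
  · rw [hmem]
    refine ⟨fun h => ⟨h _ (B 0).2, h _ (B 1).2⟩, ?_⟩
    rintro ⟨h0, h1⟩ a ha
    have h := congrArg Subtype.val (B.sum_repr ⟨a, ha⟩)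
    rw [Fin.sum_univ_two] at h
    simp only [Submodule.coe_add, Submodule.coe_smul] at h
    rw [← h, add_dotProduct, smul_dotProduct, smul_dotProduct, h0, h1, smul_zero, smul_zero,
      add_zero]

end

/-- **The B. and M. Shapiro conjecture for codimension-2 Schubert conditions.**
If `z₁, …, z_{2d−2}` are distinct real numbers and `H ⊆ ℂ^{d+1}` is a `(d−1)`-dimensional
complex subspace meeting the tangent line `span{E(zᵢ), E′(zᵢ)}` of the rational normal
curve nontrivially for every `i`, then `H` is real, i.e. invariant under coordinatewise
complex conjugation. -/
theorem shapiro_conjecture_tangent_lines (d : ℕ) (hd : 2 ≤ d)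
    (z : Fin (2 * d - 2) → ℝ) (hz : Function.Injective z)
    (H : Submodule ℂ (Fin (d + 1) → ℂ))
    (hdim : Module.finrank ℂ H = d - 1)
    (hmeet : ∀ i, H ⊓ Submodule.span ℂ {rncE d ((z i : ℂ)), rncE' d ((z i : ℂ))} ≠ ⊥) :
    ∀ v ∈ H, (fun j => (starRingEnd ℂ) (v j)) ∈ H := by
  obtain ⟨a, b, hab, hH⟩ := exists_mem_iff_dotProduct_eq_zero (H := H) (by omega)
  rw [LinearIndependent.pair_iff] at hab
  let P := Polynomial.ofFn (R := ℂ) (d + 1)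
  have hdeg : ∀ a, (P a).natDegree ≤ d := fun a =>
    Nat.lt_succ_iff.1 (Polynomial.ofFn_natDegree_lt (by omega) a)
  have hcoeff : ∀ a (j : Fin (d + 1)), (P a).coeff j = a j := fun a j =>
    Polynomial.ofFn_coeff_eq_val_of_lt a j.2
  have hinj : ∀ a, P a = 0 → a = 0 := fun a ha => funext fun j => by
    rw [← hcoeff a, ha, Polynomial.coeff_zero, Pi.zero_apply]
  have hW : Polynomial.wronskian (P a) (P b) ≠ 0 := by
    intro h
    have ha : P a ≠ 0 := by
      intro ha
      have := (hab 1 0 (by rw [hinj a ha]; simp)).1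
      exact one_ne_zero this
    obtain ⟨s, hs⟩ := exists_eq_C_mul_of_wronskian_eq_zero ha h
    have h0 : (-s) • a + (1 : ℂ) • b = 0 := by
      refine hinj _ ?_
      rw [map_add, map_smul, map_smul, hs, Polynomial.smul_eq_C_mul, Polynomial.smul_eq_C_mul,
        Polynomial.C_neg, Polynomial.C_1]
      ring
    exact one_ne_zero (hab _ _ h0).2
  have hmeet' : ∀ i, ∃ α β : ℂ, (α ≠ 0 ∨ β ≠ 0) ∧
      α * (P a).eval (z i : ℂ) + β * (P a).derivative.eval (z i : ℂ) = 0 ∧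
      α * (P b).eval (z i : ℂ) + β * (P b).derivative.eval (z i : ℂ) = 0 := by
    intro i
    obtain ⟨w, hw, hw0⟩ := Submodule.exists_mem_ne_zero_of_ne_bot (hmeet i)
    obtain ⟨hwH, hws⟩ := Submodule.mem_inf.1 hw
    obtain ⟨α, β, rfl⟩ := Submodule.mem_span_pair.1 hws
    refine ⟨α, β, ?_, ?_⟩
    · by_contra! h
      simp [h.1, h.2] at hw0
    · simpa only [P, eval_ofFn_eq_dotProduct, eval_derivative_ofFn_eq_dotProduct, dotProduct_add,
        dotProduct_smul, smul_eq_mul] using (hH _).1 hwH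
  intro v hv
  have hconj : ∀ u, u = a ∨ u = b → u ⬝ᵥ (fun j => (starRingEnd ℂ) (v j)) = 0 := by
    intro u hu
    obtain ⟨α, β, h⟩ := exists_map_conj_eq_add hd (Fintype.card_fin _) hz (hdeg a) (hdeg b) hW
      hmeet' (u := P u) (hu.imp (congrArg P) (congrArg P))
    have hj : ∀ j, (starRingEnd ℂ) (u j) = α * a j + β * b j := by
      intro j
      have := congrArg (fun p => Polynomial.coeff p j) h
      simpa only [Polynomial.coeff_map, Polynomial.coeff_add, Polynomial.coeff_C_mul, hcoeff]
        using this
    apply (starRingEnd ℂ).injective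
    rw [map_zero]
    have h1 := (hH v).1 hv
    calc (starRingEnd ℂ) (u ⬝ᵥ fun j => (starRingEnd ℂ) (v j))
        = α * (a ⬝ᵥ v) + β * (b ⬝ᵥ v) := by
          simp only [dotProduct, map_sum, map_mul, hj, Complex.conj_conj, Finset.mul_sum,
            ← Finset.sum_add_distrib]
          exact Finset.sum_congr rfl fun j _ => by ring
      _ = 0 := by rw [h1.1, h1.2, mul_zero, mul_zero, add_zero]
  exact (hH _).2 ⟨hconj a (Or.inl rfl), hconj b (Or.inr rfl)⟩
end

section
/- Let d ≥ 1. For a rational function f = f₁/f₀ of degree d, with f₁(z) = a₀ + a₁z + … + a_d z^d and f₀(z) = b₀ + b₁z + … + b_d z^d coprime, let H_f = {x ∈ ℂ^{d+1} : a₀x₀ + … + a_d x_d = 0 and b₀x₀ + … + b_d x_d = 0}. Then H_f is a (d−1)-dimensional complex subspace of ℂ^{d+1}, H_{f} = H_{g} if and only if f and g are equivalent, and f ↦ H_f gives a bijection between the set of equivalence classes of rational functions of degree d and the set of (d−1)-dimensional complex subspaces H ⊆ ℂ^{d+1} containing no nonzero vector of the form E(z) = (1, z, …, z^d) with z ∈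 ℂ and not containing the vector (0, …, 0, 1). -/
open Polynomial

/-- The linear form `x ↦ Σ_j p.coeff j * x j` on `ℂ^{d+1}` given by the coefficients of `p`. -/
noncomputable def coeffForm (d : ℕ) (p : ℂ[X]) : (Fin (d + 1) → ℂ) →ₗ[ℂ] ℂ :=
  ∑ j : Fin (d + 1), p.coeff (j : ℕ) • LinearMap.proj j

/-- The codimension-two subspace `H_f ⊆ ℂ^{d+1}` attached to `f = f₁/f₀`,
cut out by the two linear equations `Σ aᵢxᵢ = 0`, `Σ bᵢxᵢ = 0` given by the
coefficients of `f₁` and `f₀`. -/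
noncomputable def Hsub (d : ℕ) (f₁ f₀ : ℂ[X]) : Submodule ℂ (Fin (d + 1) → ℂ) :=
  LinearMap.ker (coeffForm d f₁) ⊓ LinearMap.ker (coeffForm d f₀)

theorem coeffForm_apply (d : ℕ) (p : ℂ[X]) (x : Fin (d + 1) → ℂ) :
    coeffForm d p x = ∑ j : Fin (d + 1), p.coeff j * x j := by
  simp [coeffForm]

theorem coeffForm_add (d : ℕ) (p q : ℂ[X]) :
    coeffForm d (p + q) = coeffForm d p + coeffForm d q := by
  simp [coeffForm, Finset.sum_add_distrib, add_smul]

theorem coeffForm_smul (d : ℕ) (c : ℂ) (p : ℂ[X]) :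
    coeffForm d (c • p) = c • coeffForm d p := by
  simp [coeffForm, Finset.smul_sum, mul_smul]

theorem coeffForm_single (d : ℕ) (p : ℂ[X]) (j : Fin (d + 1)) :
    coeffForm d p (Pi.single j 1) = p.coeff j := by
  simp [coeffForm_apply, Pi.single_apply]

theorem coeffForm_rncE {d : ℕ} {p : ℂ[X]} (hp : p.degree ≤ d) (z : ℂ) :
    coeffForm d p (rncE d z) = p.eval z := by
  rw [coeffForm_apply, eval_eq_sum_range' (Nat.lt_succ_of_le (natDegree_le_of_degree_le hp)),
    ← Fin.sum_univ_eq_sum_range (fun i => p.coeff i * z ^ i)]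
  rfl

theorem eq_of_coeffForm_eq {d : ℕ} {p q : ℂ[X]} (hp : p.degree ≤ d) (hq : q.degree ≤ d)
    (h : coeffForm d p = coeffForm d q) : p = q := by
  ext n
  by_cases hn : n < d + 1
  · simpa only [coeffForm_single] using LinearMap.congr_fun h (Pi.single ⟨n, hn⟩ 1)
  · have hdn : (d : WithBot ℕ) < n := by exact_mod_cast (by omega : d < n)
    rw [coeff_eq_zero_of_degree_lt (hp.trans_lt hdn), coeff_eq_zero_of_degree_lt (hq.trans_lt hdn)]

/-- Every linear form on `ℂ^{d+1}` comes from a polynomial of degree at most `d`. -/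
theorem exists_coeffForm_eq (d : ℕ) (φ : Module.Dual ℂ (Fin (d + 1) → ℂ)) :
    ∃ p : ℂ[X], p.degree ≤ d ∧ coeffForm d p = φ := by
  let v : Fin (d + 1) → ℂ := fun j => φ (Pi.single j 1)
  refine ⟨(degreeLTEquiv ℂ (d + 1)).symm v, ?_, ?_⟩
  · exact mem_degreeLE.1 (degreeLT_succ_eq_degreeLE.le ((degreeLTEquiv ℂ (d + 1)).symm v).2)
  · refine LinearMap.pi_ext' fun j => LinearMap.ext_ring ?_
    have h := congrFun ((degreeLTEquiv ℂ (d + 1)).apply_symm_apply v) j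
    simp only [LinearMap.coe_comp, LinearMap.coe_single, Function.comp_apply, coeffForm_single]
    exact h

theorem mem_Hsub {d : ℕ} {p q : ℂ[X]} {x : Fin (d + 1) → ℂ} :
    x ∈ Hsub d p q ↔ coeffForm d p x = 0 ∧ coeffForm d q x = 0 := by
  simp [Hsub]

theorem Hsub_eq_dualCoannihilator (d : ℕ) (p q : ℂ[X]) :
    Hsub d p q = (Submodule.span ℂ {coeffForm d p, coeffForm d q}).dualCoannihilator := by
  ext x
  rw [mem_Hsub, Submodule.mem_dualCoannihilator]
  refine ⟨fun h φ hφ => ?_, fun h => ⟨h _ (Submodule.subset_span (by simp)),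
    h _ (Submodule.subset_span (by simp))⟩⟩
  obtain ⟨a, b, rfl⟩ := Submodule.mem_span_pair.1 hφ
  simp [h.1, h.2]

namespace IsRatOfDeg

variable {d : ℕ} {p q : ℂ[X]}

theorem degree_le_left (h : IsRatOfDeg d p q) : p.degree ≤ d := h.2 ▸ le_max_left _ _

theorem degree_le_right (h : IsRatOfDeg d p q) : q.degree ≤ d := h.2 ▸ le_max_right _ _

theorem symm (h : IsRatOfDeg d p q) : IsRatOfDeg d q p := ⟨h.1.symm, max_comm p.degree _ ▸ h.2⟩

theorem ne_smul (h : IsRatOfDeg d p q) (hd : 1 ≤ d) (c : ℂ) : p ≠ c • q := by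
  rintro rfl
  have hu : IsUnit q := h.1.isUnit_of_dvd' (smul_eq_C_mul c ▸ dvd_mul_left q (C c)) dvd_rfl
  have h1 := degree_eq_zero_of_isUnit hu
  have h2 : max (c • q).degree q.degree ≤ 0 := max_le ((degree_smul_le c q).trans h1.le) h1.le
  rw [h.2] at h2
  have : d ≤ 0 := by exact_mod_cast h2
  omega

theorem eq_zero_of_smul_add_smul (h : IsRatOfDeg d p q) (hd : 1 ≤ d) {s t : ℂ}
    (hst : s • p + t • q = 0) : s = 0 ∧ t = 0 := by
  constructor
  · by_contra hs
    refine h.ne_smul hd (-(s⁻¹ * t)) ?_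
    rw [neg_smul, mul_smul, ← smul_neg, ← eq_neg_of_add_eq_zero_left hst, inv_smul_smul₀ hs]
  · by_contra ht
    refine h.symm.ne_smul hd (-(t⁻¹ * s)) ?_
    rw [neg_smul, mul_smul, ← smul_neg, ← eq_neg_of_add_eq_zero_right hst, inv_smul_smul₀ ht]

theorem linearIndependent_coeffForm (h : IsRatOfDeg d p q) (hd : 1 ≤ d) :
    LinearIndependent ℂ ![coeffForm d p, coeffForm d q] := by
  refine LinearIndependent.pair_iff.2 fun s t hst => h.eq_zero_of_smul_add_smul hd ?_
  refine eq_of_coeffForm_eq ((degree_add_le _ _).trans (max_le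
    ((degree_smul_le s p).trans h.degree_le_left) ((degree_smul_le t q).trans h.degree_le_right)))
    (by simp) ?_
  rw [coeffForm_add, coeffForm_smul, coeffForm_smul, hst]
  simpa using (coeffForm_smul d 0 0).symm

theorem finrank_Hsub (h : IsRatOfDeg d p q) (hd : 1 ≤ d) :
    Module.finrank ℂ (Hsub d p q) = d - 1 := by
  have h1 := Subspace.finrank_add_finrank_dualCoannihilator_eq
    (Submodule.span ℂ {coeffForm d p, coeffForm d q})
  have h2 := finrank_span_eq_card (h.linearIndependent_coeffForm hd)
  rw [Matrix.range_cons, Matrix.range_cons, Matrix.range_empty, Set.union_empty,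
    Set.singleton_union, Fintype.card_fin] at h2
  rw [← Hsub_eq_dualCoannihilator, h2, Module.finrank_fin_fun] at h1
  omega

theorem rncE_notMem_Hsub (h : IsRatOfDeg d p q) (z : ℂ) : rncE d z ∉ Hsub d p q := by
  rw [mem_Hsub, coeffForm_rncE h.degree_le_left, coeffForm_rncE h.degree_le_right]
  rintro ⟨hp, hq⟩
  obtain ⟨u, v, huv⟩ := h.1
  simpa [hp, hq] using congrArg (eval z) huv

theorem single_last_notMem_Hsub (h : IsRatOfDeg d p q) :
    Pi.single (Fin.last d) (1 : ℂ) ∉ Hsub d p q := by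
  rw [mem_Hsub, coeffForm_single, coeffForm_single, Fin.val_last]
  rintro ⟨hp, hq⟩
  rcases max_choice p.degree q.degree with hm | hm
  · exact coeff_ne_zero_of_eq_degree (hm ▸ h.2) hp
  · exact coeff_ne_zero_of_eq_degree (hm ▸ h.2) hq

theorem exists_eq_smul_add_smul {r : ℂ[X]} (h : IsRatOfDeg d p q) (hr : r.degree ≤ d)
    (hmem : coeffForm d r ∈ Submodule.span ℂ {coeffForm d p, coeffForm d q}) :
    ∃ a b : ℂ, r = a • p + b • q := by
  obtain ⟨a, b, hab⟩ := Submodule.mem_span_pair.1 hmem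
  refine ⟨a, b, eq_of_coeffForm_eq hr ((degree_add_le _ _).trans (max_le
    ((degree_smul_le a p).trans h.degree_le_left)
    ((degree_smul_le b q).trans h.degree_le_right))) ?_⟩
  rw [coeffForm_add, coeffForm_smul, coeffForm_smul, hab]

end IsRatOfDeg

theorem ratEquiv_of_Hsub_eq {d : ℕ} (hd : 1 ≤ d) {f₁ f₀ g₁ g₀ : ℂ[X]}
    (hf : IsRatOfDeg d f₁ f₀) (hg : IsRatOfDeg d g₁ g₀) (h : Hsub d f₁ f₀ = Hsub d g₁ g₀) :
    RatEquiv f₁ f₀ g₁ g₀ := by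
  rw [Hsub_eq_dualCoannihilator, Hsub_eq_dualCoannihilator] at h
  have hspan := congrArg Submodule.dualAnnihilator h
  rw [Subspace.dualCoannihilator_dualAnnihilator_eq,
    Subspace.dualCoannihilator_dualAnnihilator_eq] at hspan
  obtain ⟨a, b, h₁⟩ := hg.exists_eq_smul_add_smul hf.degree_le_left
    (hspan ▸ Submodule.subset_span (by simp))
  obtain ⟨c, e, h₀⟩ := hg.exists_eq_smul_add_smul hf.degree_le_right
    (hspan ▸ Submodule.subset_span (by simp))
  refine ⟨a, b, c, e, fun hdet => ?_, by rw [← h₁, ← h₀, mul_comm]⟩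
  have hC : C a * C e - C b * C c = 0 := by rw [← C_mul, ← C_mul, ← C_sub, hdet, C_0]
  have hl : e • f₁ + (-b) • f₀ = 0 := by
    rw [h₁, h₀]
    simp only [smul_eq_C_mul, C_neg]
    linear_combination g₁ * hC
  have hr : c • f₁ + (-a) • f₀ = 0 := by
    rw [h₁, h₀]
    simp only [smul_eq_C_mul, C_neg]
    linear_combination -g₀ * hC
  have hb := (hf.eq_zero_of_smul_add_smul hd hl).2
  have ha := (hf.eq_zero_of_smul_add_smul hd hr).2
  rw [neg_eq_zero] at ha hb
  exact hf.ne_smul hd 0 (by simpa [ha, hb] using h₁)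

theorem Hsub_eq_of_ratEquiv {d : ℕ} (hd : 1 ≤ d) {f₁ f₀ g₁ g₀ : ℂ[X]}
    (hf : IsRatOfDeg d f₁ f₀) (hg : IsRatOfDeg d g₁ g₀) (h : RatEquiv f₁ f₀ g₁ g₀) :
    Hsub d f₁ f₀ = Hsub d g₁ g₀ := by
  obtain ⟨a, b, c, e, hdet, h⟩ := h
  have hf₀ : f₀ ≠ 0 := by simpa using hf.symm.ne_smul hd 0
  obtain ⟨k, hk₀⟩ : f₀ ∣ c • g₁ + e • g₀ := hf.1.symm.dvd_of_dvd_mul_left ⟨_, h⟩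
  have hk₁ : a • g₁ + b • g₀ = f₁ * k :=
    mul_left_cancel₀ hf₀ (by rw [← h, hk₀]; ring)
  have hC : C (a * e - b * c) * C (a * e - b * c)⁻¹ = 1 := by
    rw [← C_mul, mul_inv_cancel₀ hdet, C_1]
  simp only [C_sub, C_mul, smul_eq_C_mul] at hC hk₀ hk₁
  have hku : IsUnit k := by
    refine hg.1.isUnit_of_dvd' ⟨C (a * e - b * c)⁻¹ * (C e * f₁ - C b * f₀), ?_⟩
      ⟨C (a * e - b * c)⁻¹ * (C a * f₀ - C c * f₁), ?_⟩
    · linear_combination -g₁ * hC + C (a * e - b * c)⁻¹ * (C e * hk₁ - C b * hk₀)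
    · linear_combination -g₀ * hC + C (a * e - b * c)⁻¹ * (C a * hk₀ - C c * hk₁)
  obtain ⟨u, hu, rfl⟩ := isUnit_iff.1 hku
  have hu0 : u ≠ 0 := hu.ne_zero
  have e₀ : c • g₁ + e • g₀ = u • f₀ := by rw [smul_eq_C_mul, smul_eq_C_mul, hk₀, smul_eq_C_mul, mul_comm]
  have e₁ : a • g₁ + b • g₀ = u • f₁ := by rw [smul_eq_C_mul, smul_eq_C_mul, hk₁, smul_eq_C_mul, mul_comm]
  ext x
  have x₀ := LinearMap.congr_fun (congrArg (coeffForm d) e₀) x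
  have x₁ := LinearMap.congr_fun (congrArg (coeffForm d) e₁) x
  simp only [coeffForm_add, coeffForm_smul, LinearMap.add_apply, LinearMap.smul_apply,
    smul_eq_mul] at x₀ x₁
  rw [mem_Hsub, mem_Hsub]
  constructor
  · rintro ⟨y₁, y₀⟩
    rw [y₀] at x₀
    rw [y₁] at x₁
    constructor <;> refine (mul_eq_zero.1 ?_).resolve_left hdet
    · linear_combination e * x₁ - b * x₀
    · linear_combination a * x₀ - c * x₁
  · rintro ⟨y₁, y₀⟩
    rw [y₁, y₀] at x₀ x₁
    constructor <;> refine (mul_eq_zero.1 ?_).resolve_left hu0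
    · linear_combination -x₁
    · linear_combination -x₀

theorem exists_Hsub_eq {d : ℕ} {H : Submodule ℂ (Fin (d + 1) → ℂ)} (hd : 1 ≤ d)
    (hH : Module.finrank ℂ H = d - 1) : ∃ p q : ℂ[X], p.degree ≤ d ∧ q.degree ≤ d ∧
      Hsub d p q = H := by
  have hrank : Module.finrank ℂ H.dualAnnihilator = 2 := by
    have h := Subspace.finrank_add_finrank_dualAnnihilator_eq H
    rw [hH, Module.finrank_fin_fun] at h
    omega
  let B := Module.finBasisOfFinrankEq ℂ H.dualAnnihilator hrank
  obtain ⟨p, hp, hpB⟩ := exists_coeffForm_eq d (B 0)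
  obtain ⟨q, hq, hqB⟩ := exists_coeffForm_eq d (B 1)
  refine ⟨p, q, hp, hq, ?_⟩
  have hspan : Submodule.span ℂ {coeffForm d p, coeffForm d q} = H.dualAnnihilator := by
    refine le_antisymm (Submodule.span_le.2 ?_) fun φ hφ => ?_
    · rintro _ (rfl | rfl)
      · exact hpB ▸ (B 0).2
      · exact hqB ▸ (B 1).2
    · have h := congrArg Subtype.val (B.sum_repr ⟨φ, hφ⟩)
      rw [Fin.sum_univ_two] at h
      exact Submodule.mem_span_pair.2 ⟨_, _, by rw [hpB, hqB]; exact h⟩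
  rw [Hsub_eq_dualCoannihilator, hspan, Subspace.dualAnnihilator_dualCoannihilator_eq]

theorem isRatOfDeg_of_notMem_Hsub {d : ℕ} {p q : ℂ[X]} (hp : p.degree ≤ d) (hq : q.degree ≤ d)
    (hE : ∀ z : ℂ, rncE d z ∉ Hsub d p q)
    (hlast : Pi.single (Fin.last d) (1 : ℂ) ∉ Hsub d p q) : IsRatOfDeg d p q := by
  constructor
  · refine (isCoprime_iff_aeval_ne_zero_of_isAlgClosed ℂ ℂ p q).2 fun z => ?_
    have h := hE z
    rw [mem_Hsub, coeffForm_rncE hp, coeffForm_rncE hq] at h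
    simpa [coe_aeval_eq_eval, imp_iff_not_or] using h
  · rw [mem_Hsub, coeffForm_single, coeffForm_single, Fin.val_last] at hlast
    refine le_antisymm (max_le hp hq) (not_lt.1 fun hlt => hlast ?_)
    exact ⟨coeff_eq_zero_of_degree_lt ((le_max_left _ _).trans_lt hlt),
      coeff_eq_zero_of_degree_lt ((le_max_right _ _).trans_lt hlt)⟩

/-- **Goldberg's correspondence (Section 1).** For a rational function `f = f₁/f₀` of degree
`d`, the subspace `H_f` is `(d−1)`-dimensional; `H_f = H_g` iff `f` and `g` are equivalent;
and `f ↦ H_f` is a bijection from equivalence classes of rational functions of degree `d`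
onto the set of `(d−1)`-dimensional subspaces of `ℂ^{d+1}` avoiding the rational normal
curve (containing no vector `E(z)`, `z ∈ ℂ`, and not containing `E(∞) = (0,…,0,1)`). -/
theorem goldberg_correspondence (d : ℕ) (hd : 1 ≤ d) :
    (∀ f₁ f₀ : ℂ[X], IsRatOfDeg d f₁ f₀ →
      Module.finrank ℂ (Hsub d f₁ f₀) = d - 1 ∧
      (∀ z : ℂ, rncE d z ∉ Hsub d f₁ f₀) ∧
      Pi.single (Fin.last d) (1 : ℂ) ∉ Hsub d f₁ f₀) ∧
    (∀ f₁ f₀ g₁ g₀ : ℂ[X], IsRatOfDeg d f₁ f₀ → IsRatOfDeg d g₁ g₀ →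
      (Hsub d f₁ f₀ = Hsub d g₁ g₀ ↔ RatEquiv f₁ f₀ g₁ g₀)) ∧
    (∀ H : Submodule ℂ (Fin (d + 1) → ℂ),
      Module.finrank ℂ H = d - 1 →
      (∀ z : ℂ, rncE d z ∉ H) →
      Pi.single (Fin.last d) (1 : ℂ) ∉ H →
      ∃ f₁ f₀ : ℂ[X], IsRatOfDeg d f₁ f₀ ∧ Hsub d f₁ f₀ = H) := by
  refine ⟨fun f₁ f₀ hf => ⟨hf.finrank_Hsub hd, hf.rncE_notMem_Hsub, hf.single_last_notMem_Hsub⟩,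
    fun f₁ f₀ g₁ g₀ hf hg => ⟨ratEquiv_of_Hsub_eq hd hf hg, Hsub_eq_of_ratEquiv hd hf hg⟩,
    fun H hH hE hlast => ?_⟩
  obtain ⟨p, q, hp, hq, rfl⟩ := exists_Hsub_eq hd hH
  exact ⟨p, q, isRatOfDeg_of_notMem_Hsub hp hq hE hlast, rfl⟩
end

section
/- Let d ≥ 1 and let w be a nonzero complex polynomial of degree at most 2d−2. Then the set of two-dimensional complex subspaces V of the space of complex polynomials of degree at most d such that the Wronskian of some (equivalently, any) basis (r, q) of V is a nonzero scalar multiple of w, is finite. (The Wronski map on the Grassmannian G(2, d+1) has finite fibers.) -/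
open Polynomial

namespace Polynomial

/-- The top coefficient of the Wronskian, shifted by one to avoid truncated subtraction. -/
theorem coeff_X_mul_wronskian {R : Type*} [CommRing R] {r q : R[X]} {a b : ℕ}
    (hr : r.natDegree ≤ a) (hq : q.natDegree ≤ b) :
    (X * wronskian r q).coeff (a + b) = ((b : R) - a) * (r.coeff a * q.coeff b) := by
  have hX : ∀ {p : R[X]} {n : ℕ}, p.natDegree ≤ n →
      (X * derivative p).natDegree ≤ n ∧ (X * derivative p).coeff n = n * p.coeff n := by
    intro p n hp
    have hc : ∀ k, (X * derivative p).coeff k = k * p.coeff k := by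
      rintro (_ | k)
      · simp
      · rw [coeff_X_mul, coeff_derivative]; push_cast; ring
    refine ⟨natDegree_le_iff_coeff_eq_zero.2 fun k hk => ?_, hc n⟩
    rw [hc, coeff_eq_zero_of_natDegree_lt (hp.trans_lt hk), mul_zero]
  have h : X * wronskian r q = r * (X * derivative q) - (X * derivative r) * q := by
    rw [wronskian]; ring
  rw [h, coeff_sub, coeff_mul_add_eq_of_natDegree_le hr (hX hq).1,
    coeff_mul_add_eq_of_natDegree_le (hX hr).1 hq, (hX hq).2, (hX hr).2]
  ring

theorem map_wronskian {R S : Type*} [CommRing R] [CommRing S] (f : R →+* S) (r q : R[X]) :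
    (wronskian r q).map f = wronskian (r.map f) (q.map f) := by
  simp [wronskian, derivative_map]

/-- In characteristic zero, polynomials with vanishing Wronskian are proportional. -/
theorem exists_eq_C_mul_of_wronskian_eq_zero {k : Type*} [Field k] [CharZero k] {r q : k[X]}
    (hr : r ≠ 0) (h : wronskian r q = 0) : ∃ c : k, q = C c * r := by
  have hdeg : ∀ p : k[X], p ≠ 0 → wronskian r p = 0 → p.natDegree = r.natDegree := by
    intro p hp hw
    have := coeff_X_mul_wronskian (le_refl r.natDegree) (le_refl p.natDegree)
    rw [hw, mul_zero, coeff_zero, eq_comm, mul_eq_zero, sub_eq_zero] at this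
    rcases this with h | h
    · exact_mod_cast h
    · simp [hr, hp] at h
  by_cases hq : q = 0
  · exact ⟨0, by simp [hq]⟩
  refine ⟨q.leadingCoeff / r.leadingCoeff, ?_⟩
  by_contra hne
  have hp : q - C (q.leadingCoeff / r.leadingCoeff) * r ≠ 0 := sub_ne_zero.2 hne
  have hw : wronskian r (q - C (q.leadingCoeff / r.leadingCoeff) * r) = 0 := by
    have : wronskian r (q - C (q.leadingCoeff / r.leadingCoeff) * r) = wronskian r q := by
      simp only [wronskian, derivative_sub, derivative_C_mul]; ring
    rw [this, h]
  have hd := hdeg _ hp hw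
  have hqd := hdeg _ hq h
  apply hp
  rw [← leadingCoeff_eq_zero, leadingCoeff, hd, coeff_sub, coeff_C_mul, coeff_natDegree,
    ← hqd, coeff_natDegree, div_mul_cancel₀ _ (leadingCoeff_ne_zero.2 hr), sub_self]

/-- A nonzero polynomial over the fraction field of a valuation ring can be scaled so that it
has coefficients in the valuation ring, one of them being `1`. -/
theorem exists_C_mul_eq_map_of_valuationSubring {K : Type*} [Field K] (O : ValuationSubring K)
    {p : K[X]} (hp : p ≠ 0) :
    ∃ l : K, l ≠ 0 ∧ ∃ P : O[X], P.map (algebraMap O K) = C l * p ∧ ∃ i, P.coeff i = 1 := by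
  obtain ⟨i, hi, hmax⟩ := p.support.exists_max_image (fun i => O.valuation (p.coeff i))
    (nonempty_support_iff.2 hp)
  have hi0 : p.coeff i ≠ 0 := mem_support_iff.1 hi
  have hlift : C (p.coeff i)⁻¹ * p ∈ lifts (algebraMap O K) := by
    rw [lifts_iff_coeff_lifts]
    intro n
    by_cases hn : p.coeff n = 0
    · exact ⟨0, by simp [hn]⟩
    · obtain ⟨c, hc⟩ := (O.valuation_le_iff _ _).1 (hmax n (mem_support_iff.2 hn))
      refine ⟨c, ?_⟩
      rw [coeff_C_mul, ← hc, ValuationSubring.algebraMap_apply]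
      field_simp
  obtain ⟨P, hP⟩ := (mem_lifts _).1 hlift
  refine ⟨_, inv_ne_zero hi0, P, hP, i, ?_⟩
  apply FaithfulSMul.algebraMap_injective O K
  rw [← coeff_map, hP, coeff_C_mul, inv_mul_cancel₀ hi0, map_one]

/-- Valuative criterion for the Wronski map: a normalized pair of polynomials whose Wronskian has
coefficients in a valuation ring of residue characteristic zero has coefficients in that ring. -/
theorem mem_lifts_valuationSubring_of_wronskian {F K : Type*} [Field F] [CharZero F] [Field K]
    (O : ValuationSubring K) (f : F →+* O) {r q : K[X]} (hr : r.Monic) (hq : q.Monic)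
    (hlt : r.natDegree < q.natDegree) (h0 : q.coeff r.natDegree = 0)
    (hW : wronskian r q ∈ lifts (algebraMap O K)) :
    r ∈ lifts (algebraMap O K) ∧ q ∈ lifts (algebraMap O K) := by
  have hinj := FaithfulSMul.algebraMap_injective O K
  let ρ := IsLocalRing.residue O
  have : CharZero (IsLocalRing.ResidueField O) :=
    charZero_of_injective_ringHom (ρ.comp f).injective
  generalize ha : r.natDegree = a at *
  generalize hb : q.natDegree = b at *
  have hra : r.coeff a = 1 := by rw [← ha]; exact hr
  have hqb : q.coeff b = 1 := by rw [← hb]; exact hq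
  obtain ⟨l, hl, R, hR, i, hi⟩ := exists_C_mul_eq_map_of_valuationSubring O hr.ne_zero
  have hRc : ∀ n, algebraMap O K (R.coeff n) = l * r.coeff n := fun n => by
    rw [← coeff_map, hR, coeff_C_mul]
  set q₁ := q - C (q.coeff i) * (C l * r) with hq₁
  have hq₁b : q₁.coeff b = 1 := by
    rw [hq₁, coeff_sub, coeff_C_mul, coeff_C_mul, hqb,
      coeff_eq_zero_of_natDegree_lt (ha.trans_lt hlt)]
    simp
  have hq₁0 : q₁ ≠ 0 := by rintro h; simp [h] at hq₁b
  have hq₁i : q₁.coeff i = 0 := by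
    rw [hq₁, coeff_sub, coeff_C_mul, coeff_C_mul, ← hRc, hi, map_one, mul_one, sub_self]
  have hq₁d : q₁.natDegree ≤ b := by
    refine (natDegree_sub_le _ _).trans (max_le hb.le ?_)
    exact (natDegree_C_mul_le _ _).trans ((natDegree_C_mul_le _ _).trans (ha.le.trans hlt.le))
  obtain ⟨m, hm, Q, hQ, j, hj⟩ := exists_C_mul_eq_map_of_valuationSubring O hq₁0
  have hQc : ∀ n, algebraMap O K (Q.coeff n) = m * q₁.coeff n := fun n => by
    rw [← coeff_map, hQ, coeff_C_mul]
  have hQi : Q.coeff i = 0 := hinj (by rw [hQc, hq₁i, mul_zero, map_zero])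
  have hRd : R.natDegree ≤ a := by
    rw [← natDegree_map_eq_of_injective hinj, hR]
    exact (natDegree_C_mul_le _ _).trans ha.le
  have hQd : Q.natDegree ≤ b := by
    rw [← natDegree_map_eq_of_injective hinj, hQ]
    exact (natDegree_C_mul_le _ _).trans hq₁d
  obtain ⟨W, hWm⟩ := (mem_lifts _).1 hW
  -- the Wronskian of the rescaled pair
  have hmap : (wronskian R Q).map (algebraMap O K) = C (l * m) * W.map (algebraMap O K) := by
    rw [map_wronskian, hR, hQ, hWm, hq₁]
    simp only [wronskian, derivative_sub, derivative_C_mul, C_mul]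
    ring
  have hWtop : (X * W).coeff (a + b) = ((b - a : ℕ) : O) := by
    apply hinj
    rw [← coeff_map, Polynomial.map_mul, map_X, hWm, coeff_X_mul_wronskian ha.le hb.le, hra, hqb,
      map_natCast, Nat.cast_sub hlt.le]
    ring
  have hu : IsUnit ((b - a : ℕ) : O) := by
    rw [← map_natCast f]
    exact (IsUnit.mk0 _ (Nat.cast_ne_zero.2 (Nat.sub_pos_of_lt hlt).ne')).map f
  obtain ⟨u, hu'⟩ := hu
  have hν : algebraMap O K ((X * wronskian R Q).coeff (a + b) * ↑u⁻¹) = l * m := by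
    have h1 : algebraMap O K ((X * wronskian R Q).coeff (a + b)) = l * m * algebraMap O K u := by
      rw [hu', ← hWtop, ← coeff_map, ← coeff_map, Polynomial.map_mul, Polynomial.map_mul, hmap,
        map_X, ← coeff_C_mul]
      congr 1; ring
    rw [map_mul, h1, mul_assoc, ← map_mul, Units.mul_inv, map_one, mul_one]
  set ν := (X * wronskian R Q).coeff (a + b) * (↑u⁻¹ : O)
  have hWν : wronskian R Q = C ν * W := by
    apply map_injective _ hinj
    rw [hmap, Polynomial.map_mul, map_C, hν]
  have hne : wronskian (R.map ρ) (Q.map ρ) ≠ 0 := by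
    intro h
    have hR0 : R.map ρ ≠ 0 := fun h => by
      have := congrArg (coeff · i) h
      simp [hi] at this
    obtain ⟨c, hc⟩ := exists_eq_C_mul_of_wronskian_eq_zero hR0 h
    have hci := congrArg (coeff · i) hc
    have hcj := congrArg (coeff · j) hc
    simp only [coeff_map, coeff_C_mul, hi, hQi, hj, map_zero, map_one, mul_one] at hci hcj
    rw [← hci, zero_mul] at hcj
    exact one_ne_zero hcj
  have htop : (X * wronskian (R.map ρ) (Q.map ρ)).coeff (a + b) ≠ 0 := by
    have hm' := congrArg (map ρ) hWν
    rw [map_wronskian, Polynomial.map_mul, map_C] at hm'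
    have hν0 : ρ ν ≠ 0 := fun h => hne (by rw [hm', h, C_0, zero_mul])
    have e : X * (C (ρ ν) * W.map ρ) = C (ρ ν) * (X * W).map ρ := by
      rw [Polynomial.map_mul, map_X]; ring
    rw [hm', e, coeff_C_mul, coeff_map, hWtop, map_natCast]
    exact mul_ne_zero hν0 (Nat.cast_ne_zero.2 (Nat.sub_pos_of_lt hlt).ne')
  rw [coeff_X_mul_wronskian (natDegree_map_le.trans hRd) (natDegree_map_le.trans hQd),
    coeff_map, coeff_map] at htop
  have hunit : ∀ {x : O}, ρ x ≠ 0 → ∃ y : O, algebraMap O K y = (algebraMap O K x)⁻¹ := by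
    intro x hx
    obtain ⟨v, rfl⟩ := (IsLocalRing.residue_ne_zero_iff_isUnit x).1 hx
    refine ⟨↑v⁻¹, eq_inv_of_mul_eq_one_left ?_⟩
    rw [← map_mul, Units.inv_mul, map_one]
  obtain ⟨l', hl'⟩ := hunit (left_ne_zero_of_mul (right_ne_zero_of_mul htop))
  obtain ⟨m', hm'⟩ := hunit (right_ne_zero_of_mul (right_ne_zero_of_mul htop))
  rw [hRc, hra, mul_one] at hl'
  rw [hQc, hq₁b, mul_one] at hm'
  have hr' : (C l' * R).map (algebraMap O K) = r := by
    rw [Polynomial.map_mul, map_C, hR, hl', ← mul_assoc, ← C_mul, inv_mul_cancel₀ hl, C_1, one_mul]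
  have hq' : (C m' * Q).map (algebraMap O K) = q₁ := by
    rw [Polynomial.map_mul, map_C, hQ, hm', ← mul_assoc, ← C_mul, inv_mul_cancel₀ hm, C_1, one_mul]
  refine ⟨(mem_lifts _).2 ⟨_, hr'⟩, (mem_lifts _).2 ⟨C m' * Q - C ((C m' * Q).coeff a * l') * R, ?_⟩⟩
  have hqi : ((C m' * Q).map (algebraMap O K)).coeff a = -(q.coeff i * l) := by
    rw [hq', hq₁, coeff_sub, coeff_C_mul, coeff_C_mul, h0, hra]; ring
  rw [coeff_map] at hqi
  rw [Polynomial.map_sub, hq', Polynomial.map_mul, map_C, map_mul, hqi, hl', hR, neg_mul,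
    mul_assoc, mul_inv_cancel₀ hl, mul_one, C_neg, hq₁]
  ring

/-- A normalized pair of polynomials over an extension of an algebraically closed field `F` whose
Wronskian is defined over `F` is itself defined over `F`. -/
theorem mem_lifts_of_wronskian_mem_lifts {F K : Type*} [Field F] [CharZero F] [IsAlgClosed F]
    [Field K] [Algebra F K] {r q : K[X]} (hr : r.Monic) (hq : q.Monic)
    (hlt : r.natDegree < q.natDegree) (h0 : q.coeff r.natDegree = 0)
    (hW : wronskian r q ∈ lifts (algebraMap F K)) (n : ℕ) :
    r.coeff n ∈ (algebraMap F K).range ∧ q.coeff n ∈ (algebraMap F K).range := by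
  have : IsIntegrallyClosedIn (algebraMap F K).range K := by
    rw [Subring.isIntegrallyClosedIn_iff]
    intro x hx
    have hx' : IsIntegral F x := by
      obtain ⟨p, hp, hpx⟩ := hx
      obtain ⟨P, hP, -, hPm⟩ := lifts_and_natDegree_eq_and_monic
        (mem_lifts_of_surjective (algebraMap F K).rangeRestrict_surjective p) hp
      refine ⟨P, hPm, ?_⟩
      rw [← hP, eval₂_map] at hpx
      exact hpx
    rw [RingHom.mem_range]
    exact (minpoly.mem_range_of_degree_eq_one F x
      (IsAlgClosed.degree_eq_one_of_irreducible F (minpoly.irreducible hx')))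
  have key : ∀ V : ValuationSubring K, (algebraMap F K).range ≤ V.toSubring →
      r.coeff n ∈ V ∧ q.coeff n ∈ V := by
    intro V hV
    have h := mem_lifts_valuationSubring_of_wronskian V
      ((algebraMap F K).codRestrict V.toSubring fun x => hV ⟨x, rfl⟩) hr hq hlt h0 <| by
        rw [lifts_iff_coeff_lifts] at hW ⊢
        intro k
        obtain ⟨c, hc⟩ := hW k
        exact ⟨⟨_, hV ⟨c, rfl⟩⟩, hc⟩
    rw [lifts_iff_coeff_lifts, lifts_iff_coeff_lifts] at h
    obtain ⟨⟨x, hx⟩, ⟨y, hy⟩⟩ := And.intro (h.1 n) (h.2 n)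
    exact ⟨hx ▸ x.2, hy ▸ y.2⟩
  constructor <;>
  · by_contra hx
    obtain ⟨V, hV, hxV⟩ := Subring.exists_le_valuationSubring_of_isIntegrallyClosedIn hx
    first | exact hxV (key V hV).1 | exact hxV (key V hV).2

/-- A function with infinitely many values is non-constant modulo some maximal ideal of the ring
of all functions. -/
theorem _root_.Pi.exists_maximal_forall_mk_ne_algebraMap {T F : Type*} [Field F] (g : T → F)
    (hg : (Set.range g).Infinite) :
    ∃ m : Ideal (T → F), m.IsMaximal ∧
      ∀ c : F, Ideal.Quotient.mk m g ≠ algebraMap F ((T → F) ⧸ m) c := by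
  classical
  let I : Ideal (T → F) :=
    { carrier := {h | (g '' Function.support h).Finite}
      zero_mem' := by simp
      add_mem' := fun {x y} hx hy =>
        ((Set.Finite.union hx hy).subset (by
          rw [← Set.image_union]
          exact Set.image_mono (Function.support_add x y)))
      smul_mem' := fun c x hx =>
        Set.Finite.subset hx (Set.image_mono (Function.support_mul_subset_right c x)) }
  have hI : I ≠ ⊤ := by
    rw [Ideal.ne_top_iff_one]
    intro h
    have h1 : (g '' Function.support (1 : T → F)).Finite := h
    rw [Function.support_one, Set.image_univ] at h1
    exact hg h1
  obtain ⟨m, hm, hIm⟩ := Ideal.exists_le_maximal I hI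
  refine ⟨m, hm, fun c hc => hm.ne_top ?_⟩
  have h1 : g - algebraMap F (T → F) c ∈ m := Ideal.Quotient.eq.1 hc
  let e : T → F := fun t => if g t = c then 1 else 0
  have he : e ∈ m := hIm <| by
    change (g '' Function.support e).Finite
    refine (Set.finite_singleton c).subset ?_
    rintro _ ⟨t, ht, rfl⟩
    by_contra hne
    exact ht (if_neg hne)
  refine Ideal.eq_top_of_isUnit_mem m (m.add_mem h1 he) (Pi.isUnit_iff.2 fun t => ?_)
  rw [isUnit_iff_ne_zero]
  by_cases ht : g t = c
  · simp [e, ht]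
  · simp [e, ht, sub_eq_zero]

/-- A family of polynomials of bounded degree is a polynomial over the ring of functions. -/
theorem exists_coeff_eq_family {T F : Type*} [CommRing F] (u : T → F[X]) (d : ℕ)
    (hu : ∀ t, (u t).natDegree ≤ d) :
    ∃ U : (T → F)[X], U.natDegree ≤ d ∧ ∀ n t, U.coeff n t = (u t).coeff n := by
  have hc : ∀ n, (∑ i ∈ Finset.range (d + 1), monomial i fun t => (u t).coeff i).coeff n =
      fun t => (u t).coeff n := by
    intro n
    simp only [finsetSum_coeff, coeff_monomial, Finset.sum_ite_eq', Finset.mem_range]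
    split_ifs with h
    · rfl
    · ext t
      exact (coeff_eq_zero_of_natDegree_lt ((hu t).trans_lt (by lia))).symm
  refine ⟨_, natDegree_le_iff_coeff_eq_zero.2 fun n hn => ?_, fun n t => congrFun (hc n) t⟩
  rw [hc]
  ext t
  exact coeff_eq_zero_of_natDegree_lt ((hu t).trans_lt hn)

/-- Only finitely many normalized pairs of polynomials have a given Wronskian. -/
theorem finite_setOf_monic_wronskian_eq {F : Type*} [Field F] [CharZero F] [IsAlgClosed F]
    {a b : ℕ} (hab : a < b) (w : F[X]) :
    {p : F[X] × F[X] | p.1.Monic ∧ p.2.Monic ∧ p.1.natDegree = a ∧ p.2.natDegree = b ∧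
      p.2.coeff a = 0 ∧ wronskian p.1 p.2 = w}.Finite := by
  set S := {p : F[X] × F[X] | p.1.Monic ∧ p.2.Monic ∧ p.1.natDegree = a ∧ p.2.natDegree = b ∧
      p.2.coeff a = 0 ∧ wronskian p.1 p.2 = w} with hS
  obtain ⟨R, hRd, hR⟩ := exists_coeff_eq_family (fun p : S => p.1.1) a fun p => p.2.2.2.1.le
  obtain ⟨Q, hQd, hQ⟩ := exists_coeff_eq_family (fun p : S => p.1.2) b fun p => p.2.2.2.2.1.le
  have hRa : R.coeff a = 1 := by
    ext p
    rw [hR, ← p.2.2.2.1]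
    exact p.2.1
  have hQb : Q.coeff b = 1 := by
    ext p
    rw [hQ, ← p.2.2.2.2.1]
    exact p.2.2.1
  have hQa : Q.coeff a = 0 := by
    ext p
    rw [hQ]
    exact p.2.2.2.2.2.1
  have hW : wronskian R Q = w.map (algebraMap F (S → F)) := by
    ext n p
    have h := p.2.2.2.2.2.2
    have hRp : R.map (Pi.evalRingHom _ p) = p.1.1 := by
      ext k; rw [coeff_map]; exact hR k p
    have hQp : Q.map (Pi.evalRingHom _ p) = p.1.2 := by
      ext k; rw [coeff_map]; exact hQ k p
    rw [← hRp, ← hQp, ← map_wronskian] at h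
    rw [coeff_map, ← h, coeff_map]
    rfl
  have key : ∀ m : Ideal (S → F), m.IsMaximal → ∀ n,
      (∃ c, Ideal.Quotient.mk m (R.coeff n) = algebraMap F ((S → F) ⧸ m) c) ∧
      ∃ c, Ideal.Quotient.mk m (Q.coeff n) = algebraMap F ((S → F) ⧸ m) c := by
    intro m hm n
    let := Ideal.Quotient.field m
    let π := Ideal.Quotient.mk m
    have hra : (R.map π).coeff a = 1 := by rw [coeff_map, hRa, map_one]
    have hqb : (Q.map π).coeff b = 1 := by rw [coeff_map, hQb, map_one]
    have hrd : (R.map π).natDegree = a :=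
      natDegree_eq_of_le_of_coeff_ne_zero (natDegree_map_le.trans hRd) (by rw [hra]; exact one_ne_zero)
    have hqd : (Q.map π).natDegree = b :=
      natDegree_eq_of_le_of_coeff_ne_zero (natDegree_map_le.trans hQd) (by rw [hqb]; exact one_ne_zero)
    have h := mem_lifts_of_wronskian_mem_lifts (F := F)
      (monic_of_natDegree_le_of_coeff_eq_one a hrd.le hra)
      (monic_of_natDegree_le_of_coeff_eq_one b hqd.le hqb) (by rwa [hrd, hqd])
      (by rw [hrd, coeff_map, hQa, map_zero])
      ((mem_lifts _).2 ⟨w, by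
        rw [← map_wronskian, hW, map_map]
        rfl⟩) n
    rw [coeff_map, coeff_map] at h
    obtain ⟨⟨x, hx⟩, ⟨y, hy⟩⟩ := h
    exact ⟨⟨x, hx.symm⟩, ⟨y, hy.symm⟩⟩
  have hfin : ∀ n, (Set.range (R.coeff n)).Finite ∧ (Set.range (Q.coeff n)).Finite := by
    intro n
    constructor <;>
    · by_contra hinf
      obtain ⟨m, hm, hne⟩ := Pi.exists_maximal_forall_mk_ne_algebraMap _ hinf
      first
        | exact (key m hm n).1.elim hne
        | exact (key m hm n).2.elim hne
  let φ : S → Fin (b + 1) → F × F := fun p i => (p.1.1.coeff i, p.1.2.coeff i)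
  have hφ : Function.Injective φ := by
    intro p p' h
    have hc : ∀ n, n ≤ b → p.1.1.coeff n = p'.1.1.coeff n ∧ p.1.2.coeff n = p'.1.2.coeff n := by
      intro n hn
      have := congrFun h ⟨n, Nat.lt_succ_of_le hn⟩
      exact Prod.ext_iff.1 this
    refine Subtype.ext (Prod.ext ?_ ?_)
    · refine (ext_iff_natDegree_le (n := b) ?_ ?_).2 fun n hn => (hc n hn).1
      · rw [p.2.2.2.1]; exact hab.le
      · rw [p'.2.2.2.1]; exact hab.le
    · exact (ext_iff_natDegree_le p.2.2.2.2.1.le p'.2.2.2.2.1.le).2 fun n hn => (hc n hn).2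
  have hrange : (Set.range φ).Finite := by
    refine (Set.Finite.pi' fun i : Fin (b + 1) => (hfin i).1.prod (hfin i).2).subset ?_
    rintro _ ⟨p, rfl⟩ i
    exact ⟨⟨p, hR _ _⟩, ⟨p, hQ _ _⟩⟩
  have : Finite S := by
    have := hrange.to_subtype
    exact Finite.of_injective _ (Set.rangeFactorization_injective.2 hφ)
  exact Set.toFinite S

/-- A two-dimensional space of polynomials contains a normalized pair. -/
theorem exists_monic_pair_mem_of_finrank_eq_two {k : Type*} [Field k] {V : Submodule k k[X]}
    (hV : Module.finrank k V = 2) :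
    ∃ r ∈ V, ∃ q ∈ V, r.Monic ∧ q.Monic ∧ r.natDegree < q.natDegree ∧
      q.coeff r.natDegree = 0 := by
  classical
  have hmonic : ∀ p ∈ V, p ≠ 0 → C p.leadingCoeff⁻¹ * p ∈ V := fun p hp _ => by
    rw [← smul_eq_C_mul]; exact V.smul_mem _ hp
  have hex : ∃ n, ∃ p ∈ V, p ≠ 0 ∧ p.natDegree = n := by
    obtain ⟨p, hp, hp0⟩ := V.exists_mem_ne_zero_of_ne_bot (by rintro rfl; simp at hV)
    exact ⟨_, p, hp, hp0, rfl⟩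
  obtain ⟨p, hp, hp0, hpn⟩ := Nat.find_spec hex
  have hmin : ∀ x ∈ V, x ≠ 0 → p.natDegree ≤ x.natDegree := fun x hx hx0 => by
    rw [hpn]; exact Nat.find_min' hex ⟨x, hx, hx0, rfl⟩
  set r := C p.leadingCoeff⁻¹ * p with hr
  have hrm : r.Monic := by
    rw [hr, mul_comm]; exact monic_mul_leadingCoeff_inv hp0
  have hrd : r.natDegree = p.natDegree :=
    natDegree_C_mul (inv_ne_zero (leadingCoeff_ne_zero.2 hp0))
  have hrV : r ∈ V := hmonic p hp hp0
  obtain ⟨s, hs, hsr⟩ : ∃ s ∈ V, s ∉ k ∙ r := by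
    by_contra! h
    have h1 : Module.finrank k V ≤ Module.finrank k (k ∙ r) := Submodule.finrank_mono h
    have h2 := finrank_span_singleton (K := k) hrm.ne_zero
    lia
  set t := s - s.coeff r.natDegree • r with ht
  have htV : t ∈ V := V.sub_mem hs (V.smul_mem _ hrV)
  have ht0 : t ≠ 0 := fun h => hsr (Submodule.mem_span_singleton.2 ⟨_, (sub_eq_zero.1 h).symm⟩)
  have htc : t.coeff r.natDegree = 0 := by
    rw [ht, coeff_sub, coeff_smul, hrm.coeff_natDegree, smul_eq_mul, mul_one, sub_self]
  refine ⟨r, hrV, _, hmonic t htV ht0, hrm, ?_, ?_, ?_⟩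
  · rw [mul_comm]; exact monic_mul_leadingCoeff_inv ht0
  · rw [natDegree_C_mul (inv_ne_zero (leadingCoeff_ne_zero.2 ht0))]
    refine lt_of_le_of_ne (hrd.le.trans (hmin t htV ht0)) fun h => ht0 ?_
    rwa [h, coeff_natDegree, leadingCoeff_eq_zero] at htc
  · rw [coeff_C_mul, htc, mul_zero]

/-- Pairs in the span of `r, q` have Wronskian proportional to that of `r, q`. -/
theorem exists_wronskian_eq_smul_of_mem_span_pair {k : Type*} [Field k] {r q r' q' : k[X]}
    (hr : r' ∈ Submodule.span k {r, q}) (hq : q' ∈ Submodule.span k {r, q}) :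
    ∃ c : k, wronskian r' q' = c • wronskian r q := by
  obtain ⟨x, y, rfl⟩ := Submodule.mem_span_pair.1 hr
  obtain ⟨z, t, rfl⟩ := Submodule.mem_span_pair.1 hq
  refine ⟨x * t - y * z, ?_⟩
  simp only [wronskian, smul_eq_C_mul, derivative_add, derivative_C_mul, C_sub, C_mul]
  ring

end Polynomial

/-- The Wronski map on the Grassmannian `G(2, d+1)` has finite fibers (Section 7):
for a nonzero polynomial `w` of degree at most `2d−2`, there are only finitely many
two-dimensional subspaces `V` of the space of complex polynomials of degree at most `d`
such that the Wronskian of some basis of `V` is a nonzero scalar multiple of `w`. -/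
theorem wronski_map_finite_fibers (d : ℕ) (hd : 1 ≤ d) (w : ℂ[X]) (hw : w ≠ 0)
    (hwdeg : w.degree ≤ (2 * d - 2 : ℕ)) :
    {V : Submodule ℂ ℂ[X] | V ≤ Polynomial.degreeLE ℂ (d : ℕ) ∧
      Module.finrank ℂ V = 2 ∧
      ∃ r q : ℂ[X], r ∈ V ∧ q ∈ V ∧ Submodule.span ℂ {r, q} = V ∧
        ∃ c : ℂ, c ≠ 0 ∧ r * derivative q - derivative r * q = c • w}.Finite := by
  let S : ℕ × ℕ → Set (ℂ[X] × ℂ[X]) := fun n =>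
    {p | p.1.Monic ∧ p.2.Monic ∧ p.1.natDegree = n.1 ∧ p.2.natDegree = n.2 ∧
      p.2.coeff n.1 = 0 ∧
      wronskian p.1 p.2 = (((n.2 : ℂ) - n.1) / (X * w).coeff (n.1 + n.2)) • w}
  let I : Set (ℕ × ℕ) := {n | n.1 < n.2 ∧ n.2 ≤ d}
  have hI : I.Finite := ((Set.finite_Iic d).prod (Set.finite_Iic d)).subset fun n hn =>
    ⟨hn.1.le.trans hn.2, hn.2⟩
  refine ((hI.biUnion fun n hn => finite_setOf_monic_wronskian_eq hn.1
    ((((n.2 : ℂ) - n.1) / (X * w).coeff (n.1 + n.2)) • w)).image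
      fun p => Submodule.span ℂ {p.1, p.2}).subset ?_
  rintro V ⟨hVd, hV, r₀, q₀, -, -, hspan, c, -, hc⟩
  obtain ⟨r, hr, q, hq, hrm, hqm, hlt, h0⟩ := exists_monic_pair_mem_of_finrank_eq_two hV
  obtain ⟨c', hc'⟩ := exists_wronskian_eq_smul_of_mem_span_pair (hspan.symm ▸ hr) (hspan.symm ▸ hq)
  rw [show wronskian r₀ q₀ = c • w from hc, smul_smul] at hc'
  have htop := coeff_X_mul_wronskian (le_refl r.natDegree) (le_refl q.natDegree)
  rw [hrm.coeff_natDegree, hqm.coeff_natDegree, mul_one, mul_one] at htop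
  have hne : (q.natDegree : ℂ) - r.natDegree ≠ 0 := sub_ne_zero.2 (by exact_mod_cast hlt.ne')
  have hscale : ((q.natDegree : ℂ) - r.natDegree) / (X * w).coeff (r.natDegree + q.natDegree) =
      c' * c := by
    rw [hc', mul_smul_comm, coeff_smul, smul_eq_mul] at htop
    rw [← htop] at hne ⊢
    exact mul_div_cancel_right₀ _ (right_ne_zero_of_mul hne)
  refine ⟨(r, q), Set.mem_biUnion (x := (r.natDegree, q.natDegree)) ⟨hlt, ?_⟩
    ⟨hrm, hqm, rfl, rfl, h0, by rw [hc', hscale]⟩, ?_⟩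
  · exact natDegree_le_iff_degree_le.2 (mem_degreeLE.1 (hVd hq))
  · have hind : LinearIndependent ℂ ![r, q] := by
      rw [LinearIndependent.pair_iff' hrm.ne_zero]
      rintro x rfl
      exact absurd (natDegree_smul_le x r) hlt.not_ge
    have : FiniteDimensional ℂ V := Module.finite_of_finrank_eq_succ hV
    refine Submodule.eq_of_le_of_finrank_eq ?_ ?_
    · rw [Submodule.span_le]
      rintro _ (rfl | rfl)
      exacts [hr, hq]
    · have := finrank_span_eq_card hind
      rw [Matrix.range_cons_cons_empty] at this
      rw [this, hV, Fintype.card_fin]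
end
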